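/- arXiv:2301.01591 — 2 statements merged into one kernel-verified Lean document; each statement's English description precedes it below -/
import Mathlib

section
/- For every α ∈ (0,1), the limit lim_{n→∞} (1/n) · log ( sup { ‖p‖_{[−1,1]} / ‖p‖_{E_n} : p a real polynomial, p not identically zero, deg p ≤ α·n } ) exists and equals C(α) = ((1+α)·log(1+α) + (1−α)·log(1−α))/2. -/
open MeasureTheory Polynomial Filter Set

/-- The `n`-grid: `n` equally spaced points in `[-1,1]` including the endpoints. -/
noncomputable def nGrid (n : ℕ) : Set ℝ :=
  {x | ∃ k : ℕ, 1 ≤ k ∧ k ≤ n ∧ x = (2 * (k : ℝ) - n - 1) / ((n : ℝ) - 1)}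

/-- Uniform norm of a real polynomial on the interval `[-1,1]`. -/
noncomputable def normI (p : Polynomial ℝ) : ℝ :=
  sSup ((fun x => |p.eval x|) '' Set.Icc (-1 : ℝ) 1)

/-- Uniform norm of a real polynomial on the `n`-grid. -/
noncomputable def normE (n : ℕ) (p : Polynomial ℝ) : ℝ :=
  sSup ((fun x => |p.eval x|) '' nGrid n)

/-- The constant `C(α)`. -/
noncomputable def Cconst (α : ℝ) : ℝ :=
  ((1 + α) * Real.log (1 + α) + (1 - α) * Real.log (1 - α)) / 2

namespace DiscreteChebyshev

/-! ### Generalized binomial polynomials -/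

/-- The polynomial `x ↦ x (x - 1) ⋯ (x - k + 1) / k!`. -/
noncomputable def choosePoly (k : ℕ) : ℝ[X] :=
  C ((k.factorial : ℝ)⁻¹) * descPochhammer ℝ k

lemma choosePoly_zero : choosePoly 0 = 1 := by simp [choosePoly]

lemma eval_choosePoly_natCast (k x : ℕ) : (choosePoly k).eval (x : ℝ) = (x.choose k : ℝ) := by
  rw [choosePoly, eval_mul, eval_C, descPochhammer_eval_eq_descFactorial,
    Nat.descFactorial_eq_factorial_mul_choose]
  have : (k.factorial : ℝ) ≠ 0 := by positivity
  push_cast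
  field_simp

lemma choosePoly_succ_eval (k : ℕ) (x : ℝ) :
    ((k : ℝ) + 1) * (choosePoly (k + 1)).eval x = (x - k) * (choosePoly k).eval x := by
  have h : (k.factorial : ℝ) ≠ 0 := by positivity
  simp only [choosePoly, eval_mul, eval_C, descPochhammer_succ_eval, Nat.factorial_succ]
  push_cast
  field_simp

lemma choosePoly_succ_eval_left (k : ℕ) (x : ℝ) :
    ((k : ℝ) + 1) * (choosePoly (k + 1)).eval x = x * (choosePoly k).eval (x - 1) := by
  have h : (k.factorial : ℝ) ≠ 0 := by positivity
  simp only [choosePoly, eval_mul, eval_C, descPochhammer_succ_left, Nat.factorial_succ, eval_X,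
    eval_comp, eval_sub, eval_one]
  push_cast
  field_simp

lemma choosePoly_eval_zero {k : ℕ} (hk : k ≠ 0) : (choosePoly k).eval 0 = 0 := by
  rw [choosePoly, eval_mul, descPochhammer_ne_zero_eval_zero ℝ hk, mul_zero]

lemma natDegree_choosePoly (k : ℕ) : (choosePoly k).natDegree = k := by
  rw [choosePoly, natDegree_C_mul (by positivity), descPochhammer_natDegree]

lemma abs_eval_choosePoly_le_one (k : ℕ) {x : ℝ} (hx : x ∈ Set.Icc (0 : ℝ) 1) :
    |(choosePoly k).eval x| ≤ 1 := by
  induction k with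
  | zero => simp [choosePoly_zero]
  | succ k ih =>
    have h := congrArg abs (choosePoly_succ_eval k x)
    have hk : (0 : ℝ) ≤ k := k.cast_nonneg
    rw [abs_mul, abs_mul, abs_of_pos (by positivity : (0 : ℝ) < k + 1)] at h
    have h1 : |x - k| ≤ k + 1 := by
      rw [abs_le]; constructor <;> linarith [hx.1, hx.2]
    have h2 : |x - k| * |(choosePoly k).eval x| ≤ (k + 1) * 1 := by gcongr
    exact le_of_mul_le_mul_left (h.trans_le h2) (by positivity)

/-- At `1 / 2` the binomial polynomials alternate in sign and decay polynomially. -/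
lemma choosePoly_eval_half (k : ℕ) :
    1 / (2 * ((k : ℝ) + 1) ^ 2) ≤ (-1) ^ k * (choosePoly (k + 1)).eval (1 / 2) := by
  induction k with
  | zero =>
    have h := choosePoly_succ_eval 0 (1 / 2)
    simp only [choosePoly_zero, eval_one, Nat.cast_zero, zero_add, one_mul] at h
    rw [zero_add, h]
    norm_num
  | succ k ih =>
    have h := choosePoly_succ_eval (k + 1) (1 / 2)
    have e : (-1) ^ (k + 1) * (choosePoly (k + 1 + 1)).eval (1 / 2 : ℝ) =
        ((k : ℝ) + 1 / 2) / (k + 2) * ((-1) ^ k * (choosePoly (k + 1)).eval (1 / 2)) := by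
      push_cast at h
      field_simp
      rw [pow_succ]
      linear_combination (-2 * (-1 : ℝ) ^ k) * h
    rw [e]
    refine le_trans ?_ (mul_le_mul_of_nonneg_left ih (by positivity))
    push_cast
    rw [div_mul_div_comm, div_le_div_iff₀ (by positivity) (by positivity)]
    have : (0 : ℝ) ≤ k := k.cast_nonneg
    nlinarith [mul_nonneg this this, mul_nonneg (mul_nonneg this this) this]

/-! ### The difference operator -/

/-- The self-adjoint second order difference operator on `{0, …, N}`. -/
def diffOp (N : ℕ) (f : ℝ → ℝ) (x : ℝ) : ℝ :=
  (x + 1) * (N - x) * (f (x + 1) - f x) - x * (N + 1 - x) * (f x - f (x - 1))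

lemma diffOp_choosePoly_zero (N : ℕ) (x : ℝ) : diffOp N (fun y => (choosePoly 0).eval y) x = 0 := by
  simp [diffOp, choosePoly_zero]

lemma diffOp_choosePoly_succ (N k : ℕ) (x : ℝ) :
    diffOp N (fun y => (choosePoly (k + 1)).eval y) x =
      -((k + 1) * (k + 2)) * (choosePoly (k + 1)).eval x
        + (k + 1) * (N - k) * (choosePoly k).eval x := by
  have h1 := choosePoly_succ_eval k x
  have h2 := choosePoly_succ_eval_left k x
  have h3 := choosePoly_succ_eval k (x - 1)
  have h4 := choosePoly_succ_eval_left k (x + 1)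
  rw [add_sub_cancel_right] at h4
  have hk : (k : ℝ) + 1 ≠ 0 := by positivity
  have e1 : (choosePoly (k + 1)).eval (x + 1) - (choosePoly (k + 1)).eval x
      = (choosePoly k).eval x := by
    apply mul_left_cancel₀ hk; linear_combination h4 - h1
  have e2 : x * ((choosePoly (k + 1)).eval x - (choosePoly (k + 1)).eval (x - 1))
      = (k + 1) * (choosePoly (k + 1)).eval x := by
    apply mul_left_cancel₀ hk; linear_combination x * h2 - x * h3 - (k + 1) * h2
  simp only [diffOp]
  linear_combination (x + 1) * (N - x) * e1 - (N + 1 - x) * e2 + (k + 1 - N + x) * h1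

lemma diffOp_sum (N : ℕ) (s : Finset ℕ) (c : ℕ → ℝ) (f : ℕ → ℝ → ℝ) (x : ℝ) :
    diffOp N (fun y => ∑ k ∈ s, c k * f k y) x = ∑ k ∈ s, c k * diffOp N (f k) x := by
  simp only [diffOp, ← Finset.sum_sub_distrib, Finset.mul_sum]
  exact Finset.sum_congr rfl fun k _ => by ring

/-- The inner product of two functions on the grid `{0, …, N}`. -/
def gridInner (N : ℕ) (f g : ℝ → ℝ) : ℝ := ∑ x ∈ Finset.range (N + 1), f x * g x

lemma gridInner_comm (N : ℕ) (f g : ℝ → ℝ) : gridInner N f g = gridInner N g f :=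
  Finset.sum_congr rfl fun _ _ => mul_comm _ _

lemma gridInner_sum_right (N : ℕ) (s : Finset ℕ) (c : ℕ → ℝ) (f : ℝ → ℝ) (g : ℕ → ℝ → ℝ) :
    gridInner N f (fun x => ∑ k ∈ s, c k * g k x) = ∑ k ∈ s, c k * gridInner N f (g k) := by
  simp only [gridInner, Finset.mul_sum]
  rw [Finset.sum_comm]
  exact Finset.sum_congr rfl fun k _ => Finset.sum_congr rfl fun x _ => by ring

lemma gridInner_diffOp (N : ℕ) (f g : ℝ → ℝ) :
    gridInner N (diffOp N f) g = gridInner N f (diffOp N g) := by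
  set W : ℕ → ℝ := fun x => (x : ℝ) * (N + 1 - x) * (f x * g (x - 1) - f (x - 1) * g x) with hW
  have h : ∑ x ∈ Finset.range (N + 1), (W (x + 1) - W x) = 0 := by
    rw [Finset.sum_range_sub, hW]
    simp
  rw [← sub_eq_zero, gridInner, gridInner, ← Finset.sum_sub_distrib, ← h]
  refine Finset.sum_congr rfl fun x _ => ?_
  simp only [hW, diffOp]
  push_cast
  rw [add_sub_cancel_right]
  ring

/-! ### Discrete Chebyshev polynomials -/

/-- The coefficients of the discrete Chebyshev polynomials in the binomial basis. -/
noncomputable def chebCoeff (N j k : ℕ) : ℝ :=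
  (-1) ^ k * ((j + k).choose j * (N - k).choose (N - j)) / N.choose j

lemma chebCoeff_zero {N j : ℕ} (hj : j ≤ N) : chebCoeff N j 0 = 1 := by
  have : (N.choose j : ℝ) ≠ 0 := by exact_mod_cast (Nat.choose_pos hj).ne'
  simp [chebCoeff, Nat.choose_symm hj, this]

lemma chebCoeff_succ {N j k : ℕ} (hj : j ≤ N) (hk : k < j) :
    ((k : ℝ) + 1) * (N - k) * chebCoeff N j (k + 1) =
      (k * (k + 1) - j * (j + 1)) * chebCoeff N j k := by
  have hN : (N.choose j : ℝ) ≠ 0 := by exact_mod_cast (Nat.choose_pos hj).ne'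
  have h1 : ((k : ℝ) + 1) * (j + (k + 1)).choose j = (j + k + 1) * (j + k).choose j := by
    have := Nat.choose_mul_succ_eq (j + k) j
    rw [show j + k + 1 - j = k + 1 by omega] at this
    have h : (((j + k).choose j * (j + k + 1) : ℕ) : ℝ) = ((j + k + 1).choose j * (k + 1) : ℕ) :=
      congrArg _ this
    push_cast at h
    rw [← add_assoc]
    linarith
  have h2 : ((N : ℝ) - k) * (N - (k + 1)).choose (N - j) = (j - k) * (N - k).choose (N - j) := by
    have := Nat.choose_mul_succ_eq (N - (k + 1)) (N - j)
    rw [show N - (k + 1) + 1 = N - k by omega, show N - k - (N - j) = j - k by omega] at this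
    have h : (((N - (k + 1)).choose (N - j) * (N - k) : ℕ) : ℝ) =
      ((N - k).choose (N - j) * (j - k) : ℕ) := congrArg _ this
    rw [Nat.cast_mul, Nat.cast_mul, Nat.cast_sub (by omega), Nat.cast_sub (by omega)] at h
    linarith
  simp only [chebCoeff]
  field_simp
  rw [pow_succ]
  linear_combination (-(-1) ^ k * ((N : ℝ) - k) * (N - (k + 1)).choose (N - j)) * h1
    - (-1) ^ k * ((j : ℝ) + k + 1) * (j + k).choose j * h2

/-- The discrete Chebyshev polynomial of degree `j` on `{0, …, N}`, equal to `1` at `0`. -/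
noncomputable def chebPoly (N j : ℕ) : ℝ[X] :=
  ∑ k ∈ Finset.range (j + 1), C (chebCoeff N j k) * choosePoly k

lemma eval_chebPoly (N j : ℕ) (x : ℝ) : (chebPoly N j).eval x =
    ∑ k ∈ Finset.range (j + 1), chebCoeff N j k * (choosePoly k).eval x := by
  simp [chebPoly, eval_finsetSum]

lemma eval_chebPoly_zero {N j : ℕ} (hj : j ≤ N) : (chebPoly N j).eval 0 = 1 := by
  rw [eval_chebPoly, Finset.sum_range_succ']
  simp [choosePoly_eval_zero, choosePoly_zero, chebCoeff_zero hj]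

lemma diffOp_chebPoly {N j : ℕ} (hj : j ≤ N) (x : ℝ) :
    diffOp N (fun y => (chebPoly N j).eval y) x = -(j * (j + 1)) * (chebPoly N j).eval x := by
  simp only [eval_chebPoly]
  rw [diffOp_sum, Finset.sum_range_succ', diffOp_choosePoly_zero, mul_zero, add_zero,
    Finset.mul_sum]
  have h : ∀ k ∈ Finset.range j,
      chebCoeff N j (k + 1) * diffOp N (fun y => (choosePoly (k + 1)).eval y) x
      = -((k + 1 : ℕ) * ((k + 1 : ℕ) + 1)) * chebCoeff N j (k + 1) * (choosePoly (k + 1)).eval x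
        + (k * (k + 1) - j * (j + 1)) * chebCoeff N j k * (choosePoly k).eval x := by
    intro k hk
    rw [diffOp_choosePoly_succ]
    push_cast
    linear_combination (choosePoly k).eval x * chebCoeff_succ hj (Finset.mem_range.1 hk)
  rw [Finset.sum_congr rfl h, Finset.sum_add_distrib]
  have h1 := Finset.sum_range_succ' (fun k : ℕ =>
    -((k : ℝ) * (k + 1)) * chebCoeff N j k * (choosePoly k).eval x) j
  have h2 := Finset.sum_range_succ (fun k : ℕ =>
    ((k : ℝ) * (k + 1) - j * (j + 1)) * chebCoeff N j k * (choosePoly k).eval x) j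
  have h3 : ∑ k ∈ Finset.range (j + 1), -((j : ℝ) * (j + 1)) *
      (chebCoeff N j k * (choosePoly k).eval x) =
      (∑ k ∈ Finset.range (j + 1), -((k : ℝ) * (k + 1)) * chebCoeff N j k * (choosePoly k).eval x)
      + ∑ k ∈ Finset.range (j + 1),
        ((k : ℝ) * (k + 1) - j * (j + 1)) * chebCoeff N j k * (choosePoly k).eval x := by
    rw [← Finset.sum_add_distrib]
    exact Finset.sum_congr rfl fun k _ => by ring
  rw [h3, h1, h2]
  simp

/-! ### Norms and orthogonality -/

/-- Inner products of discrete Chebyshev polynomials with binomial polynomials. -/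
lemma gridInner_chebPoly_choosePoly_succ {N j : ℕ} (hj : j ≤ N) (k : ℕ) :
    ((k + 1) * (k + 2) - j * (j + 1)) *
      gridInner N (fun x => (chebPoly N j).eval x) (fun x => (choosePoly (k + 1)).eval x) =
    (k + 1) * (N - k) *
      gridInner N (fun x => (chebPoly N j).eval x) (fun x => (choosePoly k).eval x) := by
  have h := gridInner_diffOp N (fun x => (chebPoly N j).eval x)
    (fun x => (choosePoly (k + 1)).eval x)
  have e1 : gridInner N (diffOp N fun x => (chebPoly N j).eval x)
      (fun x => (choosePoly (k + 1)).eval x) = -(j * (j + 1)) *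
      gridInner N (fun x => (chebPoly N j).eval x) (fun x => (choosePoly (k + 1)).eval x) := by
    simp only [gridInner, Finset.mul_sum, diffOp_chebPoly hj]
    exact Finset.sum_congr rfl fun _ _ => by ring
  have e2 : gridInner N (fun x => (chebPoly N j).eval x)
      (diffOp N fun x => (choosePoly (k + 1)).eval x) = -((k + 1) * (k + 2)) *
      gridInner N (fun x => (chebPoly N j).eval x) (fun x => (choosePoly (k + 1)).eval x) +
      (k + 1) * (N - k) *
      gridInner N (fun x => (chebPoly N j).eval x) (fun x => (choosePoly k).eval x) := by
    simp only [gridInner, Finset.mul_sum, diffOp_choosePoly_succ, ← Finset.sum_add_distrib]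
    exact Finset.sum_congr rfl fun _ _ => by ring
  linear_combination h - e1 + e2

lemma gridInner_chebPoly_choosePoly_of_lt {N j k : ℕ} (hj : j ≤ N) (hk : k < j) :
    gridInner N (fun x => (chebPoly N j).eval x) (fun x => (choosePoly k).eval x) = 0 := by
  have hlt : ∀ i : ℕ, i < j → ((i : ℝ) * (i + 1) - j * (j + 1)) ≠ 0 := by
    intro i hi
    have : (i : ℝ) < j := by exact_mod_cast hi
    have h0 : (0 : ℝ) ≤ i := i.cast_nonneg
    nlinarith
  induction k with
  | zero =>
    have h := gridInner_diffOp N (fun x => (chebPoly N j).eval x) (fun x => (choosePoly 0).eval x)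
    have e1 : gridInner N (diffOp N fun x => (chebPoly N j).eval x)
        (fun x => (choosePoly 0).eval x) = -(j * (j + 1)) *
        gridInner N (fun x => (chebPoly N j).eval x) (fun x => (choosePoly 0).eval x) := by
      simp only [gridInner, Finset.mul_sum, diffOp_chebPoly hj]
      exact Finset.sum_congr rfl fun _ _ => by ring
    have e2 : gridInner N (fun x => (chebPoly N j).eval x)
        (diffOp N fun x => (choosePoly 0).eval x) = 0 := by
      simp [gridInner, diffOp_choosePoly_zero]
    have := hlt 0 hk
    apply (mul_eq_zero.1 (_ : ((0 : ℕ) * ((0 : ℕ) + 1) - j * (j + 1) : ℝ) * _ = 0)).resolve_left this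
    push_cast
    linear_combination h - e1 + e2
  | succ k ih =>
    have h := gridInner_chebPoly_choosePoly_succ hj k
    rw [ih (by omega), mul_zero] at h
    refine (mul_eq_zero.1 h).resolve_left ?_
    have := hlt (k + 1) hk
    push_cast at this
    rwa [add_assoc, one_add_one_eq_two] at this

lemma gridInner_chebPoly_choosePoly_add {N j : ℕ} (hj : j ≤ N) (i : ℕ) (hi : i ≤ N - j) :
    gridInner N (fun x => (chebPoly N j).eval x) (fun x => (choosePoly (j + i)).eval x) *
      (j.factorial * (N - j - i).factorial * i.factorial * (2 * j + 1 + i).factorial) =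
    gridInner N (fun x => (chebPoly N j).eval x) (fun x => (choosePoly j).eval x) *
      ((j + i).factorial * (N - j).factorial * (2 * j + 1).factorial) := by
  induction i with
  | zero => simp
  | succ i ih =>
    have h := gridInner_chebPoly_choosePoly_succ hj (j + i)
    have ih := ih (by omega)
    obtain ⟨r, hr⟩ : ∃ r, N = j + i + 1 + r := ⟨N - j - i - 1, by omega⟩
    have hN : (N : ℝ) = j + i + 1 + r := by rw [hr]; push_cast; ring
    rw [show N - j - (i + 1) = r by omega]
    rw [show N - j - i = r + 1 by omega] at ih
    rw [← add_assoc, ← add_assoc, Nat.factorial_succ i, Nat.factorial_succ (2 * j + 1 + i),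
      Nat.factorial_succ (j + i)]
    rw [Nat.factorial_succ r] at ih
    rw [hN] at h
    push_cast at h ih ⊢
    have hr1 : (r : ℝ) + 1 ≠ 0 := by positivity
    apply mul_left_cancel₀ hr1
    linear_combination (j.factorial * r.factorial * i.factorial * (2 * j + 1 + i).factorial : ℝ)
      * (r + 1) * h + (j + i + 1) * (r + 1) * ih

lemma eq_zero_of_diffOp_eq {N : ℕ} {μ : ℝ} {f : ℝ → ℝ} (hf : ∀ x, diffOp N f x = μ * f x)
    (h0 : f 0 = 0) (x : ℕ) (hx : x ≤ N) : f x = 0 := by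
  induction x using Nat.strong_induction_on with
  | _ x ih =>
    rcases x with _ | x
    · simpa using h0
    have hfx := ih x (by omega) (by omega)
    have hprev : (x : ℝ) * f (x - 1) = 0 := by
      rcases x with _ | z
      · simp
      · have := ih z (by omega) (by omega)
        push_cast
        rw [add_sub_cancel_right, this, mul_zero]
    have h := hf x
    rw [diffOp, hfx] at h
    have hxN : (x : ℝ) + 1 ≤ N := by exact_mod_cast hx
    have h2 : ((x : ℝ) + 1) * (N - x) * f (x + 1) = 0 := by
      linear_combination h - (N + 1 - x) * hprev
    have h3 : ((x : ℝ) + 1) * (N - x) ≠ 0 := by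
      have : (0 : ℝ) ≤ x := x.cast_nonneg
      apply ne_of_gt; apply mul_pos <;> linarith
    push_cast
    exact (mul_eq_zero.1 h2).resolve_left h3

lemma eval_chebPoly_reflect {N j : ℕ} (hj : j ≤ N) (x : ℕ) (hx : x ≤ N) :
    (chebPoly N j).eval ((N : ℝ) - x) =
      (chebPoly N j).eval (N : ℝ) * (chebPoly N j).eval (x : ℝ) := by
  rw [← sub_eq_zero]
  refine eq_zero_of_diffOp_eq (N := N) (μ := -(j * (j + 1)))
    (f := fun x => (chebPoly N j).eval ((N : ℝ) - x) -
      (chebPoly N j).eval (N : ℝ) * (chebPoly N j).eval x) ?_ ?_ x hx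
  · intro x
    have h1 := diffOp_chebPoly hj x
    have h2 := diffOp_chebPoly hj (N - x)
    simp only [diffOp] at h1 h2 ⊢
    rw [show (N : ℝ) - (x + 1) = N - x - 1 by ring, show (N : ℝ) - (x - 1) = N - x + 1 by ring]
    linear_combination h2 - (chebPoly N j).eval (N : ℝ) * h1
  · simp [eval_chebPoly_zero hj]

lemma sq_eval_chebPoly_right {N j : ℕ} (hj : j ≤ N) : (chebPoly N j).eval (N : ℝ) ^ 2 = 1 := by
  have := eval_chebPoly_reflect hj N le_rfl
  rw [sub_self, eval_chebPoly_zero hj] at this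
  rw [sq, this]

/-- The sum of the absolute values of the coefficients `chebCoeff N j k`. -/
noncomputable def chebMass (N j : ℕ) : ℝ :=
  (N + 1 + j).factorial * (N - j).factorial / ((N + 1).factorial * N.factorial)

lemma chebMass_pos (N j : ℕ) : 0 < chebMass N j := by unfold chebMass; positivity

/-- The squared grid norm of the discrete Chebyshev polynomial. -/
noncomputable def chebNormSq (N j : ℕ) : ℝ :=
  gridInner N (fun x => (chebPoly N j).eval x) (fun x => (chebPoly N j).eval x)

lemma chebNormSq_nonneg (N j : ℕ) : 0 ≤ chebNormSq N j := by
  unfold chebNormSq gridInner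
  exact Finset.sum_nonneg fun x _ => mul_self_nonneg ((chebPoly N j).eval (x : ℝ))

lemma two_mul_add_one_mul_chebNormSq {N j : ℕ} (hj : j ≤ N) :
    (2 * j + 1) * chebNormSq N j = (N + 1) * chebMass N j := by
  set u := gridInner N (fun x => (chebPoly N j).eval x) (fun x => (choosePoly j).eval x) with hu
  have h1 : chebNormSq N j = chebCoeff N j j * u := by
    have e : chebNormSq N j = gridInner N (fun x => (chebPoly N j).eval x)
        (fun x => ∑ k ∈ Finset.range (j + 1), chebCoeff N j k * (choosePoly k).eval x) := by
      simp only [chebNormSq, ← eval_chebPoly]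
    rw [e, gridInner_sum_right, Finset.sum_range_succ, Finset.sum_eq_zero, zero_add]
    intro k hk
    rw [gridInner_chebPoly_choosePoly_of_lt hj (Finset.mem_range.1 hk), mul_zero]
  have h2 : gridInner N (fun x => (chebPoly N j).eval x) (fun x => (choosePoly N).eval x) =
      (chebPoly N j).eval (N : ℝ) := by
    rw [gridInner, Finset.sum_range_succ, Finset.sum_eq_zero]
    · simp [eval_choosePoly_natCast]
    · intro x hx
      simp [eval_choosePoly_natCast, Nat.choose_eq_zero_of_lt (Finset.mem_range.1 hx)]
  have h3 := gridInner_chebPoly_choosePoly_add hj (N - j) le_rfl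
  rw [Nat.add_sub_cancel' hj, h2, ← hu, Nat.sub_self, Nat.factorial_zero,
    show 2 * j + 1 + (N - j) = N + 1 + j by omega] at h3
  have hρ : |(chebPoly N j).eval (N : ℝ)| = 1 := by
    rw [← sq_eq_sq₀ (abs_nonneg _) zero_le_one, sq_abs, sq_eval_chebPoly_right hj, one_pow]
  have h4 := congrArg abs h3
  rw [abs_mul (eval _ _), abs_mul u, hρ, Nat.cast_one, mul_one, one_mul,
    abs_of_nonneg (by positivity),
    abs_of_nonneg (by positivity : (0 : ℝ) ≤ N.factorial * (N - j).factorial *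
      (2 * j + 1).factorial)] at h4
  have h5 : |chebCoeff N j j| * (j.factorial * N.factorial) =
      (2 * j).factorial * (N - j).factorial := by
    have e1 : ((2 * j).factorial : ℝ) = (j + j).choose j * j.factorial * j.factorial := by
      rw [two_mul, ← Nat.add_choose_mul_factorial_mul_factorial j j]; push_cast; ring
    have e2 : (N.factorial : ℝ) = N.choose j * j.factorial * (N - j).factorial := by
      exact_mod_cast (Nat.choose_mul_factorial_mul_factorial hj).symm
    have hN : (0 : ℝ) < N.choose j := by exact_mod_cast Nat.choose_pos hj
    rw [chebCoeff, abs_div, abs_mul, abs_pow, abs_neg, abs_one, one_pow, one_mul, abs_of_pos hN,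
      abs_of_nonneg (by positivity), Nat.choose_self, e1, e2]
    field_simp
    simp
  have h6 : chebNormSq N j = |chebCoeff N j j| * |u| := by
    rw [← abs_mul, ← h1, abs_of_nonneg (chebNormSq_nonneg N j)]
  rw [h6, chebMass]
  have hj0 : (j.factorial : ℝ) ≠ 0 := by positivity
  have hNj : ((N - j).factorial : ℝ) ≠ 0 := by positivity
  have h2j : ((2 * j).factorial : ℝ) ≠ 0 := by positivity
  have hN0 : (N.factorial : ℝ) ≠ 0 := by positivity
  rw [Nat.factorial_succ (2 * j)] at h4
  rw [Nat.factorial_succ N]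
  push_cast at h4 ⊢
  field_simp
  have key : (j.factorial * (N - j).factorial * (2 * j).factorial : ℝ) *
      ((2 * j + 1) * |chebCoeff N j j| * |u| * N.factorial ^ 2) =
      (j.factorial * (N - j).factorial * (2 * j).factorial) *
        ((N + 1 + j).factorial * (N - j).factorial) := by
    linear_combination (-|chebCoeff N j j| * (j.factorial * N.factorial)) * h4
      + (j.factorial * (N - j).factorial * (N + 1 + j).factorial : ℝ) * h5
  have := mul_left_cancel₀ (by positivity) key
  linear_combination this

lemma gridInner_chebPoly_of_lt {N i j : ℕ} (hj : j ≤ N) (hi : i < j) :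
    gridInner N (fun x => (chebPoly N j).eval x) (fun x => (chebPoly N i).eval x) = 0 := by
  simp only [eval_chebPoly N i]
  rw [gridInner_sum_right]
  refine Finset.sum_eq_zero fun k hk => ?_
  have := Finset.mem_range.1 hk
  rw [gridInner_chebPoly_choosePoly_of_lt hj (by omega), mul_zero]

lemma gridInner_chebPoly_of_ne {N i j : ℕ} (hi : i ≤ N) (hj : j ≤ N) (hij : i ≠ j) :
    gridInner N (fun x => (chebPoly N i).eval x) (fun x => (chebPoly N j).eval x) = 0 := by
  rcases lt_or_gt_of_ne hij with h | h
  · rw [gridInner_comm, gridInner_chebPoly_of_lt hj h]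
  · exact gridInner_chebPoly_of_lt hi h

lemma sum_range_choose_mul_choose (M p q : ℕ) :
    ∑ a ∈ Finset.range (M + 1), a.choose p * (M - a).choose q = (M + 1).choose (p + q + 1) := by
  induction M generalizing q with
  | zero =>
    rcases p with _ | p <;> rcases q with _ | q <;> simp [Nat.choose_eq_zero_of_lt]
  | succ M ih =>
    rw [Finset.sum_range_succ]
    rcases q with _ | q
    · have := ih 0
      simp only [Nat.choose_zero_right, mul_one] at this ⊢
      rw [this, add_zero, Nat.choose_succ_succ' (M + 1) p, add_comm]
    · have h : ∀ a ∈ Finset.range (M + 1), a.choose p * (M + 1 - a).choose (q + 1) =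
          a.choose p * (M - a).choose q + a.choose p * (M - a).choose (q + 1) := by
        intro a ha
        have := Finset.mem_range.1 ha
        rw [show M + 1 - a = M - a + 1 by omega, Nat.choose_succ_succ', mul_add]
      rw [Finset.sum_congr rfl h, Finset.sum_add_distrib, ih, ih, Nat.sub_self,
        Nat.choose_zero_succ, mul_zero, add_zero, ← add_assoc p q 1,
        Nat.choose_succ_succ' (M + 1) (p + q + 1)]

lemma abs_chebCoeff (N j k : ℕ) : |chebCoeff N j k| =
    (j + k).choose j * (N - k).choose (N - j) / N.choose j := by
  rw [chebCoeff, abs_div, abs_mul, abs_pow, abs_neg, abs_one, one_pow, one_mul, Nat.abs_cast,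
    abs_of_nonneg (by positivity)]

lemma sum_abs_chebCoeff {N j : ℕ} (hj : j ≤ N) :
    ∑ k ∈ Finset.range (j + 1), |chebCoeff N j k| = chebMass N j := by
  have h := sum_range_choose_mul_choose (j + N) j (N - j)
  rw [add_assoc j N 1, Finset.sum_range_add, Finset.sum_eq_zero, zero_add,
    show N + 1 = j + 1 + (N - j) by omega, Finset.sum_range_add,
    Finset.sum_eq_zero (s := Finset.range (N - j)), add_zero] at h
  rotate_left
  · intro x hx
    rw [Nat.choose_eq_zero_of_lt (k := N - j), mul_zero]
    have := Finset.mem_range.1 hx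
    omega
  · intro x hx
    rw [Nat.choose_eq_zero_of_lt (Finset.mem_range.1 hx), zero_mul]
  rw [show j + (j + 1 + (N - j)) = N + 1 + j by omega, show j + (N - j) + 1 = N + 1 by omega] at h
  simp only [abs_chebCoeff]
  have h' : ∑ k ∈ Finset.range (j + 1), ((j + k).choose j : ℝ) * (N - k).choose (N - j) =
      (N + 1 + j).choose (N + 1) := by
    rw [← h]
    push_cast
    refine Finset.sum_congr rfl fun k _ => ?_
    rw [show j + N - (j + k) = N - k by omega]
  rw [← Finset.sum_div, h', chebMass]
  have e1 : ((N + 1 + j).factorial : ℝ) =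
      (N + 1 + j).choose (N + 1) * (N + 1).factorial * j.factorial := by
    rw [Nat.choose_symm_add]
    exact_mod_cast (Nat.add_choose_mul_factorial_mul_factorial (N + 1) j).symm
  have e2 : (N.factorial : ℝ) = N.choose j * j.factorial * (N - j).factorial := by
    exact_mod_cast (Nat.choose_mul_factorial_mul_factorial hj).symm
  have hN : (0 : ℝ) < N.choose j := by exact_mod_cast Nat.choose_pos hj
  rw [e1, e2]
  field_simp

lemma chebMass_mono {N i j : ℕ} (hij : i ≤ j) (hj : j ≤ N) : chebMass N i ≤ chebMass N j := by
  induction j, hij using Nat.le_induction with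
  | base => exact le_rfl
  | succ j hij ih =>
    refine (ih (by omega)).trans ?_
    unfold chebMass
    gcongr ?_ / _
    rw [← add_assoc, Nat.factorial_succ (N + 1 + j), show N - j = N - (j + 1) + 1 by omega,
      Nat.factorial_succ (N - (j + 1))]
    norm_cast
    rw [mul_comm (N + 1 + j + 1), mul_assoc]
    gcongr
    omega

lemma abs_eval_chebPoly_le_chebMass {N j : ℕ} (hj : j ≤ N) {x : ℝ} (hx : x ∈ Set.Icc (0 : ℝ) 1) :
    |(chebPoly N j).eval x| ≤ chebMass N j := by
  rw [eval_chebPoly, ← sum_abs_chebCoeff hj]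
  refine (Finset.abs_sum_le_sum_abs _ _).trans (Finset.sum_le_sum fun k _ => ?_)
  rw [abs_mul]
  exact mul_le_of_le_one_right (abs_nonneg _) (abs_eval_choosePoly_le_one k hx)

lemma chebMass_le_abs_eval_half {N j : ℕ} (hj : j ≤ N) (hj1 : 1 ≤ j) :
    (chebMass N j - 1) / (2 * (j : ℝ) ^ 2) - 1 ≤ |(chebPoly N j).eval (1 / 2)| := by
  refine le_trans ?_ (neg_le_abs _)
  have hj0 : (1 : ℝ) ≤ j := by exact_mod_cast hj1
  rw [eval_chebPoly, ← sum_abs_chebCoeff hj, Finset.sum_range_succ', Finset.sum_range_succ',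
    chebCoeff_zero hj, choosePoly_zero, eval_one, abs_one, add_sub_cancel_right, Finset.sum_div]
  suffices ∑ k ∈ Finset.range j, |chebCoeff N j (k + 1)| / (2 * (j : ℝ) ^ 2) ≤
      -∑ k ∈ Finset.range j, chebCoeff N j (k + 1) * (choosePoly (k + 1)).eval (1 / 2) by linarith
  rw [← Finset.sum_neg_distrib]
  refine Finset.sum_le_sum fun k hk => ?_
  have e : -(chebCoeff N j (k + 1) * (choosePoly (k + 1)).eval (1 / 2)) =
      |chebCoeff N j (k + 1)| * ((-1) ^ k * (choosePoly (k + 1)).eval (1 / 2)) := by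
    rw [abs_chebCoeff, chebCoeff, pow_succ]; ring
  rw [e, div_eq_mul_inv]
  gcongr
  refine le_trans ?_ (choosePoly_eval_half k)
  rw [← one_div]
  have : (k : ℝ) + 1 ≤ j := by exact_mod_cast Finset.mem_range.1 hk
  gcongr

/-! ### Lagrange interpolation near the centre of the grid -/

lemma prod_erase_abs_sub_le {N a : ℕ} (ha : a ≤ N) (i : ℕ) {x : ℝ} (h1 : (a : ℝ) ≤ x)
    (h2 : x ≤ a + 1) :
    ∏ k ∈ (Finset.range (N + 1)).erase i, |x - k| ≤ (a + 1).factorial * (N - a).factorial := by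
  set w : ℕ → ℕ := fun k => if k ≤ a then a + 1 - k else k - a with hw
  have hw1 : ∀ k, 1 ≤ w k := by
    intro k; simp only [hw]; split_ifs <;> omega
  have hxw : ∀ k : ℕ, |x - k| ≤ (w k : ℝ) := by
    intro k
    simp only [hw]
    split_ifs with h
    · have h' : (k : ℝ) ≤ a := by exact_mod_cast h
      rw [Nat.cast_sub (by omega), abs_le]
      push_cast
      constructor <;> linarith
    · have h' : (a : ℝ) + 1 ≤ k := by exact_mod_cast not_le.1 h
      rw [Nat.cast_sub (by omega), abs_le]
      constructor <;> linarith
  have hprod : ∏ k ∈ Finset.range (N + 1), w k = (a + 1).factorial * (N - a).factorial := by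
    rw [show N + 1 = a + 1 + (N - a) by omega, Finset.prod_range_add,
      ← Nat.descFactorial_self (a + 1), Nat.descFactorial_eq_prod_range,
      ← Finset.prod_range_add_one_eq_factorial]
    congr 1
    · refine Finset.prod_congr rfl fun k hk => ?_
      have := Finset.mem_range.1 hk
      simp only [hw]
      rw [if_pos (by omega)]
    · refine Finset.prod_congr rfl fun k _ => ?_
      simp only [hw]
      rw [if_neg (by omega)]
      omega
  calc ∏ k ∈ (Finset.range (N + 1)).erase i, |x - k|
      ≤ ∏ k ∈ (Finset.range (N + 1)).erase i, (w k : ℝ) :=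
        Finset.prod_le_prod (fun _ _ => abs_nonneg _) fun k _ => hxw k
    _ = ((∏ k ∈ (Finset.range (N + 1)).erase i, w k : ℕ) : ℝ) := by push_cast; rfl
    _ ≤ ((∏ k ∈ Finset.range (N + 1), w k : ℕ) : ℝ) := by
        exact_mod_cast Finset.prod_le_prod_of_subset_of_one_le' (Finset.erase_subset _ _)
          fun k _ _ => hw1 k
    _ = _ := by rw [hprod]; push_cast; rfl

lemma prod_erase_abs_natCast_sub {N i : ℕ} (hi : i ≤ N) :
    ∏ k ∈ (Finset.range (N + 1)).erase i, |(i : ℝ) - k| = i.factorial * (N - i).factorial := by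
  set f : ℕ → ℝ := fun k => if k = i then 1 else |(i : ℝ) - k| with hf
  have e : ∏ k ∈ (Finset.range (N + 1)).erase i, |(i : ℝ) - k| =
      ∏ k ∈ Finset.range (N + 1), f k := by
    rw [← Finset.prod_erase (Finset.range (N + 1)) (f := f) (a := i) (by simp [hf])]
    refine Finset.prod_congr rfl fun k hk => ?_
    simp only [hf]
    rw [if_neg (Finset.ne_of_mem_erase hk)]
  rw [e, show N + 1 = i + 1 + (N - i) by omega, Finset.prod_range_add, Finset.prod_range_succ,
    ← Nat.descFactorial_self i, Nat.descFactorial_eq_prod_range,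
    ← Finset.prod_range_add_one_eq_factorial]
  push_cast
  congr 1
  · rw [show f i = 1 by simp [hf], mul_one]
    refine Finset.prod_congr rfl fun k hk => ?_
    have := Finset.mem_range.1 hk
    simp only [hf]
    rw [if_neg (by omega), Nat.cast_sub (by omega), abs_of_nonneg]
    have : (k : ℝ) ≤ i := by exact_mod_cast this.le
    linarith
  · refine Finset.prod_congr rfl fun k _ => ?_
    simp only [hf]
    rw [if_neg (by omega), abs_sub_comm, abs_of_nonneg] <;> push_cast
    · ring
    · have : (0 : ℝ) ≤ k := k.cast_nonneg
      linarith

lemma abs_eval_le_of_mem_Icc {N a : ℕ} (ha : a ≤ N) {p : ℝ[X]} (hp : p.natDegree ≤ N) {H : ℝ}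
    (hH : ∀ i : ℕ, i ≤ N → |p.eval (i : ℝ)| ≤ H) {x : ℝ} (h1 : (a : ℝ) ≤ x) (h2 : x ≤ a + 1) :
    |p.eval x| ≤ ∑ i ∈ Finset.range (N + 1),
      H * ((a + 1).factorial * (N - a).factorial / (i.factorial * (N - i).factorial)) := by
  have hinj : Set.InjOn (fun i : ℕ => (i : ℝ)) (Finset.range (N + 1)) :=
    fun _ _ _ _ h => Nat.cast_injective h
  have hdeg : p.degree < (Finset.range (N + 1)).card := by
    rw [Finset.card_range]
    exact degree_le_natDegree.trans_lt (by exact_mod_cast Nat.lt_succ_of_le hp)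
  rw [Lagrange.eq_interpolate hinj hdeg, Lagrange.interpolate_apply, eval_finsetSum]
  refine (Finset.abs_sum_le_sum_abs _ _).trans (Finset.sum_le_sum fun i hi => ?_)
  have hiN : i ≤ N := Nat.lt_succ_iff.1 (Finset.mem_range.1 hi)
  rw [eval_mul, eval_C, abs_mul]
  refine mul_le_mul (hH i hiN) ?_ (abs_nonneg _) ((abs_nonneg _).trans (hH i hiN))
  rw [Lagrange.basis, eval_prod, Finset.abs_prod, ← prod_erase_abs_natCast_sub hiN]
  simp only [Lagrange.basisDivisor, eval_mul, eval_C, eval_sub, eval_X, abs_mul, abs_inv,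
    Finset.prod_mul_distrib, Finset.prod_inv_distrib]
  rw [div_eq_mul_inv, mul_comm]
  gcongr
  · exact prod_erase_abs_sub_le ha i h1 h2

lemma choose_half_le_mul_choose {N a : ℕ} (hN : 4 ≤ N) (h1 : N / 2 ≤ a + 1) (h2 : a ≤ N / 2 + 1) :
    N.choose (N / 2) ≤ (N + 1) * N.choose a := by
  have hs : ∀ k, N.choose (k + 1) * (k + 1) = N.choose k * (N - k) := fun k =>
    Nat.choose_succ_right_eq N k
  obtain h | h | h : N / 2 = a + 1 ∨ a = N / 2 ∨ a = N / 2 + 1 := by omega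
  · rw [h]
    have := hs a
    nlinarith [Nat.sub_le N a, Nat.zero_le (N.choose (a + 1)), Nat.zero_le (N.choose a),
      Nat.mul_le_mul_left (N.choose a) (Nat.sub_le N a)]
  · rw [h]; nlinarith [Nat.zero_le (N.choose (N / 2))]
  · rw [h]
    have := hs (N / 2)
    have h3 : 1 ≤ N - N / 2 := by omega
    have h4 : N / 2 + 1 ≤ N + 1 := by omega
    calc N.choose (N / 2) ≤ N.choose (N / 2) * (N - N / 2) := Nat.le_mul_of_pos_right _ h3
      _ = N.choose (N / 2 + 1) * (N / 2 + 1) := this.symm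
      _ ≤ N.choose (N / 2 + 1) * (N + 1) := Nat.mul_le_mul_left _ h4
      _ = _ := mul_comm _ _

/-- Near the centre of the grid, a polynomial is controlled by its values on the grid. -/
lemma abs_eval_le_of_near_center {N : ℕ} (hN : 4 ≤ N) {p : ℝ[X]} (hp : p.natDegree ≤ N) {H : ℝ}
    (hH : ∀ i : ℕ, i ≤ N → |p.eval (i : ℝ)| ≤ H) {x : ℝ} (h1 : (N : ℝ) / 2 - 1 ≤ x)
    (h2 : x ≤ (N : ℝ) / 2 + 1) :
    |p.eval x| ≤ ((N : ℝ) + 1) ^ 3 * H := by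
  have hN' : (4 : ℝ) ≤ N := by exact_mod_cast hN
  have hH0 : 0 ≤ H := (abs_nonneg _).trans (hH 0 (Nat.zero_le _))
  set a := ⌊x⌋₊ with ha
  have hx0 : 0 ≤ x := by linarith
  have ha1 : (a : ℝ) ≤ x := Nat.floor_le hx0
  have ha2 : x < a + 1 := Nat.lt_floor_add_one x
  have ha3 : N / 2 ≤ a + 1 := by
    have : (N : ℝ) < 2 * a + 4 := by linarith
    have : N < 2 * a + 4 := by exact_mod_cast this
    omega
  have ha4 : a ≤ N / 2 + 1 := by
    have : (2 : ℝ) * a ≤ N + 2 := by linarith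
    have : 2 * a ≤ N + 2 := by exact_mod_cast this
    omega
  have haN : a + 1 ≤ N := by omega
  refine (abs_eval_le_of_mem_Icc (by omega) hp hH ha1 ha2.le).trans ?_
  have hterm : ∀ i ∈ Finset.range (N + 1),
      H * ((a + 1).factorial * (N - a).factorial / (i.factorial * (N - i).factorial) : ℝ) ≤
      H * ((N : ℝ) + 1) ^ 2 := by
    intro i hi
    have hiN : i ≤ N := Nat.lt_succ_iff.1 (Finset.mem_range.1 hi)
    refine mul_le_mul_of_nonneg_left ?_ hH0
    have e1 : (N.factorial : ℝ) = N.choose i * i.factorial * (N - i).factorial := by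
      exact_mod_cast (Nat.choose_mul_factorial_mul_factorial hiN).symm
    have e2 : (N.factorial : ℝ) = N.choose a * a.factorial * (N - a).factorial := by
      exact_mod_cast (Nat.choose_mul_factorial_mul_factorial (by omega : a ≤ N)).symm
    have h3 : (N.choose i : ℝ) ≤ (N + 1) * N.choose a := by
      exact_mod_cast (Nat.choose_le_middle i N).trans (choose_half_le_mul_choose hN ha3 ha4)
    have h4 : (a : ℝ) + 1 ≤ N + 1 := by exact_mod_cast (by omega : a + 1 ≤ N + 1)
    have hca : (0 : ℝ) < N.choose a := by exact_mod_cast Nat.choose_pos (by omega : a ≤ N)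
    rw [div_le_iff₀ (by positivity), Nat.factorial_succ]
    push_cast
    apply le_of_mul_le_mul_left _ hca
    calc (N.choose a : ℝ) * ((a + 1) * a.factorial * (N - a).factorial)
        = (a + 1) * (N.choose i * i.factorial * (N - i).factorial) := by
          rw [← e1, e2]; ring
      _ ≤ (N + 1) * ((N + 1) * N.choose a * i.factorial * (N - i).factorial) := by gcongr
      _ = _ := by ring
  refine (Finset.sum_le_sum hterm).trans_eq ?_
  rw [Finset.sum_const, Finset.card_range, nsmul_eq_mul]
  push_cast
  ring

/-! ### An energy function for the difference equation -/

/-- A discrete Sonine function, monotone on the left half of the grid. -/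
def energy (N : ℕ) (μ : ℝ) (f : ℝ → ℝ) (x : ℝ) : ℝ :=
  (x * (N + 1 - x)) ^ 2 * (f x - f (x - 1)) ^ 2 + μ * (x * (N + 1 - x)) * f x * f (x - 1)

lemma energy_add_one {N : ℕ} {μ : ℝ} {f : ℝ → ℝ} {x : ℝ} (h : diffOp N f x = -μ * f x) :
    energy N μ f (x + 1) = energy N μ f x + μ * f x ^ 2 * (N - 2 * x) := by
  simp only [diffOp] at h
  simp only [energy, add_sub_cancel_right]
  linear_combination ((x + 1) * (N - x) * (f (x + 1) - f x) +
    x * (N + 1 - x) * (f x - f (x - 1))) * h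

lemma energy_le_energy_add {N : ℕ} {μ : ℝ} {f : ℝ → ℝ} (hμ : 0 ≤ μ)
    (h : ∀ x, diffOp N f x = -μ * f x) (x : ℝ) (k : ℕ) (hk : x + k ≤ (N : ℝ) / 2 + 1) :
    energy N μ f x ≤ energy N μ f (x + k) := by
  induction k with
  | zero => simp
  | succ k ih =>
    push_cast at hk ⊢
    refine (ih (by linarith)).trans ?_
    rw [← add_assoc, energy_add_one (h _)]
    have : 0 ≤ μ * f (x + k) ^ 2 * (N - 2 * (x + k)) :=
      mul_nonneg (mul_nonneg hμ (sq_nonneg _)) (by linarith)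
    linarith

lemma natDegree_chebPoly_le (N j : ℕ) : (chebPoly N j).natDegree ≤ j := by
  refine natDegree_sum_le_of_forall_le _ _ fun k hk => ?_
  refine (natDegree_C_mul_le _ _).trans ?_
  rw [natDegree_choosePoly]
  exact Nat.lt_succ_iff.1 (Finset.mem_range.1 hk)

lemma one_le_chebNormSq {N j : ℕ} (hj : j ≤ N) : 1 ≤ chebNormSq N j := by
  unfold chebNormSq gridInner
  rw [Finset.sum_range_succ']
  simp only [Nat.cast_zero, eval_chebPoly_zero hj, mul_one]
  linarith [Finset.sum_nonneg fun (x : ℕ) (_ : x ∈ Finset.range N) =>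
    mul_self_nonneg ((chebPoly N j).eval ((x + 1 : ℕ) : ℝ))]

lemma abs_eval_chebPoly_natCast_le {N j i : ℕ} (hi : i ≤ N) :
    |(chebPoly N j).eval (i : ℝ)| ≤ √(chebNormSq N j) := by
  apply Real.abs_le_sqrt
  unfold chebNormSq gridInner
  rw [sq]
  exact Finset.single_le_sum (f := fun i : ℕ => (chebPoly N j).eval (i : ℝ) *
    (chebPoly N j).eval (i : ℝ)) (fun _ _ => mul_self_nonneg _)
    (Finset.mem_range.2 (Nat.lt_succ_of_le hi))

/-- A lower bound for the energy next to a maximum of `|f|` away from the center of the grid. -/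
lemma two_mul_sq_le_energy {N : ℕ} {μ : ℝ} {f : ℝ → ℝ} {y : ℝ} (hμ : 2 ≤ μ) (hy1 : 1 < y)
    (hy2 : y < (N : ℝ) / 2 - 1) (h : diffOp N f y = -μ * f y) (hyp : |f (y + 1)| ≤ |f y|)
    (hym : |f (y - 1)| ≤ |f y|) (h0 : 0 < |f y|) : 2 * f y ^ 2 ≤ energy N μ f (y + 1) := by
  simp only [diffOp] at h
  obtain ⟨p, hp⟩ : ∃ p, p = y * (N + 1 - y) := ⟨_, rfl⟩
  obtain ⟨q, hq⟩ : ∃ q, q = (y + 1) * (N - y) := ⟨_, rfl⟩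
  rw [← hp, ← hq] at h
  have hp0 : 0 < p := hp ▸ mul_pos (by linarith) (by linarith)
  have hq0 : 0 < q := hq ▸ mul_pos (by linarith) (by linarith)
  have hpq : q - p = N - 2 * y := by rw [hp, hq]; ring
  have hle : μ ≤ 2 * (p + q) := by
    by_contra! hlt
    have e : (μ - p - q) * f y = -(q * f (y + 1) + p * f (y - 1)) := by linear_combination h
    have e' := congrArg abs e
    rw [abs_mul, abs_neg, abs_of_pos (by linarith : 0 < μ - p - q)] at e'
    have h1 : |q * f (y + 1) + p * f (y - 1)| ≤ q * |f y| + p * |f y| := by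
      refine (abs_add_le _ _).trans ?_
      rw [abs_mul q, abs_mul p, abs_of_pos hp0, abs_of_pos hq0]
      gcongr
    linarith [mul_pos (sub_pos.2 hlt) h0]
  have e : energy N μ f (y + 1) =
      (q * f (y + 1) - (q - μ / 2) * f y) ^ 2 + μ * ((4 * q - μ) / 4) * f y ^ 2 := by
    simp only [energy, add_sub_cancel_right, hq]; ring
  have h1 : 1 ≤ (4 * q - μ) / 4 := by linarith
  have h2 : 2 ≤ μ * ((4 * q - μ) / 4) := by
    have := mul_le_mul hμ h1 zero_le_one (by linarith)
    linarith
  rw [e]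
  linarith [sq_nonneg (q * f (y + 1) - (q - μ / 2) * f y),
    mul_le_mul_of_nonneg_right h2 (sq_nonneg (f y))]

/-- Bound for the discrete Chebyshev polynomials between the grid points. -/
lemma abs_eval_chebPoly_le {N j : ℕ} (hN : 4 ≤ N) (hj : j ≤ N) {x : ℝ} (hx0 : 0 ≤ x)
    (hx : x ≤ (N : ℝ) / 2 + 1) :
    |(chebPoly N j).eval x| ≤ 2 * ((N : ℝ) + 1) ^ 5 * chebNormSq N j := by
  have hN' : (4 : ℝ) ≤ N := by exact_mod_cast hN
  have hh := one_le_chebNormSq hj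
  have hpow : ∀ n : ℕ, (1 : ℝ) ≤ ((N : ℝ) + 1) ^ n := fun n => one_le_pow₀ (by linarith)
  rcases Nat.eq_zero_or_pos j with rfl | hj1
  · rw [eval_chebPoly]
    simp only [zero_add, Finset.sum_range_one, chebCoeff_zero hj, choosePoly_zero, eval_one]
    rw [mul_one, abs_one]
    nlinarith [mul_le_mul (hpow 5) hh zero_le_one (by positivity)]
  set f : ℝ → ℝ := fun x => (chebPoly N j).eval x with hf
  set μ : ℝ := j * (j + 1) with hμ
  have hj1' : (1 : ℝ) ≤ j := by exact_mod_cast hj1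
  have hjN : (j : ℝ) ≤ N := by exact_mod_cast hj
  have hμ2 : 2 ≤ μ := by rw [hμ]; nlinarith
  have hμN : μ ≤ ((N : ℝ) + 1) ^ 2 := by rw [hμ]; nlinarith
  have hrec : ∀ x, diffOp N f x = -μ * f x := fun x => diffOp_chebPoly hj x
  set B : ℝ := ((N : ℝ) + 1) ^ 3 * √(chebNormSq N j) with hB
  have hmid : ∀ z, (N : ℝ) / 2 - 1 ≤ z → z ≤ (N : ℝ) / 2 + 1 → |f z| ≤ B := fun z h1 h2 =>
    abs_eval_le_of_near_center hN ((natDegree_chebPoly_le N j).trans hj)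
      (fun i hi => abs_eval_chebPoly_natCast_le hi) h1 h2
  have hB0 : 0 ≤ B := by positivity
  have hBsq : B ^ 2 = ((N : ℝ) + 1) ^ 6 * chebNormSq N j := by
    rw [hB, mul_pow, Real.sq_sqrt (by linarith)]; ring
  obtain ⟨y, ⟨hy0, hyN⟩, hmax⟩ := isCompact_Icc.exists_isMaxOn
    (Set.nonempty_Icc.2 (by linarith : (0 : ℝ) ≤ (N : ℝ) / 2 + 1))
    (f := fun x => |f x|) (chebPoly N j).continuous.abs.continuousOn
  refine (hmax ⟨hx0, hx⟩ : |f x| ≤ |f y|).trans ?_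
  have hBle : B ≤ 2 * ((N : ℝ) + 1) ^ 5 * chebNormSq N j := by
    have h1 : √(chebNormSq N j) ≤ chebNormSq N j := by
      rw [Real.sqrt_le_left (by linarith)]; nlinarith
    have h2 : ((N : ℝ) + 1) ^ 3 ≤ 2 * ((N : ℝ) + 1) ^ 5 := by
      have : ((N : ℝ) + 1) ^ 3 ≤ ((N : ℝ) + 1) ^ 5 := pow_le_pow_right₀ (by linarith) (by norm_num)
      linarith [hpow 5]
    exact mul_le_mul h2 h1 (Real.sqrt_nonneg _) (by positivity)
  rcases le_or_gt y 1 with hy1 | hy1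
  · refine (abs_eval_chebPoly_le_chebMass hj ⟨hy0, hy1⟩).trans ?_
    have h1 := two_mul_add_one_mul_chebNormSq hj
    have h2 : chebMass N j ≤ 2 * chebNormSq N j := by
      have : (0 : ℝ) < N + 1 := by linarith
      apply le_of_mul_le_mul_left _ this
      rw [← h1]
      nlinarith
    nlinarith [hpow 5]
  rcases le_or_gt ((N : ℝ) / 2 - 1) y with hy2 | hy2
  · exact (hmid y hy2 hyN).trans hBle
  have hyp : |f (y + 1)| ≤ |f y| := hmax ⟨by linarith, by linarith⟩
  have hym : |f (y - 1)| ≤ |f y| := hmax ⟨by linarith, by linarith⟩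
  have h1y : 1 ≤ |f y| := by
    have h : |f 0| ≤ |f y| := hmax ⟨le_rfl, by linarith⟩
    have h0 : f 0 = 1 := eval_chebPoly_zero hj
    rwa [h0, abs_one] at h
  have hE1 : 2 * f y ^ 2 ≤ energy N μ f (y + 1) :=
    two_mul_sq_le_energy hμ2 hy1 hy2 (hrec y) hyp hym (by linarith)
  set k := ⌊(N : ℝ) / 2 - y - 1⌋₊ + 1 with hk
  set z := y + 1 + (k : ℝ) with hz
  have hk1 : (k : ℝ) ≤ (N : ℝ) / 2 - y - 1 + 1 := by
    rw [hk]; push_cast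
    linarith [Nat.floor_le (by linarith : 0 ≤ (N : ℝ) / 2 - y - 1)]
  have hk2 : (N : ℝ) / 2 - y - 1 < k := by
    rw [hk]; push_cast; exact Nat.lt_floor_add_one _
  have hz1 : z ≤ (N : ℝ) / 2 + 1 := by rw [hz]; linarith
  have hz2 : (N : ℝ) / 2 < z := by rw [hz]; linarith
  have hE2 : energy N μ f (y + 1) ≤ energy N μ f z :=
    energy_le_energy_add (by linarith) hrec _ _ hz1
  have hE3 : energy N μ f z ≤ 5 * ((N : ℝ) + 1) ^ 4 * B ^ 2 := by
    have ha := hmid z (by linarith) hz1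
    have hb := hmid (z - 1) (by linarith) (by linarith)
    have hP0 : 0 ≤ z * (N + 1 - z) := mul_nonneg (by linarith) (by linarith)
    have hP1 : z * (N + 1 - z) ≤ ((N : ℝ) + 1) ^ 2 := by nlinarith
    have h1 : (f z - f (z - 1)) ^ 2 ≤ (2 * B) ^ 2 := by
      rw [sq_le_sq, abs_of_nonneg (by positivity : 0 ≤ 2 * B)]
      exact (abs_sub _ _).trans (by linarith)
    have h2 : f z * f (z - 1) ≤ B * B := by
      refine (le_abs_self _).trans ?_
      rw [abs_mul]
      exact mul_le_mul ha hb (abs_nonneg _) hB0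
    calc energy N μ f z
        = (z * (N + 1 - z)) ^ 2 * (f z - f (z - 1)) ^ 2 +
          μ * (z * (N + 1 - z)) * (f z * f (z - 1)) := by rw [energy]; ring
      _ ≤ (((N : ℝ) + 1) ^ 2) ^ 2 * (2 * B) ^ 2 +
          ((N : ℝ) + 1) ^ 2 * ((N : ℝ) + 1) ^ 2 * (B * B) := by
          have hμ0 : 0 ≤ μ * (z * (N + 1 - z)) := mul_nonneg (by linarith) hP0
          have hBB : 0 ≤ B * B := mul_nonneg hB0 hB0
          refine add_le_add (by gcongr) ?_
          exact (mul_le_mul_of_nonneg_left h2 hμ0).trans (by gcongr)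
      _ = _ := by ring
  have hR : 0 ≤ 2 * ((N : ℝ) + 1) ^ 5 * chebNormSq N j := hB0.trans hBle
  refine abs_le_of_sq_le_sq ?_ hR
  have hfin : 2 * f y ^ 2 ≤ 5 * ((N : ℝ) + 1) ^ 4 * (((N : ℝ) + 1) ^ 6 * chebNormSq N j) := by
    rw [← hBsq]; linarith
  have h10 : 0 ≤ ((N : ℝ) + 1) ^ 10 := by positivity
  have : chebNormSq N j ≤ chebNormSq N j ^ 2 := by nlinarith
  have := mul_le_mul_of_nonneg_left this h10
  have h11 : 0 ≤ ((N : ℝ) + 1) ^ 10 * chebNormSq N j ^ 2 := by positivity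
  have e1 : (2 * ((N : ℝ) + 1) ^ 5 * chebNormSq N j) ^ 2 =
    4 * (((N : ℝ) + 1) ^ 10 * chebNormSq N j ^ 2) := by ring
  have e2 : 5 * ((N : ℝ) + 1) ^ 4 * (((N : ℝ) + 1) ^ 6 * chebNormSq N j) =
    5 * (((N : ℝ) + 1) ^ 10 * chebNormSq N j) := by ring
  rw [e1]
  rw [e2] at hfin
  linarith

/-! ### The upper bound for arbitrary polynomials -/

lemma coeff_chebPoly_self_ne_zero {N j : ℕ} (hj : j ≤ N) : (chebPoly N j).coeff j ≠ 0 := by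
  have h : (chebPoly N j).coeff j = chebCoeff N j j * (choosePoly j).coeff j := by
    rw [chebPoly, finsetSum_coeff, Finset.sum_range_succ, Finset.sum_eq_zero, zero_add, coeff_C_mul]
    intro k hk
    rw [coeff_C_mul, coeff_eq_zero_of_natDegree_lt, mul_zero]
    rw [natDegree_choosePoly]
    exact Finset.mem_range.1 hk
  rw [h]
  refine mul_ne_zero ?_ ?_
  · have h1 : ((j + j).choose j : ℝ) ≠ 0 := by exact_mod_cast (Nat.choose_pos (by omega)).ne'
    have h2 : (N.choose j : ℝ) ≠ 0 := by exact_mod_cast (Nat.choose_pos hj).ne'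
    simp [chebCoeff, h1, h2]
  · have : (descPochhammer ℝ j).coeff j = 1 := by
      have := (monic_descPochhammer ℝ j).coeff_natDegree
      rwa [descPochhammer_natDegree] at this
    rw [choosePoly, coeff_C_mul, this, mul_one]
    positivity

lemma exists_eq_sum_chebPoly {N m : ℕ} (hm : m ≤ N) {p : ℝ[X]} (hp : p.natDegree ≤ m) :
    ∃ a : ℕ → ℝ, p = ∑ j ∈ Finset.range (m + 1), C (a j) * chebPoly N j := by
  suffices H : ∀ n ≤ N + 1, ∀ p : ℝ[X], p.degree < n →
      ∃ a : ℕ → ℝ, p = ∑ j ∈ Finset.range n, C (a j) * chebPoly N j from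
    H (m + 1) (by omega) p (degree_le_natDegree.trans_lt (by exact_mod_cast Nat.lt_succ_of_le hp))
  intro n
  induction n with
  | zero =>
    intro _ p hp
    refine ⟨0, ?_⟩
    rw [Finset.range_zero, Finset.sum_empty]
    by_contra h0
    rw [degree_eq_natDegree h0] at hp
    simp at hp
  | succ n ih =>
    intro hn p hp
    set c := p.coeff n / (chebPoly N n).coeff n with hc
    have hdeg : (p - C c * chebPoly N n).degree < n := by
      rw [degree_lt_iff_coeff_zero]
      intro i hi
      rw [coeff_sub, coeff_C_mul]
      rcases eq_or_lt_of_le hi with rfl | hlt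
      · rw [hc, div_mul_cancel₀ _ (coeff_chebPoly_self_ne_zero (by omega)), sub_self]
      · rw [coeff_eq_zero_of_natDegree_lt ((natDegree_chebPoly_le N n).trans_lt hlt), mul_zero,
          sub_zero]
        exact (degree_lt_iff_coeff_zero _ _).1 hp i hlt
    obtain ⟨a, ha⟩ := ih (by omega) _ hdeg
    refine ⟨Function.update a n c, ?_⟩
    rw [Finset.sum_range_succ, Function.update_self, ← sub_eq_iff_eq_add, ha]
    refine Finset.sum_congr rfl fun j hj => ?_
    rw [Function.update_of_ne (Finset.mem_range.1 hj).ne]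

lemma sqrt_chebNormSq_le {N j m : ℕ} (hj : j ≤ m) (hm : m ≤ N) :
    √(chebNormSq N j) ≤ (N + 1) * √(chebMass N m) := by
  rw [Real.sqrt_le_left (by positivity), mul_pow, Real.sq_sqrt (chebMass_pos N m).le]
  have e := two_mul_add_one_mul_chebNormSq (hj.trans hm)
  have e1 := chebMass_mono hj hm
  have e3 := mul_nonneg (j.cast_nonneg : (0 : ℝ) ≤ j) (chebNormSq_nonneg N j)
  calc chebNormSq N j ≤ (N + 1) * chebMass N j := by linarith
    _ ≤ (N + 1) * chebMass N m := by gcongr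
    _ ≤ ((N : ℝ) + 1) ^ 2 * chebMass N m :=
      mul_le_mul_of_nonneg_right (by nlinarith) (chebMass_pos N m).le

lemma abs_eval_le_of_le_half {N m : ℕ} (hN : 4 ≤ N) (hm : m ≤ N) {p : ℝ[X]}
    (hp : p.natDegree ≤ m) {M : ℝ} (hM : ∀ i : ℕ, i ≤ N → |p.eval (i : ℝ)| ≤ M) {x : ℝ}
    (hx0 : 0 ≤ x) (hx : x ≤ (N : ℝ) / 2 + 1) :
    |p.eval x| ≤ 2 * ((N : ℝ) + 1) ^ 8 * √(chebMass N m) * M := by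
  have hN' : (4 : ℝ) ≤ N := by exact_mod_cast hN
  have hM0 : 0 ≤ M := (abs_nonneg _).trans (hM 0 (Nat.zero_le _))
  obtain ⟨a, ha⟩ := exists_eq_sum_chebPoly hm hp
  have hev : ∀ x, p.eval x = ∑ j ∈ Finset.range (m + 1), a j * (chebPoly N j).eval x := by
    intro x
    conv_lhs => rw [ha]
    simp [eval_finsetSum]
  have hjm : ∀ j ∈ Finset.range (m + 1), j ≤ m := fun j hj =>
    Nat.lt_succ_iff.1 (Finset.mem_range.1 hj)
  have hinner : ∀ i ∈ Finset.range (m + 1),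
      gridInner N (fun x => (chebPoly N i).eval x) (fun x => p.eval x) = a i * chebNormSq N i := by
    intro i hi
    simp only [hev]
    rw [gridInner_sum_right, Finset.sum_eq_single_of_mem i hi]
    · rfl
    · intro j hj hji
      rw [gridInner_chebPoly_of_ne ((hjm i hi).trans hm) ((hjm j hj).trans hm) hji.symm, mul_zero]
  have hparseval : ∑ j ∈ Finset.range (m + 1), a j ^ 2 * chebNormSq N j =
      gridInner N (fun x => p.eval x) (fun x => p.eval x) := by
    have : gridInner N (fun x => p.eval x) (fun x => p.eval x) = gridInner N (fun x => p.eval x)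
        (fun x => ∑ j ∈ Finset.range (m + 1), a j * (chebPoly N j).eval x) := by
      simp only [← hev]
    rw [this, gridInner_sum_right]
    refine Finset.sum_congr rfl fun j hj => ?_
    rw [gridInner_comm, hinner j hj]
    ring
  have hnorm : gridInner N (fun x => p.eval x) (fun x => p.eval x) ≤ (N + 1) * M ^ 2 := by
    have h : ∀ x ∈ Finset.range (N + 1), p.eval (x : ℝ) * p.eval (x : ℝ) ≤ M ^ 2 := by
      intro x hx
      rw [← sq, ← sq_abs]
      have := hM x (Nat.lt_succ_iff.1 (Finset.mem_range.1 hx))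
      gcongr
    refine (Finset.sum_le_sum h).trans_eq ?_
    rw [Finset.sum_const, Finset.card_range, nsmul_eq_mul]
    push_cast
    ring
  have hterm : ∀ j ∈ Finset.range (m + 1), |a j * (chebPoly N j).eval x| ≤
      2 * ((N : ℝ) + 1) ^ 7 * √(chebMass N m) * M := by
    intro j hj
    have hjN := (hjm j hj).trans hm
    have h1 : |a j| * √(chebNormSq N j) ≤ (N + 1) * M := by
      apply le_of_sq_le_sq _ (by positivity)
      rw [mul_pow, sq_abs, Real.sq_sqrt (chebNormSq_nonneg N j)]
      refine (Finset.single_le_sum (f := fun j => a j ^ 2 * chebNormSq N j)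
        (fun j _ => mul_nonneg (sq_nonneg _) (chebNormSq_nonneg N j)) hj).trans ?_
      rw [hparseval]
      refine hnorm.trans ?_
      have := sq_nonneg M
      nlinarith [mul_nonneg (by linarith : (0 : ℝ) ≤ N) this]
    have h2 := sqrt_chebNormSq_le (hjm j hj) hm
    rw [abs_mul]
    calc |a j| * |(chebPoly N j).eval x|
        ≤ |a j| * (2 * ((N : ℝ) + 1) ^ 5 * chebNormSq N j) := by
          gcongr; exact abs_eval_chebPoly_le hN hjN hx0 hx
      _ = 2 * ((N : ℝ) + 1) ^ 5 * (|a j| * √(chebNormSq N j)) * √(chebNormSq N j) := by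
          conv_lhs => rw [← Real.mul_self_sqrt (chebNormSq_nonneg N j)]
          ring
      _ ≤ 2 * ((N : ℝ) + 1) ^ 5 * ((N + 1) * M) * ((N + 1) * √(chebMass N m)) := by gcongr
      _ = _ := by ring
  rw [hev]
  refine (Finset.abs_sum_le_sum_abs _ _).trans ((Finset.sum_le_sum hterm).trans ?_)
  rw [Finset.sum_const, Finset.card_range, nsmul_eq_mul]
  have : ((m + 1 : ℕ) : ℝ) ≤ N + 1 := by exact_mod_cast Nat.succ_le_succ hm
  calc ((m + 1 : ℕ) : ℝ) * (2 * ((N : ℝ) + 1) ^ 7 * √(chebMass N m) * M)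
      ≤ (N + 1) * (2 * ((N : ℝ) + 1) ^ 7 * √(chebMass N m) * M) := by gcongr
    _ = _ := by ring

lemma abs_eval_le_of_mem_grid_hull {N m : ℕ} (hN : 4 ≤ N) (hm : m ≤ N) {p : ℝ[X]}
    (hp : p.natDegree ≤ m) {M : ℝ} (hM : ∀ i : ℕ, i ≤ N → |p.eval (i : ℝ)| ≤ M) {x : ℝ}
    (hx : x ∈ Set.Icc (0 : ℝ) N) :
    |p.eval x| ≤ 2 * ((N : ℝ) + 1) ^ 8 * √(chebMass N m) * M := by
  rcases le_or_gt x ((N : ℝ) / 2 + 1) with h | h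
  · exact abs_eval_le_of_le_half hN hm hp hM hx.1 h
  · have := abs_eval_le_of_le_half (p := p.comp (C (N : ℝ) - X)) (M := M) (x := N - x) hN hm ?_ ?_
      (by linarith [hx.2]) (by linarith)
    · simpa using this
    · rw [natDegree_comp]
      have : (C (N : ℝ) - X : ℝ[X]).natDegree ≤ 1 := by compute_degree
      nlinarith
    · intro i hi
      have := hM (N - i) (Nat.sub_le _ _)
      rw [Nat.cast_sub hi] at this
      simpa using this

/-! ### Rescaling to the interval `[-1, 1]` -/

lemma nGrid_add_one {N : ℕ} (hN : 0 < N) :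
    nGrid (N + 1) = (fun i : ℕ => 2 / (N : ℝ) * i - 1) '' Set.Iic N := by
  have hN' : (N : ℝ) ≠ 0 := by positivity
  ext x
  simp only [nGrid, Set.mem_ofPred_eq, Set.mem_image, Set.mem_Iic]
  constructor
  · rintro ⟨k, hk1, hk2, rfl⟩
    refine ⟨k - 1, by omega, ?_⟩
    rw [Nat.cast_sub hk1]
    push_cast
    rw [add_sub_cancel_right]
    field_simp
    ring
  · rintro ⟨i, hi, rfl⟩
    refine ⟨i + 1, by omega, by omega, ?_⟩
    push_cast
    rw [add_sub_cancel_right]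
    field_simp
    ring

lemma nonempty_nGrid_add_one {N : ℕ} (hN : 0 < N) : (nGrid (N + 1)).Nonempty := by
  rw [nGrid_add_one hN]
  exact ⟨_, 0, Nat.zero_le _, rfl⟩

lemma abs_eval_le_normE {N i : ℕ} (hN : 0 < N) (hi : i ≤ N) (p : ℝ[X]) :
    |p.eval (2 / (N : ℝ) * i - 1)| ≤ normE (N + 1) p := by
  refine le_csSup ?_ ⟨_, ?_, rfl⟩
  · rw [nGrid_add_one hN]
    exact (((Set.finite_Iic N).image _).image _).bddAbove
  · rw [nGrid_add_one hN]
    exact ⟨i, hi, rfl⟩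

lemma normE_le {N : ℕ} (hN : 0 < N) {p : ℝ[X]} {M : ℝ}
    (h : ∀ i ≤ N, |p.eval (2 / (N : ℝ) * (i : ℕ) - 1)| ≤ M) : normE (N + 1) p ≤ M := by
  refine csSup_le ((nonempty_nGrid_add_one hN).image _) ?_
  rw [nGrid_add_one hN]
  rintro _ ⟨_, ⟨i, hi, rfl⟩, rfl⟩
  exact h i hi

lemma abs_eval_le_normI {x : ℝ} (hx : x ∈ Set.Icc (-1 : ℝ) 1) (p : ℝ[X]) :
    |p.eval x| ≤ normI p :=
  le_csSup (isCompact_Icc.image p.continuous.abs).bddAbove ⟨x, hx, rfl⟩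

lemma normI_le {p : ℝ[X]} {M : ℝ} (h : ∀ x ∈ Set.Icc (-1 : ℝ) 1, |p.eval x| ≤ M) :
    normI p ≤ M := by
  refine csSup_le ((Set.nonempty_Icc.2 (by norm_num)).image _) ?_
  rintro _ ⟨x, hx, rfl⟩
  exact h x hx

lemma normI_le_mul_normE {N m : ℕ} (hN : 4 ≤ N) (hm : m ≤ N) {p : ℝ[X]} (hp : p.natDegree ≤ m) :
    normI p ≤ 2 * ((N : ℝ) + 1) ^ 8 * √(chebMass N m) * normE (N + 1) p := by
  have hN0 : (0 : ℝ) < N := by exact_mod_cast (by omega : 0 < N)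
  refine normI_le fun x hx => ?_
  have hdeg : (C (2 / (N : ℝ)) * X - 1 : ℝ[X]).natDegree ≤ 1 := by compute_degree
  have h := abs_eval_le_of_mem_grid_hull hN hm (p := p.comp (C (2 / (N : ℝ)) * X - 1))
    (M := normE (N + 1) p) (x := N * (x + 1) / 2) ?_ ?_ ?_
  · have e : 2 / (N : ℝ) * (N * (x + 1) / 2) - 1 = x := by field_simp; ring
    rwa [eval_comp, eval_sub, eval_mul, eval_C, eval_X, eval_one, e] at h
  · rw [natDegree_comp]
    exact (Nat.mul_le_mul hp hdeg).trans_eq (mul_one m)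
  · intro i hi
    simpa using abs_eval_le_normE (by omega) hi p
  · constructor
    · have := hx.1
      have : 0 ≤ x + 1 := by linarith
      positivity
    · nlinarith [hx.2]

/-- The discrete Chebyshev polynomial transported to `[-1, 1]`. -/
noncomputable def scaledChebPoly (N m : ℕ) : ℝ[X] :=
  (chebPoly N m).comp (C ((N : ℝ) / 2) * X + C ((N : ℝ) / 2))

lemma eval_scaledChebPoly (N m : ℕ) (x : ℝ) :
    (scaledChebPoly N m).eval x = (chebPoly N m).eval ((N : ℝ) / 2 * x + N / 2) := by
  simp [scaledChebPoly]

lemma natDegree_scaledChebPoly_le (N m : ℕ) : (scaledChebPoly N m).natDegree ≤ m := by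
  have hdeg : (C ((N : ℝ) / 2) * X + C ((N : ℝ) / 2)).natDegree ≤ 1 := by compute_degree
  rw [scaledChebPoly, natDegree_comp]
  exact (Nat.mul_le_mul (natDegree_chebPoly_le N m) hdeg).trans_eq (mul_one m)

lemma eval_scaledChebPoly_grid {N : ℕ} (hN : 0 < N) (m i : ℕ) :
    (scaledChebPoly N m).eval (2 / (N : ℝ) * i - 1) = (chebPoly N m).eval (i : ℝ) := by
  have hN' : (N : ℝ) ≠ 0 := by positivity
  rw [eval_scaledChebPoly]
  congr 1
  field_simp
  ring

lemma one_le_normE_scaledChebPoly {N m : ℕ} (hN : 0 < N) (hm : m ≤ N) :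
    1 ≤ normE (N + 1) (scaledChebPoly N m) := by
  have h := abs_eval_le_normE hN (Nat.zero_le N) (scaledChebPoly N m)
  rwa [eval_scaledChebPoly_grid hN, Nat.cast_zero, eval_chebPoly_zero hm, abs_one] at h

lemma scaledChebPoly_ne_zero {N m : ℕ} (hN : 0 < N) (hm : m ≤ N) : scaledChebPoly N m ≠ 0 := by
  intro h
  have h0 := eval_scaledChebPoly_grid hN m 0
  rw [h, eval_zero, Nat.cast_zero, eval_chebPoly_zero hm] at h0
  exact zero_ne_one h0

lemma normE_scaledChebPoly_le {N m : ℕ} (hN : 0 < N) (hm : m ≤ N) :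
    normE (N + 1) (scaledChebPoly N m) ≤ ((N : ℝ) + 1) * √(chebMass N m) := by
  refine normE_le hN fun i hi => ?_
  rw [eval_scaledChebPoly_grid hN]
  exact (abs_eval_chebPoly_natCast_le hi).trans (sqrt_chebNormSq_le le_rfl hm)

lemma le_normI_scaledChebPoly {N m : ℕ} (hN : 0 < N) (hm : m ≤ N) (hm1 : 1 ≤ m) :
    (chebMass N m - 1) / (2 * (m : ℝ) ^ 2) - 1 ≤ normI (scaledChebPoly N m) := by
  have hN1 : (1 : ℝ) ≤ N := by exact_mod_cast hN
  refine (chebMass_le_abs_eval_half hm hm1).trans ?_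
  have hx : 1 / (N : ℝ) - 1 ∈ Set.Icc (-1 : ℝ) 1 := by
    have h1 : 0 ≤ 1 / (N : ℝ) := by positivity
    have h2 : 1 / (N : ℝ) ≤ 1 := div_le_one_of_le₀ hN1 (by linarith)
    constructor <;> linarith
  have h := abs_eval_le_normI hx (scaledChebPoly N m)
  have e : (N : ℝ) / 2 * (1 / N - 1) + N / 2 = 1 / 2 := by field_simp; ring
  rwa [eval_scaledChebPoly, e] at h

lemma le_normI_div_normE_scaledChebPoly {N m : ℕ} (hN : 0 < N) (hm : m ≤ N) (hm1 : 1 ≤ m)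
    (hS : 6 * ((N : ℝ) + 1) ^ 2 ≤ chebMass N m) :
    √(chebMass N m) / (4 * ((N : ℝ) + 1) ^ 3) ≤
      normI (scaledChebPoly N m) / normE (N + 1) (scaledChebPoly N m) := by
  have hE := one_le_normE_scaledChebPoly hN hm
  have hm1' : (1 : ℝ) ≤ m := by exact_mod_cast hm1
  have hmN : (m : ℝ) ≤ N + 1 := by exact_mod_cast hm.trans (Nat.le_succ N)
  have hn : (1 : ℝ) ≤ (N + 1) ^ 2 := one_le_pow₀ (by linarith)
  have hI : chebMass N m / (4 * ((N : ℝ) + 1) ^ 2) ≤ normI (scaledChebPoly N m) := by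
    refine le_trans ?_ (le_normI_scaledChebPoly hN hm hm1)
    have h1 : (chebMass N m - 1) / (2 * ((N : ℝ) + 1) ^ 2) ≤
        (chebMass N m - 1) / (2 * (m : ℝ) ^ 2) := by
      have : 0 ≤ chebMass N m - 1 := by linarith
      gcongr
    refine le_trans ?_ (sub_le_sub_right h1 1)
    rw [le_sub_iff_add_le, div_add_one (by positivity), div_le_div_iff₀ (by positivity)
      (by positivity)]
    nlinarith
  rw [le_div_iff₀ (by linarith)]
  refine le_trans ?_ hI
  calc √(chebMass N m) / (4 * ((N : ℝ) + 1) ^ 3) * normE (N + 1) (scaledChebPoly N m)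
      ≤ √(chebMass N m) / (4 * ((N : ℝ) + 1) ^ 3) * (((N : ℝ) + 1) * √(chebMass N m)) := by
        gcongr
        exact normE_scaledChebPoly_le hN hm
    _ = √(chebMass N m) * √(chebMass N m) / (4 * ((N : ℝ) + 1) ^ 2) := by field_simp
    _ = _ := by rw [Real.mul_self_sqrt (chebMass_pos N m).le]

/-- Two-sided bounds for the extremal ratio. -/
lemma sSup_ratio_mem_Icc {N : ℕ} {r : ℝ} (hN : 4 ≤ N) (hr : 1 ≤ r) (hrN : r < N + 1)
    (hS : 6 * ((N : ℝ) + 1) ^ 2 ≤ chebMass N ⌊r⌋₊) :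
    sSup {t : ℝ | ∃ p : ℝ[X], p ≠ 0 ∧ (p.natDegree : ℝ) ≤ r ∧ t = normI p / normE (N + 1) p} ∈
      Set.Icc (√(chebMass N ⌊r⌋₊) / (4 * ((N : ℝ) + 1) ^ 3))
        (2 * ((N : ℝ) + 1) ^ 8 * √(chebMass N ⌊r⌋₊)) := by
  have hN0 : 0 < N := by omega
  have hm : ⌊r⌋₊ ≤ N := by
    rw [← Nat.lt_succ_iff, Nat.floor_lt (by linarith)]
    exact_mod_cast hrN
  have hm1 : 1 ≤ ⌊r⌋₊ := Nat.le_floor (by exact_mod_cast hr)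
  have hub : ∀ t ∈ {t : ℝ | ∃ p : ℝ[X], p ≠ 0 ∧ (p.natDegree : ℝ) ≤ r ∧
      t = normI p / normE (N + 1) p}, t ≤ 2 * ((N : ℝ) + 1) ^ 8 * √(chebMass N ⌊r⌋₊) := by
    rintro _ ⟨p, -, hp, rfl⟩
    exact div_le_of_le_mul₀ ((abs_nonneg _).trans (abs_eval_le_normE hN0 hN0.le p))
      (by positivity) (normI_le_mul_normE hN hm (Nat.le_floor hp))
  have hmem : normI (scaledChebPoly N ⌊r⌋₊) / normE (N + 1) (scaledChebPoly N ⌊r⌋₊) ∈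
      {t : ℝ | ∃ p : ℝ[X], p ≠ 0 ∧ (p.natDegree : ℝ) ≤ r ∧ t = normI p / normE (N + 1) p} :=
    ⟨_, scaledChebPoly_ne_zero hN0 hm, (Nat.cast_le.2 (natDegree_scaledChebPoly_le _ _)).trans
      (Nat.floor_le (by linarith)), rfl⟩
  exact ⟨(le_normI_div_normE_scaledChebPoly hN0 hm hm1 hS).trans (le_csSup ⟨_, hub⟩ hmem),
    csSup_le ⟨_, hmem⟩ hub⟩

/-! ### Asymptotics -/

lemma tendsto_log_factorial {a : ℕ → ℕ} {c : ℝ} (hc : 0 < c)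
    (ha : Tendsto (fun n => (a n : ℝ) / n) atTop (nhds c)) :
    Tendsto (fun n : ℕ => (Real.log (a n).factorial - a n * Real.log n) / n) atTop
      (nhds (c * Real.log c - c)) := by
  have hinv : Tendsto (fun n : ℕ => (n : ℝ)⁻¹) atTop (nhds 0) := tendsto_inv_atTop_nhds_zero_nat
  have hlog : Tendsto (fun n : ℕ => Real.log n / n) atTop (nhds 0) :=
    (Real.isLittleO_log_id_atTop.tendsto_div_nhds_zero).comp tendsto_natCast_atTop_atTop
  have hatop : Tendsto a atTop atTop := by
    rw [← tendsto_natCast_atTop_iff (R := ℝ)]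
    refine (ha.pos_mul_atTop hc tendsto_natCast_atTop_atTop).congr' ?_
    filter_upwards [eventually_gt_atTop 0] with n hn
    field_simp
  have hst : Tendsto (fun n => Real.log (Stirling.stirlingSeq (a n))) atTop
      (nhds (Real.log √Real.pi)) :=
    ((Real.continuousAt_log (by positivity)).tendsto.comp
      Stirling.tendsto_stirlingSeq_sqrt_pi).comp hatop
  have hlogc := (Real.continuousAt_log hc.ne').tendsto.comp ha
  have key := (((hst.add ((hlogc.const_add (Real.log 2)).const_mul (1 / 2))).mul hinv).add
    (hlog.const_mul (1 / 2))).add ((ha.mul hlogc).sub ha)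
  simp only [mul_zero, zero_add] at key
  refine key.congr' ?_
  filter_upwards [eventually_gt_atTop 0, hatop.eventually_gt_atTop 0] with n hn han
  have hn' : (n : ℝ) ≠ 0 := by positivity
  have han' : (a n : ℝ) ≠ 0 := by positivity
  simp only [Function.comp_apply]
  rw [Stirling.log_stirlingSeq_formula, Real.log_mul two_ne_zero han',
    Real.log_div han' (Real.exp_ne_zero 1), Real.log_exp, Real.log_div han' hn']
  field_simp
  ring

lemma tendsto_log_chebMass {α : ℝ} (hα : α ∈ Set.Ioo (0 : ℝ) 1) :
    Tendsto (fun n : ℕ => Real.log (chebMass (n - 1) ⌊α * n⌋₊) / n) atTop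
      (nhds (2 * Cconst α)) := by
  have hm : Tendsto (fun n : ℕ => (⌊α * n⌋₊ : ℝ) / n) atTop (nhds α) :=
    (tendsto_nat_floor_mul_div_atTop hα.1.le).comp tendsto_natCast_atTop_atTop
  have hinv : Tendsto (fun n : ℕ => (n : ℝ)⁻¹) atTop (nhds 0) := tendsto_inv_atTop_nhds_zero_nat
  have hfloor : ∀ n : ℕ, 0 < n → ⌊α * n⌋₊ ≤ n - 1 := by
    intro n hn
    have hn' : (0 : ℝ) < n := by exact_mod_cast hn
    have : ⌊α * n⌋₊ < n := by
      rw [Nat.floor_lt (mul_nonneg hα.1.le hn'.le)]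
      nlinarith [hα.2]
    omega
  have h1 : Tendsto (fun n : ℕ => ((n + ⌊α * n⌋₊ : ℕ) : ℝ) / n) atTop (nhds (1 + α)) := by
    refine (hm.const_add 1).congr' ?_
    filter_upwards [eventually_gt_atTop 0] with n hn
    push_cast
    field_simp
  have h2 : Tendsto (fun n : ℕ => ((n - 1 - ⌊α * n⌋₊ : ℕ) : ℝ) / n) atTop (nhds (1 - α)) := by
    have := (hinv.const_sub 1).sub hm
    rw [sub_zero] at this
    refine this.congr' ?_
    filter_upwards [eventually_gt_atTop 0] with n hn
    rw [Nat.cast_sub (hfloor n hn), Nat.cast_sub hn]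
    push_cast
    field_simp
  have h3 : Tendsto (fun n : ℕ => ((n : ℕ) : ℝ) / n) atTop (nhds 1) := by
    refine tendsto_const_nhds.congr' ?_
    filter_upwards [eventually_gt_atTop 0] with n hn
    field_simp
  have h4 : Tendsto (fun n : ℕ => ((n - 1 : ℕ) : ℝ) / n) atTop (nhds 1) := by
    have := hinv.const_sub 1
    rw [sub_zero] at this
    refine this.congr' ?_
    filter_upwards [eventually_gt_atTop 0] with n hn
    rw [Nat.cast_sub hn]
    push_cast
    field_simp
  have key := (((tendsto_log_factorial (by linarith [hα.1]) h1).add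
    (tendsto_log_factorial (by linarith [hα.2]) h2)).sub
    (tendsto_log_factorial one_pos h3)).sub (tendsto_log_factorial one_pos h4)
  have e : 2 * Cconst α = (1 + α) * Real.log (1 + α) - (1 + α) +
      ((1 - α) * Real.log (1 - α) - (1 - α)) - (1 * Real.log 1 - 1) - (1 * Real.log 1 - 1) := by
    rw [Cconst, Real.log_one]; ring
  rw [e]
  refine key.congr' ?_
  filter_upwards [eventually_gt_atTop 0] with n hn
  have hf : ∀ k : ℕ, (k.factorial : ℝ) ≠ 0 := fun k => by positivity
  rw [chebMass, Nat.sub_add_cancel hn, Real.log_div (mul_ne_zero (hf _) (hf _))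
    (mul_ne_zero (hf _) (hf _)), Real.log_mul (hf _) (hf _), Real.log_mul (hf _) (hf _),
    Nat.cast_sub (hfloor n hn), Nat.cast_sub hn]
  push_cast
  field_simp
  ring

lemma Cconst_pos {α : ℝ} (hα : α ∈ Set.Ioo (0 : ℝ) 1) : 0 < Cconst α := by
  have h := Real.strictConvexOn_mul_log.2
    (Set.mem_Ici.2 (by linarith [hα.1] : 0 ≤ 1 + α))
    (Set.mem_Ici.2 (by linarith [hα.2] : 0 ≤ 1 - α))
    (by linarith [hα.1]) (one_half_pos : (0 : ℝ) < 1 / 2) one_half_pos (by norm_num)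
  have e : 1 / 2 * (1 + α) + 1 / 2 * (1 - α) = 1 := by ring
  simp only [smul_eq_mul] at h
  rw [e, Real.log_one, mul_zero] at h
  rw [Cconst]
  linarith

end DiscreteChebyshev

open DiscreteChebyshev

theorem extremal_ratio_limit (α : ℝ) (hα : α ∈ Set.Ioo (0 : ℝ) 1) :
    Tendsto (fun n : ℕ =>
        (n : ℝ)⁻¹ * Real.log (sSup {t : ℝ | ∃ p : Polynomial ℝ, p ≠ 0 ∧
          (p.natDegree : ℝ) ≤ α * n ∧ t = normI p / normE n p}))
      atTop (nhds (Cconst α)) := by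
  have hinv : Tendsto (fun n : ℕ => (n : ℝ)⁻¹) atTop (nhds 0) := tendsto_inv_atTop_nhds_zero_nat
  have hlog : Tendsto (fun n : ℕ => Real.log n / n) atTop (nhds 0) :=
    (Real.isLittleO_log_id_atTop.tendsto_div_nhds_zero).comp tendsto_natCast_atTop_atTop
  have hS := tendsto_log_chebMass hα
  have hlarge : ∀ᶠ n : ℕ in atTop, 6 * (n : ℝ) ^ 2 ≤ chebMass (n - 1) ⌊α * n⌋₊ := by
    have h := ((hinv.const_mul (Real.log 6)).add (hlog.const_mul 2))
    rw [mul_zero, mul_zero, add_zero] at h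
    filter_upwards [h.eventually_lt hS (by linarith [Cconst_pos hα]), eventually_gt_atTop 0]
      with n hlt hn
    have hn' : (0 : ℝ) < n := by exact_mod_cast hn
    rw [← Real.log_le_log_iff (by positivity) (chebMass_pos _ _), Real.log_mul (by norm_num)
      (by positivity), Real.log_pow]
    rw [lt_div_iff₀ hn'] at hlt
    refine le_of_eq_of_le ?_ hlt.le
    push_cast
    field_simp
  have hbounds : ∀ᶠ n : ℕ in atTop, sSup {t : ℝ | ∃ p : Polynomial ℝ, p ≠ 0 ∧
      (p.natDegree : ℝ) ≤ α * n ∧ t = normI p / normE n p} ∈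
      Set.Icc (√(chebMass (n - 1) ⌊α * n⌋₊) / (4 * (n : ℝ) ^ 3))
        (2 * (n : ℝ) ^ 8 * √(chebMass (n - 1) ⌊α * n⌋₊)) := by
    filter_upwards [hlarge, eventually_ge_atTop 5,
      (tendsto_natCast_atTop_atTop.const_mul_atTop hα.1).eventually_ge_atTop 1] with n h6 hn hr
    obtain ⟨N, rfl⟩ : ∃ N, n = N + 1 := ⟨n - 1, by omega⟩
    have hN : (0 : ℝ) ≤ N := N.cast_nonneg
    have := sSup_ratio_mem_Icc (N := N) (r := α * ((N + 1 : ℕ) : ℝ)) (by omega) hr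
      (by push_cast; nlinarith [hα.2]) (by simpa using h6)
    simpa using this
  have hlow : Tendsto (fun n : ℕ => 1 / 2 * (Real.log (chebMass (n - 1) ⌊α * n⌋₊) / n) -
      (Real.log 4 * (n : ℝ)⁻¹ + 3 * (Real.log n / n))) atTop (nhds (Cconst α)) := by
    convert (hS.const_mul (1 / 2)).sub ((hinv.const_mul (Real.log 4)).add (hlog.const_mul 3))
      using 2
    ring
  have hupp : Tendsto (fun n : ℕ => 1 / 2 * (Real.log (chebMass (n - 1) ⌊α * n⌋₊) / n) +
      (Real.log 2 * (n : ℝ)⁻¹ + 8 * (Real.log n / n))) atTop (nhds (Cconst α)) := by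
    convert (hS.const_mul (1 / 2)).add ((hinv.const_mul (Real.log 2)).add (hlog.const_mul 8))
      using 2
    ring
  refine tendsto_of_tendsto_of_tendsto_of_le_of_le' hlow hupp ?_ ?_
  · filter_upwards [hbounds, eventually_gt_atTop 0] with n hb hn
    have hn' : (0 : ℝ) < n := by exact_mod_cast hn
    have hs : 0 < √(chebMass (n - 1) ⌊α * n⌋₊) := Real.sqrt_pos.2 (chebMass_pos _ _)
    have h := Real.log_le_log (by positivity) hb.1
    rw [Real.log_div hs.ne' (by positivity), Real.log_mul (by norm_num) (by positivity),
      Real.log_pow, Real.log_sqrt (chebMass_pos _ _).le] at h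
    refine le_of_eq_of_le ?_ (mul_le_mul_of_nonneg_left h (inv_nonneg.2 hn'.le))
    push_cast
    ring
  · filter_upwards [hbounds, eventually_gt_atTop 0] with n hb hn
    have hn' : (0 : ℝ) < n := by exact_mod_cast hn
    have hs : 0 < √(chebMass (n - 1) ⌊α * n⌋₊) := Real.sqrt_pos.2 (chebMass_pos _ _)
    have h := Real.log_le_log (lt_of_lt_of_le (by positivity) hb.1) hb.2
    rw [Real.log_mul (by positivity) hs.ne', Real.log_mul (by norm_num) (by positivity),
      Real.log_pow, Real.log_sqrt (chebMass_pos _ _).le] at h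
    refine le_of_le_of_eq (mul_le_mul_of_nonneg_left h (inv_nonneg.2 hn'.le)) ?_
    push_cast
    ring
end

section
/- Let α ∈ (0,1). For each n ≥ 2 let P_n* be a monic real polynomial of degree ⌊α·n⌋ that minimizes ‖P‖_{E_n} among all monic real polynomials of degree ⌊α·n⌋. Then lim_{n→∞} (1/n) · log ( ‖P_n*‖_{[−1,1]} / ‖P_n*‖_{E_n} ) = C(α), where C(α) = ((1+α)·log(1+α) + (1−α)·log(1−α))/2. -/
open MeasureTheory Polynomial Filter Set

/-! ### Binomial polynomials -/

/-- The binomial polynomial `x ↦ x (x - 1) ⋯ (x - j + 1) / j!`. -/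
noncomputable def binomPoly (j : ℕ) : ℝ[X] :=
  C ((j.factorial : ℝ)⁻¹) * descPochhammer ℝ j

theorem binomPoly_zero : binomPoly 0 = 1 := by simp [binomPoly]

theorem natDegree_binomPoly (j : ℕ) : (binomPoly j).natDegree = j := by
  have h : ((j.factorial : ℝ)⁻¹) ≠ 0 := by positivity
  rw [binomPoly, natDegree_C_mul h, descPochhammer_natDegree]

theorem leadingCoeff_binomPoly (j : ℕ) :
    (binomPoly j).leadingCoeff = (j.factorial : ℝ)⁻¹ := by
  rw [binomPoly, leadingCoeff_mul, leadingCoeff_C, (monic_descPochhammer ℝ j).leadingCoeff, mul_one]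

theorem succ_mul_binomPoly_eval_succ (j : ℕ) (x : ℝ) :
    ((j : ℝ) + 1) * (binomPoly (j + 1)).eval x = (x - j) * (binomPoly j).eval x := by
  simp only [binomPoly, eval_mul, eval_C, descPochhammer_succ_eval, Nat.factorial_succ]
  push_cast
  have : (j.factorial : ℝ) ≠ 0 := by positivity
  have : (j : ℝ) + 1 ≠ 0 := by positivity
  field_simp

theorem binomPoly_eval_add_one (j : ℕ) (x : ℝ) :
    (binomPoly (j + 1)).eval (x + 1) = (binomPoly (j + 1)).eval x + (binomPoly j).eval x := by
  induction j with
  | zero =>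
    have h1 := succ_mul_binomPoly_eval_succ 0 x
    have h2 := succ_mul_binomPoly_eval_succ 0 (x + 1)
    simp [binomPoly_zero] at h1 h2 ⊢
    rw [h1, h2]
  | succ j ih =>
    have h1 := succ_mul_binomPoly_eval_succ (j + 1) x
    have h2 := succ_mul_binomPoly_eval_succ (j + 1) (x + 1)
    have h3 := succ_mul_binomPoly_eval_succ j x
    rw [ih] at h2
    push_cast at h1 h2
    have h4 : (j : ℝ) + 1 + 1 ≠ 0 := by positivity
    apply mul_left_cancel₀ h4
    linear_combination h2 - h1 - h3

theorem binomPoly_eval_natCast (j n : ℕ) : (binomPoly j).eval (n : ℝ) = n.choose j := by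
  rw [binomPoly, eval_mul, eval_C, descPochhammer_eval_eq_descFactorial,
    Nat.descFactorial_eq_factorial_mul_choose]
  push_cast
  have : (j.factorial : ℝ) ≠ 0 := by positivity
  field_simp

theorem binomPoly_eval_neg_one (j : ℕ) : (binomPoly j).eval (-1) = (-1) ^ j := by
  induction j with
  | zero => simp [binomPoly_zero]
  | succ j ih =>
    have h := succ_mul_binomPoly_eval_succ j (-1)
    rw [ih] at h
    have h4 : (j : ℝ) + 1 ≠ 0 := by positivity
    apply mul_left_cancel₀ h4
    rw [h]; ring

theorem abs_binomPoly_eval_le_one (j : ℕ) {x : ℝ} (hx : |x| ≤ 1) :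
    |(binomPoly j).eval x| ≤ 1 := by
  induction j with
  | zero => simp [binomPoly_zero]
  | succ j ih =>
    have h := congrArg abs (succ_mul_binomPoly_eval_succ j x)
    rw [abs_mul, abs_mul] at h
    have h4 : (0 : ℝ) < (j : ℝ) + 1 := by positivity
    rw [abs_of_pos h4] at h
    have h5 : |x - j| ≤ j + 1 := by
      have := abs_le.1 hx
      rw [abs_le]; constructor <;> linarith [(Nat.cast_nonneg j : (0 : ℝ) ≤ j)]
    have : ((j : ℝ) + 1) * |(binomPoly (j + 1)).eval x| ≤ (j + 1) * 1 := by
      rw [h]; exact mul_le_mul h5 ih (abs_nonneg _) h4.le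
    exact le_of_mul_le_mul_left this h4

/-! ### Binomial convolution identities -/

theorem sum_antidiagonal_choose_mul_choose (a b k : ℕ) :
    ∑ p ∈ Finset.HasAntidiagonal.antidiagonal k, (a + p.1).choose a * (b + p.2).choose b =
      (a + b + 1 + k).choose (a + b + 1) := by
  have h := congrArg (PowerSeries.coeff k)
    (pow_add (PowerSeries.mk (1 : ℕ → ℝ)) (a + 1) (b + 1))
  rw [show a + 1 + (b + 1) = (a + b + 1) + 1 by ring, PowerSeries.mk_one_pow_eq_mk_choose_add,
    PowerSeries.mk_one_pow_eq_mk_choose_add, PowerSeries.mk_one_pow_eq_mk_choose_add,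
    PowerSeries.coeff_mul] at h
  simp only [PowerSeries.coeff_mk] at h
  exact_mod_cast h.symm

theorem sum_range_choose_mul_choose (m j k : ℕ) (hj : j ≤ m) :
    ∑ x ∈ Finset.range (m + 1), x.choose j * (m + k - x).choose k =
      (m + k + 1).choose (k + j + 1) := by
  have h := sum_antidiagonal_choose_mul_choose j k (m - j)
  rw [Finset.Nat.sum_antidiagonal_eq_sum_range_succ
    (fun p q => (j + p).choose j * (k + q).choose k)] at h
  rw [show j + k + 1 + (m - j) = m + k + 1 by omega, show j + k + 1 = k + j + 1 by ring] at h
  rw [← h, ← Finset.sum_subset (s₁ := Finset.Ico j (m + 1))]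
  · rw [Finset.sum_Ico_eq_sum_range]
    apply Finset.sum_congr (by congr 1; omega)
    intro x hx
    rw [Finset.mem_range] at hx
    congr 2; omega
  · intro x hx
    rw [Finset.mem_Ico] at hx
    rw [Finset.mem_range]; omega
  · intro x hx hx'
    rw [Finset.mem_Ico] at hx'
    rw [Finset.mem_range] at hx
    rw [Nat.choose_eq_zero_of_lt (by omega), zero_mul]

theorem sum_range_choose_sub_mul_choose (m k : ℕ) (hk : k ≤ m) :
    ∑ j ∈ Finset.range (k + 1), (m - j).choose (k - j) * (k + j).choose k =
      (m + 1 + k).choose k := by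
  have h := sum_antidiagonal_choose_mul_choose k (m - k) k
  rw [Finset.Nat.sum_antidiagonal_eq_sum_range_succ
    (fun p q => (k + p).choose k * (m - k + q).choose (m - k))] at h
  rw [show k + (m - k) + 1 + k = m + 1 + k by omega, show k + (m - k) + 1 = m + 1 by omega,
    Nat.choose_symm_add] at h
  rw [← h]
  refine Finset.sum_congr rfl fun j hj => ?_
  rw [Finset.mem_range] at hj
  rw [mul_comm, show m - k + (k - j) = m - j by omega,
    ← Nat.choose_symm (show m - k ≤ m - j by omega)]
  congr 2; omega

theorem alternating_sum_choose_mul_choose (k : ℕ) :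
    ∑ j ∈ Finset.range (k + 1),
      (-1 : ℝ) ^ j * ((2 * k + 1).choose (k - j) * (k + j).choose k) = 1 := by
  have h : ((1 - PowerSeries.X : PowerSeries ℝ)) ^ (2 * k + 1) * (PowerSeries.mk 1) ^ (k + 1)
      = (1 - PowerSeries.X) ^ k := by
    rw [show 2 * k + 1 = k + (k + 1) by ring, pow_add, mul_assoc, ← mul_pow]
    have : (1 - PowerSeries.X : PowerSeries ℝ) * PowerSeries.mk 1 = 1 := by
      rw [mul_comm]; exact PowerSeries.mk_one_mul_one_sub_eq_one ℝ
    rw [this]; simp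
  have hc : ∀ n i : ℕ, PowerSeries.coeff i ((1 - PowerSeries.X : PowerSeries ℝ) ^ n)
      = (-1) ^ i * n.choose i := by
    intro n i
    have : (1 - PowerSeries.X : PowerSeries ℝ) ^ n = (((1 - X) ^ n : ℝ[X]) : PowerSeries ℝ) := by
      simp
    rw [this, Polynomial.coeff_coe]
    have h2 : (1 - X : ℝ[X]) ^ n = ((1 + X) ^ n).comp (C (-1) * X) := by simp [sub_eq_add_neg]
    rw [h2, comp_C_mul_X_coeff, coeff_one_add_X_pow, mul_comm]
  have h1 := congrArg (PowerSeries.coeff k) h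
  rw [PowerSeries.mk_one_pow_eq_mk_choose_add, PowerSeries.coeff_mul, hc,
    ← Finset.Nat.sum_antidiagonal_swap,
    Finset.Nat.sum_antidiagonal_eq_sum_range_succ_mk] at h1
  simp only [hc, Nat.choose_self, Nat.cast_one, mul_one, PowerSeries.coeff_mk, Prod.swap] at h1
  have h2 : ∀ j ∈ Finset.range (k + 1), (-1 : ℝ) ^ j * ((2 * k + 1).choose (k - j) * (k + j).choose k)
      = (-1) ^ k * ((-1) ^ (k - j) * ((2 * k + 1).choose (k - j)) * (k + j).choose k) := by
    intro j hj
    rw [Finset.mem_range] at hj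
    have : (-1 : ℝ) ^ j = (-1) ^ k * (-1) ^ (k - j) := by
      rw [← pow_add, show k + (k - j) = 2 * (k - j) + j by omega, pow_add, pow_mul]; simp
    rw [this]; ring
  rw [Finset.sum_congr rfl h2, ← Finset.mul_sum, h1, ← pow_add, ← two_mul, pow_mul]; simp

/-! ### Gram polynomials (discrete Chebyshev polynomials) on `{0, …, m}` -/

/-- The coefficients of the Gram polynomial in the basis of binomial polynomials. -/
noncomputable def gramCoeff (m k j : ℕ) : ℝ :=
  (-1) ^ j * ((m - j).choose (k - j) * (k + j).choose k)

/-- The Gram polynomial of degree `k` on the grid `{0, …, m}`. -/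
noncomputable def gramPoly (m k : ℕ) : ℝ[X] :=
  ∑ j ∈ Finset.range (k + 1), C (gramCoeff m k j) * binomPoly j

theorem gramPoly_zero (m : ℕ) : gramPoly m 0 = 1 := by
  simp [gramPoly, gramCoeff, binomPoly_zero]

theorem gramPoly_eval (m k : ℕ) (x : ℝ) :
    (gramPoly m k).eval x =
      ∑ j ∈ Finset.range (k + 1), gramCoeff m k j * (binomPoly j).eval x := by
  simp [gramPoly, eval_finsetSum]

theorem natDegree_gramPoly_le (m k : ℕ) : (gramPoly m k).natDegree ≤ k := by
  refine natDegree_sum_le_of_forall_le _ _ fun j hj => ?_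
  refine (natDegree_C_mul_le _ _).trans ?_
  rw [natDegree_binomPoly]
  exact Nat.lt_succ_iff.1 (Finset.mem_range.1 hj)

theorem coeff_gramPoly_self (m k : ℕ) :
    (gramPoly m k).coeff k = (-1) ^ k * (2 * k).choose k * (k.factorial : ℝ)⁻¹ := by
  rw [gramPoly, finsetSum_coeff, Finset.sum_range_succ, Finset.sum_eq_zero]
  · have := leadingCoeff_binomPoly k
    rw [leadingCoeff, natDegree_binomPoly] at this
    rw [coeff_C_mul, this, gramCoeff, ← two_mul]
    simp
  · intro j hj
    rw [coeff_C_mul, coeff_eq_zero_of_natDegree_lt, mul_zero]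
    rw [natDegree_binomPoly]; exact Finset.mem_range.1 hj

theorem coeff_gramPoly_self_ne_zero (m k : ℕ) : (gramPoly m k).coeff k ≠ 0 := by
  rw [coeff_gramPoly_self]
  have : (2 * k).choose k ≠ 0 := (Nat.choose_pos (by omega)).ne'
  have : (k.factorial : ℝ) ≠ 0 := by positivity
  simp_all

theorem gramPoly_eval_neg_one {m k : ℕ} (hk : k ≤ m) :
    (gramPoly m k).eval (-1) = (m + 1 + k).choose k := by
  rw [gramPoly_eval, ← sum_range_choose_sub_mul_choose m k hk]
  push_cast
  refine Finset.sum_congr rfl fun j _ => ?_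
  rw [binomPoly_eval_neg_one, gramCoeff, mul_right_comm, ← pow_add, ← two_mul, pow_mul]
  simp

theorem abs_gramPoly_eval_le {m k : ℕ} (hk : k ≤ m) {x : ℝ} (hx : |x| ≤ 1) :
    |(gramPoly m k).eval x| ≤ (m + 1 + k).choose k := by
  rw [gramPoly_eval, ← sum_range_choose_sub_mul_choose m k hk]
  push_cast
  refine (Finset.abs_sum_le_sum_abs _ _).trans (Finset.sum_le_sum fun j _ => ?_)
  have h : |gramCoeff m k j| = (m - j).choose (k - j) * (k + j).choose k := by
    rw [gramCoeff, abs_mul, abs_pow, abs_neg, abs_one, one_pow, one_mul, abs_of_nonneg]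
    positivity
  rw [abs_mul, h]
  exact mul_le_of_le_one_right (by positivity) (abs_binomPoly_eval_le_one j hx)

theorem mul_binomPoly_eval_sub_one (j : ℕ) (x : ℝ) :
    x * (binomPoly j).eval (x - 1) = (j + 1) * (binomPoly (j + 1)).eval x := by
  have h1 := binomPoly_eval_add_one j (x - 1)
  have h2 := succ_mul_binomPoly_eval_succ j (x - 1)
  rw [sub_add_cancel] at h1
  rw [h1]
  linear_combination -h2

theorem binomPoly_difference_eq (m j : ℕ) (x : ℝ) :
    (x + 1) * (m - x) * ((binomPoly (j + 1)).eval (x + 1) - (binomPoly (j + 1)).eval x)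
      - x * (m + 1 - x) * ((binomPoly (j + 1)).eval x - (binomPoly (j + 1)).eval (x - 1))
      = -((j + 1) * (j + 2)) * (binomPoly (j + 1)).eval x
        + (j + 1) * (m - j) * (binomPoly j).eval x := by
  have h0 := binomPoly_eval_add_one j x
  have h1 := binomPoly_eval_add_one j (x - 1)
  have h2 := succ_mul_binomPoly_eval_succ j x
  have h3 := mul_binomPoly_eval_sub_one j x
  rw [sub_add_cancel] at h1
  linear_combination (x + 1) * (m - x) * h0 - x * (m + 1 - x) * h1 - (m + 1 - x) * h3 + (-(m + 1 - x) + j + 2) * h2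

theorem gramCoeff_succ {m k j : ℕ} (hk : k ≤ m) (hj : j < k) :
    gramCoeff m k (j + 1) * ((j + 1) * (m - j)) = -gramCoeff m k j * ((k - j) * (k + j + 1)) := by
  obtain ⟨i, rfl⟩ := Nat.exists_eq_add_of_lt hj
  obtain ⟨l, rfl⟩ := Nat.exists_eq_add_of_le hk
  simp only [gramCoeff]
  rw [show j + i + 1 + l - (j + 1) = i + l by omega, show j + i + 1 - (j + 1) = i by omega,
    show j + i + 1 + l - j = i + l + 1 by omega, show j + i + 1 - j = i + 1 by omega]
  have h1 := Nat.add_one_mul_choose_eq (i + l) i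
  have h2 := Nat.choose_mul_succ_eq (j + i + 1 + j) (j + i + 1)
  rw [show j + i + 1 + j + 1 - (j + i + 1) = j + 1 by omega] at h2
  rw [show j + i + 1 + (j + 1) = j + i + 1 + j + 1 by ring]
  rify at h1 h2
  push_cast
  rw [pow_succ]
  linear_combination (-1 : ℝ) ^ j * (-((j + i + 1 + j + 1).choose (j + i + 1) * (j + 1)) * h1
    + (i + l + 1).choose (i + 1) * (i + 1) * h2)

theorem gramPoly_difference_eq {m k : ℕ} (hk : k ≤ m) (x : ℝ) :
    (x + 1) * (m - x) * ((gramPoly m k).eval (x + 1) - (gramPoly m k).eval x)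
      - x * (m + 1 - x) * ((gramPoly m k).eval x - (gramPoly m k).eval (x - 1))
      = -(k * (k + 1)) * (gramPoly m k).eval x := by
  have hl : ∀ y, (gramPoly m k).eval y = ∑ j ∈ Finset.range k,
      gramCoeff m k (j + 1) * (binomPoly (j + 1)).eval y + gramCoeff m k 0 := by
    intro y
    rw [gramPoly_eval, Finset.sum_range_succ']
    simp [binomPoly_zero]
  have h1 : (x + 1) * (m - x) * ((gramPoly m k).eval (x + 1) - (gramPoly m k).eval x)
      - x * (m + 1 - x) * ((gramPoly m k).eval x - (gramPoly m k).eval (x - 1))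
      = ∑ j ∈ Finset.range k, (gramCoeff m k (j + 1) *
        (-((j + 1) * (j + 2)) * (binomPoly (j + 1)).eval x)
        + gramCoeff m k (j + 1) * ((j + 1) * (m - j)) * (binomPoly j).eval x) := by
    rw [hl, hl, hl, add_sub_add_right_eq_sub, add_sub_add_right_eq_sub, ← Finset.sum_sub_distrib,
      ← Finset.sum_sub_distrib, Finset.mul_sum, Finset.mul_sum, ← Finset.sum_sub_distrib]
    refine Finset.sum_congr rfl fun j _ => ?_
    linear_combination gramCoeff m k (j + 1) * binomPoly_difference_eq m j x
  have h2 : ∑ j ∈ Finset.range k, gramCoeff m k (j + 1) * ((j + 1) * (m - j))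
      * (binomPoly j).eval x = ∑ j ∈ Finset.range (k + 1),
        -gramCoeff m k j * ((k - j) * (k + j + 1)) * (binomPoly j).eval x := by
    rw [Finset.sum_range_succ]
    simp only [sub_self, zero_mul, mul_zero, add_zero]
    refine Finset.sum_congr rfl fun j hj => ?_
    rw [gramCoeff_succ hk (Finset.mem_range.1 hj)]
  have h3 : ∑ j ∈ Finset.range k, gramCoeff m k (j + 1) *
        (-((j + 1) * (j + 2)) * (binomPoly (j + 1)).eval x) = ∑ j ∈ Finset.range (k + 1),
        gramCoeff m k j * (-(j * (j + 1)) * (binomPoly j).eval x) := by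
    rw [Finset.sum_range_succ']
    simp only [Nat.cast_add, Nat.cast_one, CharP.cast_eq_zero, zero_mul, neg_zero, mul_zero,
      add_zero]
    refine Finset.sum_congr rfl fun j _ => ?_
    ring
  rw [h1, Finset.sum_add_distrib, h2, h3, ← Finset.sum_add_distrib, gramPoly_eval, Finset.mul_sum]
  refine Finset.sum_congr rfl fun j _ => ?_
  ring

theorem sum_gramPoly_mul_gramPoly {m k l : ℕ} (hk : k ≤ m) (hl : l ≤ m) (hkl : k ≠ l) :
    ∑ x ∈ Finset.range (m + 1), (gramPoly m k).eval (x : ℝ) * (gramPoly m l).eval (x : ℝ) = 0 := by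
  set f : ℝ → ℝ := fun x => (gramPoly m k).eval x with hf
  set g : ℝ → ℝ := fun x => (gramPoly m l).eval x with hg
  set D : ℕ → ℝ := fun x => (x : ℝ) * (m + 1 - x) * (f x * g (x - 1) - f (x - 1) * g x) with hD
  have h := Finset.sum_range_sub D (m + 1)
  have hz : D (m + 1) - D 0 = 0 := by simp [hD]
  have hs : ∀ x : ℕ, D (x + 1) - D x =
      ((l : ℝ) * (l + 1) - k * (k + 1)) * (f x * g x) := by
    intro x
    have hf' := gramPoly_difference_eq hk (x : ℝ)
    have hg' := gramPoly_difference_eq hl (x : ℝ)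
    simp only [hD]
    push_cast
    rw [add_sub_cancel_right]
    linear_combination (g x) * hf' - (f x) * hg'
  rw [hz, Finset.sum_congr rfl fun x _ => hs x, ← Finset.mul_sum] at h
  refine (mul_eq_zero.1 h).resolve_left fun h0 => hkl ?_
  have h1 : ((l : ℝ) - k) * (l + k + 1) = 0 := by linear_combination h0
  have h2 : (l : ℝ) + k + 1 ≠ 0 := by positivity
  have := (mul_eq_zero.1 h1).resolve_right h2
  exact_mod_cast (sub_eq_zero.1 this).symm

theorem exists_eq_sum_gramPoly (m d : ℕ) (p : ℝ[X]) (hp : p.natDegree ≤ d) :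
    ∃ a : ℕ → ℝ, p = ∑ k ∈ Finset.range (d + 1), C (a k) * gramPoly m k := by
  induction d generalizing p with
  | zero =>
    refine ⟨fun _ => p.coeff 0, ?_⟩
    simp only [zero_add, Finset.range_one, Finset.sum_singleton, gramPoly_zero, mul_one]
    exact eq_C_of_natDegree_le_zero hp
  | succ d ih =>
    set b := p.coeff (d + 1) / (gramPoly m (d + 1)).coeff (d + 1) with hb
    obtain ⟨a, ha⟩ := ih (p - C b * gramPoly m (d + 1)) (by
      rw [natDegree_le_iff_coeff_eq_zero]
      intro N hN
      rcases eq_or_lt_of_le (Nat.succ_le_of_lt hN) with h | h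
      · rw [← h, coeff_sub, coeff_C_mul, hb, Nat.succ_eq_add_one,
          div_mul_cancel₀ _ (coeff_gramPoly_self_ne_zero m (d + 1)), sub_self]
      · rw [coeff_sub, coeff_C_mul, coeff_eq_zero_of_natDegree_lt (by omega),
          coeff_eq_zero_of_natDegree_lt ((natDegree_gramPoly_le m (d + 1)).trans_lt h)]
        simp)
    refine ⟨fun k => if k = d + 1 then b else a k, ?_⟩
    rw [Finset.sum_range_succ]
    simp only [if_true]
    rw [← sub_eq_iff_eq_add, ha]
    refine Finset.sum_congr rfl fun k hk => ?_
    rw [if_neg (Finset.mem_range.1 hk).ne]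

theorem sum_gramPoly_mul_eq_zero {m k : ℕ} (hk : k ≤ m) {p : ℝ[X]} (hp : p.degree < k) :
    ∑ x ∈ Finset.range (m + 1), (gramPoly m k).eval (x : ℝ) * p.eval (x : ℝ) = 0 := by
  rcases eq_or_ne p 0 with rfl | h0
  · simp
  rw [← natDegree_lt_iff_degree_lt h0] at hp
  obtain ⟨a, ha⟩ := exists_eq_sum_gramPoly m p.natDegree p le_rfl
  have h : ∀ x : ℕ, (gramPoly m k).eval (x : ℝ) * p.eval (x : ℝ) =
      ∑ l ∈ Finset.range (p.natDegree + 1),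
        a l * ((gramPoly m k).eval (x : ℝ) * (gramPoly m l).eval (x : ℝ)) := by
    intro x
    conv_lhs => rw [ha]
    rw [eval_finsetSum, Finset.mul_sum]
    refine Finset.sum_congr rfl fun l _ => ?_
    rw [eval_mul, eval_C]; ring
  rw [Finset.sum_congr rfl fun x _ => h x, Finset.sum_comm]
  refine Finset.sum_eq_zero fun l hl => ?_
  rw [Finset.mem_range] at hl
  rw [← Finset.mul_sum, sum_gramPoly_mul_gramPoly hk (by omega) (by omega), mul_zero]

theorem sum_gramPoly_mul_binomPoly {m k : ℕ} (hk : k ≤ m) :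
    ∑ x ∈ Finset.range (m + 1), (gramPoly m k).eval (x : ℝ) *
      (binomPoly k).eval ((m + k : ℕ) - x : ℝ) = (m + k + 1).choose (2 * k + 1) := by
  have h : ∀ x ∈ Finset.range (m + 1), (gramPoly m k).eval (x : ℝ) *
      (binomPoly k).eval ((m + k : ℕ) - x : ℝ) = ∑ j ∈ Finset.range (k + 1),
        gramCoeff m k j * ((x.choose j * (m + k - x).choose k : ℕ) : ℝ) := by
    intro x hx
    rw [Finset.mem_range] at hx
    rw [← Nat.cast_sub (by omega), gramPoly_eval, Finset.sum_mul, binomPoly_eval_natCast]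
    refine Finset.sum_congr rfl fun j _ => ?_
    rw [binomPoly_eval_natCast]; push_cast; ring
  rw [Finset.sum_congr rfl h, Finset.sum_comm]
  have h2 : ∀ j ∈ Finset.range (k + 1), ∑ x ∈ Finset.range (m + 1),
      gramCoeff m k j * ((x.choose j * (m + k - x).choose k : ℕ) : ℝ) =
      (m + k + 1).choose (2 * k + 1) *
        ((-1) ^ j * ((2 * k + 1).choose (k - j) * (k + j).choose k)) := by
    intro j hj
    rw [Finset.mem_range] at hj
    rw [← Finset.mul_sum, ← Nat.cast_sum, sum_range_choose_mul_choose m j k (by omega), gramCoeff]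
    have h3 := Nat.choose_mul (n := m + k + 1) (k := 2 * k + 1) (s := k + j + 1)
      (by omega)
    rw [show m + k + 1 - (k + j + 1) = m - j by omega,
      show 2 * k + 1 - (k + j + 1) = k - j by omega,
      ← Nat.choose_symm (show k + j + 1 ≤ 2 * k + 1 by omega),
      show 2 * k + 1 - (k + j + 1) = k - j by omega] at h3
    rify at h3
    linear_combination (-1 : ℝ) ^ j * (k + j).choose k * -h3
  rw [Finset.sum_congr rfl h2, ← Finset.mul_sum, alternating_sum_choose_mul_choose, mul_one]

theorem sum_gramPoly_sq {m k : ℕ} (hk : k ≤ m) :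
    ∑ x ∈ Finset.range (m + 1), (gramPoly m k).eval (x : ℝ) ^ 2 =
      (2 * k).choose k * (m + k + 1).choose (2 * k + 1) := by
  set q : ℝ[X] := (binomPoly k).comp (C (-1) * X + C ((m + k : ℕ) : ℝ)) with hq
  have hql : (C (-1) * X + C ((m + k : ℕ) : ℝ)).natDegree = 1 := natDegree_linear (by norm_num)
  have hqd : q.natDegree = k := by rw [hq, natDegree_comp, natDegree_binomPoly, hql, mul_one]
  have hqc : q.coeff k = (-1) ^ k * (k.factorial : ℝ)⁻¹ := by
    have : q.coeff k = q.leadingCoeff := by rw [leadingCoeff, hqd]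
    rw [this, hq, leadingCoeff_comp (by rw [hql]; norm_num), leadingCoeff_binomPoly,
      natDegree_binomPoly, leadingCoeff_linear (by norm_num), mul_comm]
  have hqe : ∀ x : ℝ, q.eval x = (binomPoly k).eval ((m + k : ℕ) - x : ℝ) := by
    intro x
    rw [hq, eval_comp]; congr 1; simp; ring
  have hdeg : (gramPoly m k - C ((2 * k).choose k : ℝ) * q).degree < k := by
    rw [degree_lt_iff_coeff_zero]
    intro i hi
    rcases eq_or_lt_of_le hi with h | h
    · rw [← h, coeff_sub, coeff_C_mul, coeff_gramPoly_self, hqc]; ring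
    · rw [coeff_sub, coeff_C_mul,
        coeff_eq_zero_of_natDegree_lt ((natDegree_gramPoly_le m k).trans_lt h),
        coeff_eq_zero_of_natDegree_lt (hqd.trans_lt h)]
      simp
  have h := sum_gramPoly_mul_eq_zero hk hdeg
  have h2 := sum_gramPoly_mul_binomPoly hk
  rw [← h2, Finset.mul_sum, ← sub_eq_zero, ← h, ← Finset.sum_sub_distrib]
  refine Finset.sum_congr rfl fun x _ => ?_
  rw [eval_sub, eval_mul, eval_C, hqe]; ring

/-! ### Ratio of endpoint value and norm -/

/-- The square of the ratio between the value at `-1` and the `ℓ²` norm of the Gram polynomial of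
degree `k` on a grid with `N` points. -/
noncomputable def gramRatio (N k : ℕ) : ℝ :=
  (2 * k + 1) * (N + k).factorial * (N - k - 1).factorial / (N.factorial : ℝ) ^ 2

theorem gramRatio_nonneg (N k : ℕ) : 0 ≤ gramRatio N k := by
  unfold gramRatio; positivity

theorem sum_gramPoly_sq_pos {m k : ℕ} (hk : k ≤ m) :
    0 < ∑ x ∈ Finset.range (m + 1), (gramPoly m k).eval (x : ℝ) ^ 2 := by
  rw [sum_gramPoly_sq hk]
  have h1 : 0 < (2 * k).choose k := Nat.choose_pos (by omega)
  have h2 : 0 < (m + k + 1).choose (2 * k + 1) := Nat.choose_pos (by omega)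
  positivity

theorem choose_sq_eq_gramRatio_mul {m k : ℕ} (hk : k ≤ m) :
    (((m + 1 + k).choose k : ℕ) : ℝ) ^ 2 = gramRatio (m + 1) k *
      ∑ x ∈ Finset.range (m + 1), (gramPoly m k).eval (x : ℝ) ^ 2 := by
  obtain ⟨l, rfl⟩ := Nat.exists_eq_add_of_le hk
  rw [sum_gramPoly_sq hk, gramRatio, show k + l + k + 1 = 2 * k + 1 + l by ring,
    show k + l + 1 + k = k + (k + l + 1) by ring, two_mul,
    show k + l + 1 - k - 1 = l by omega]
  rw [Nat.cast_add_choose, Nat.cast_add_choose, ← two_mul, show (2 * k).choose k = (k + k).choose k by rw [two_mul],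
    Nat.cast_add_choose]
  rw [show 2 * k + 1 + l = k + (k + l + 1) by ring,
    show 2 * k + 1 = k + k + 1 by ring, Nat.factorial_succ (k + k)]
  push_cast
  have h1 := Nat.cast_ne_zero (R := ℝ).2 (Nat.factorial_ne_zero k)
  have h2 := Nat.cast_ne_zero (R := ℝ).2 (Nat.factorial_ne_zero l)
  have h3 := Nat.cast_ne_zero (R := ℝ).2 (Nat.factorial_ne_zero (k + k))
  have h4 := Nat.cast_ne_zero (R := ℝ).2 (Nat.factorial_ne_zero (k + l + 1))
  have h5 : (k : ℝ) + k + 1 ≠ 0 := by positivity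
  field_simp
  ring

theorem gramRatio_mono {m k d : ℕ} (hkd : k ≤ d) (hd : d ≤ m) :
    gramRatio (m + 1) k ≤ gramRatio (m + 1) d := by
  induction d, hkd using Nat.le_induction with
  | base => exact le_rfl
  | succ d hkd ih =>
    refine (ih (by omega)).trans ?_
    obtain ⟨l, rfl⟩ := Nat.exists_eq_add_of_le hd
    unfold gramRatio
    rw [show d + 1 + l + 1 - d - 1 = l + 1 by omega, show d + 1 + l + 1 - (d + 1) - 1 = l by omega,
      Nat.factorial_succ l, show d + 1 + l + 1 + (d + 1) = d + 1 + l + 1 + d + 1 by ring,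
      Nat.factorial_succ (d + 1 + l + 1 + d)]
    push_cast
    gcongr ?_ / _
    rw [mul_assoc, mul_assoc]
    have : ((l : ℝ) + 1) ≤ d + 1 + l + 1 + d + 1 := by
      linarith [(Nat.cast_nonneg d : (0 : ℝ) ≤ d)]
    calc (2 * (d : ℝ) + 1) * ((d + 1 + l + 1 + d).factorial * ((l + 1) * l.factorial))
        ≤ (2 * ((d : ℝ) + 1) + 1) * ((d + 1 + l + 1 + d).factorial *
          ((d + 1 + l + 1 + d + 1) * l.factorial)) := by gcongr; linarith
      _ = _ := by ring

theorem one_le_mul_gramRatio {m k : ℕ} (hk : k ≤ m) : 1 ≤ (m + 1) * gramRatio (m + 1) k := by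
  have h := gramRatio_mono (Nat.zero_le k) hk
  have h0 : ((m : ℝ) + 1) * gramRatio (m + 1) 0 = 1 := by
    simp only [gramRatio]
    simp only [add_zero, Nat.sub_zero, Nat.add_sub_cancel, Nat.factorial_succ]
    push_cast
    have h1 := Nat.cast_ne_zero (R := ℝ).2 (Nat.factorial_ne_zero m)
    have h2 : (m : ℝ) + 1 ≠ 0 := by positivity
    field_simp
    ring
  exact h0.symm.trans_le (mul_le_mul_of_nonneg_left h (by positivity : (0 : ℝ) ≤ m + 1))

/-! ### Interpolation near the middle of the grid -/

theorem prod_range_abs_sub_erase {m j : ℕ} (hj : j ≤ m) :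
    ∏ i ∈ (Finset.range (m + 1)).erase j, |(j : ℝ) - i| = j.factorial * (m - j).factorial := by
  obtain ⟨l, rfl⟩ := Nat.exists_eq_add_of_le hj
  have h1 : ∏ i ∈ (Finset.range (j + l + 1)).erase j, |(j : ℝ) - i| =
      ∏ i ∈ Finset.range (j + (1 + l)), if i = j then 1 else |(j : ℝ) - i| := by
    rw [show j + l + 1 = j + (1 + l) by ring,
      ← Finset.mul_prod_erase _ _ (show j ∈ Finset.range (j + (1 + l)) by simp), if_pos rfl, one_mul]
    exact Finset.prod_congr rfl fun i hi => (if_neg (Finset.ne_of_mem_erase hi)).symm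
  rw [h1, Finset.prod_range_add, Finset.prod_range_add, Finset.prod_range_one, add_zero,
    if_pos rfl, one_mul, Nat.add_sub_cancel_left]
  congr 1
  · rw [← Finset.prod_range_add_one_eq_factorial, ← Finset.prod_range_reflect, Nat.cast_prod]
    refine Finset.prod_congr rfl fun i hi => ?_
    rw [Finset.mem_range] at hi
    rw [if_neg (by omega), Nat.sub_sub, Nat.cast_sub (by omega), abs_of_nonneg]
    · push_cast; ring
    · push_cast; linarith [(Nat.cast_nonneg i : (0 : ℝ) ≤ i)]
  · rw [← Finset.prod_range_add_one_eq_factorial, Nat.cast_prod]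
    refine Finset.prod_congr rfl fun i hi => ?_
    rw [if_neg (by omega), abs_sub_comm, abs_of_nonneg]
    · push_cast; ring
    · push_cast; linarith [(Nat.cast_nonneg i : (0 : ℝ) ≤ i)]

theorem prod_range_abs_sub_erase_le {m μ : ℕ} (j : ℕ) (hμ : μ ≤ m) {x : ℝ} (h0 : (μ : ℝ) ≤ x)
    (h1 : x ≤ μ + 1) :
    ∏ i ∈ (Finset.range (m + 1)).erase j, |x - i| ≤ (μ + 1).factorial * (m - μ).factorial := by
  set u : ℕ → ℝ := fun i => if i ≤ μ then (μ : ℝ) + 1 - i else (i : ℝ) - μ with hu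
  have hu1 : ∀ i, 1 ≤ u i := by
    intro i
    simp only [hu]
    split_ifs with h
    · have : (i : ℝ) ≤ μ := by exact_mod_cast h
      linarith
    · have : (μ : ℝ) + 1 ≤ i := by exact_mod_cast (not_le.1 h)
      linarith
  have hxu : ∀ i : ℕ, |x - i| ≤ u i := by
    intro i
    simp only [hu]
    split_ifs with h
    · have : (i : ℝ) ≤ μ := by exact_mod_cast h
      rw [abs_of_nonneg] <;> linarith
    · have : (μ : ℝ) + 1 ≤ i := by exact_mod_cast (not_le.1 h)
      rw [abs_of_nonpos] <;> linarith
  obtain ⟨l, rfl⟩ := Nat.exists_eq_add_of_le hμ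
  calc ∏ i ∈ (Finset.range (μ + l + 1)).erase j, |x - i|
      ≤ ∏ i ∈ (Finset.range (μ + l + 1)).erase j, u i :=
        Finset.prod_le_prod (fun i _ => abs_nonneg _) fun i _ => hxu i
    _ ≤ ∏ i ∈ Finset.range (μ + l + 1), u i :=
        Finset.prod_le_prod_of_subset_of_one_le (Finset.erase_subset _ _)
          (fun i _ => zero_le_one.trans (hu1 i)) fun i _ _ => hu1 i
    _ = (μ + 1).factorial * (μ + l - μ).factorial := by
      rw [show μ + l + 1 = μ + 1 + l by ring, Finset.prod_range_add, Nat.add_sub_cancel_left]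
      congr 1
      · rw [← Finset.prod_range_add_one_eq_factorial, ← Finset.prod_range_reflect, Nat.cast_prod]
        refine Finset.prod_congr rfl fun i hi => ?_
        rw [Finset.mem_range] at hi
        simp only [hu]
        rw [if_pos (by omega), Nat.sub_sub, Nat.cast_sub (by omega)]
        push_cast; ring
      · rw [← Finset.prod_range_add_one_eq_factorial, Nat.cast_prod]
        refine Finset.prod_congr rfl fun i hi => ?_
        simp only [hu]
        rw [if_neg (by omega)]
        push_cast; ring

theorem factorial_mul_factorial_le {m μ j : ℕ} (hm : 4 ≤ m) (hj : j ≤ m) (h1 : m / 2 ≤ μ + 1)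
    (h2 : μ ≤ m / 2 + 2) :
    (μ + 1).factorial * (m - μ).factorial ≤ (m + 1) ^ 3 * (j.factorial * (m - j).factorial) := by
  obtain ⟨h, hh⟩ : ∃ h, h = m / 2 := ⟨_, rfl⟩
  obtain ⟨g, rfl⟩ : ∃ g, m = h + g + 2 := ⟨m - h - 2, by omega⟩
  have hmid : h.factorial * (g + 2).factorial ≤ j.factorial * (h + g + 2 - j).factorial := by
    have h3 := Nat.choose_le_middle j (h + g + 2)
    rw [← hh] at h3
    have h4 := Nat.choose_mul_factorial_mul_factorial hj
    have h5 := Nat.choose_mul_factorial_mul_factorial (show h ≤ h + g + 2 by omega)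
    rw [show h + g + 2 - h = g + 2 by omega] at h5
    have h6 : 0 < (h + g + 2).choose h := Nat.choose_pos (by omega)
    by_contra! h7
    have := Nat.mul_lt_mul_of_le_of_lt h3 h7 h6
    rw [← mul_assoc, ← mul_assoc, h4, h5] at this
    exact lt_irrefl _ this
  refine le_trans ?_ (Nat.mul_le_mul_left _ hmid)
  have e1 : (g + 2).factorial = (g + 2) * ((g + 1) * g.factorial) := by
    rw [Nat.factorial_succ, Nat.factorial_succ]
  have hf : 0 < h.factorial * g.factorial := by positivity
  have key : ∀ a b : ℕ, a ≤ (h + g + 2 + 1) ^ 3 * b →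
      a * (h.factorial * g.factorial) ≤ (h + g + 2 + 1) ^ 3 * (b * (h.factorial * g.factorial)) :=
    fun a b hab => by
      rw [← mul_assoc _ b]; exact Nat.mul_le_mul_right _ hab
  have hμ : μ + 1 = h ∨ μ = h ∨ μ = h + 1 ∨ μ = h + 2 := by omega
  have hb : h.factorial * ((g + 2) * ((g + 1) * g.factorial)) =
      ((g + 2) * (g + 1)) * (h.factorial * g.factorial) := by ring
  rw [e1, hb]
  rcases hμ with hμ | rfl | rfl | rfl
  · obtain ⟨h', rfl⟩ : ∃ h', h = h' + 1 := ⟨h - 1, by omega⟩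
    obtain rfl : μ = h' := by omega
    rw [show μ + 1 + g + 2 - μ = g + 3 by omega, Nat.factorial_succ (g + 2), e1]
    refine le_of_eq_of_le ?_ (key ((g + 3) * ((g + 2) * (g + 1))) ((g + 2) * (g + 1)) ?_)
    · ring
    · gcongr
      nlinarith [Nat.zero_le (μ * g), sq_nonneg (μ + g)]
  · rw [show μ + g + 2 - μ = g + 2 by omega, Nat.factorial_succ μ, e1]
    refine le_of_eq_of_le ?_ (key ((μ + 1) * ((g + 2) * (g + 1))) ((g + 2) * (g + 1)) ?_)
    · ring
    · gcongr
      nlinarith [Nat.zero_le (μ * g), sq_nonneg (μ + g)]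
  · rw [show h + g + 2 - (h + 1) = g + 1 by omega, Nat.factorial_succ (h + 1),
      Nat.factorial_succ h, Nat.factorial_succ g]
    refine le_of_eq_of_le ?_ (key ((h + 2) * (h + 1) * (g + 1)) ((g + 2) * (g + 1)) ?_)
    · ring
    · have h1 : (h + 2) * (h + 1) ≤ (h + g + 2 + 1) ^ 2 := by
        rw [sq]; exact Nat.mul_le_mul (by omega) (by omega)
      calc (h + 2) * (h + 1) * (g + 1) ≤ (h + g + 2 + 1) ^ 2 * (g + 1) :=
            Nat.mul_le_mul_right _ h1
        _ ≤ (h + g + 2 + 1) ^ 2 * ((h + g + 2 + 1) * ((g + 2) * (g + 1))) := by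
            gcongr; nlinarith [Nat.zero_le ((h + g) * ((g + 2) * (g + 1))), Nat.zero_le (g * g)]
        _ = _ := by ring
  · rw [show h + g + 2 - (h + 2) = g by omega, Nat.factorial_succ (h + 2),
      Nat.factorial_succ (h + 1), Nat.factorial_succ h]
    refine le_of_eq_of_le ?_ (key ((h + 3) * (h + 2) * (h + 1)) ((g + 2) * (g + 1)) ?_)
    · ring
    · calc (h + 3) * (h + 2) * (h + 1)
          ≤ (h + g + 2 + 1) * (h + g + 2 + 1) * (h + g + 2 + 1) := by
            apply Nat.mul_le_mul (Nat.mul_le_mul _ _) <;> omega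
        _ = (h + g + 2 + 1) ^ 3 * 1 := by ring
        _ ≤ (h + g + 2 + 1) ^ 3 * ((g + 2) * (g + 1)) := by
            gcongr; nlinarith [Nat.zero_le (g * g)]

theorem abs_eval_le_of_mem_middle {m : ℕ} (hm : 4 ≤ m) {p : ℝ[X]} (hp : p.natDegree ≤ m) {G : ℝ}
    (hG : ∀ j ≤ m, |p.eval (j : ℝ)| ≤ G) {x : ℝ} (h1 : (m / 2 : ℕ) - 1 ≤ x)
    (h2 : x ≤ (m / 2 : ℕ) + 2) : |p.eval x| ≤ (m + 1) ^ 4 * G := by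
  have hG0 : 0 ≤ G := (abs_nonneg _).trans (hG 0 (by omega))
  have hx0 : 0 ≤ x := by
    have : (1 : ℝ) ≤ (m / 2 : ℕ) := by exact_mod_cast (by omega : 1 ≤ m / 2)
    linarith
  have hμ1 : m / 2 ≤ ⌊x⌋₊ + 1 := by
    have := Nat.lt_floor_add_one x
    have h3 : ((m / 2 : ℕ) : ℝ) < (⌊x⌋₊ + 1 : ℕ) + 1 := by push_cast; linarith
    have h4 : m / 2 < ⌊x⌋₊ + 1 + 1 := by exact_mod_cast h3
    omega
  have hμ2 : ⌊x⌋₊ ≤ m / 2 + 2 := by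
    have h3 := Nat.floor_le_floor h2
    have h4 : ⌊((m / 2 : ℕ) : ℝ) + 2⌋₊ = m / 2 + 2 := by exact_mod_cast Nat.floor_natCast (m / 2 + 2)
    omega
  have hinj : Set.InjOn (fun i : ℕ => (i : ℝ)) (Finset.range (m + 1)) :=
    Nat.cast_injective.injOn
  have hdeg : p.degree < (Finset.range (m + 1)).card := by
    rw [Finset.card_range]
    exact degree_le_natDegree.trans_lt (by exact_mod_cast (by omega : p.natDegree < m + 1))
  have hlag := Lagrange.eq_interpolate hinj hdeg
  rw [hlag, Lagrange.interpolate_apply, eval_finsetSum]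
  refine (Finset.abs_sum_le_sum_abs _ _).trans ?_
  have hterm : ∀ j ∈ Finset.range (m + 1), |eval x (C (eval (j : ℝ) p) *
      Lagrange.basis (Finset.range (m + 1)) (fun i : ℕ => (i : ℝ)) j)| ≤ G * (m + 1) ^ 3 := by
    intro j hj
    have hjm : j ≤ m := Nat.lt_succ_iff.1 (Finset.mem_range.1 hj)
    rw [eval_mul, eval_C, abs_mul]
    refine mul_le_mul (hG j hjm) ?_ (abs_nonneg _) hG0
    have hd := prod_range_abs_sub_erase hjm
    have hn := prod_range_abs_sub_erase_le j (show ⌊x⌋₊ ≤ m by omega) (Nat.floor_le hx0)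
      (Nat.lt_floor_add_one x).le
    rw [Lagrange.basis, eval_prod, Finset.abs_prod]
    have hb : ∀ i ∈ (Finset.range (m + 1)).erase j,
        |eval x (Lagrange.basisDivisor (j : ℝ) (i : ℝ))| = |x - i| / |(j : ℝ) - i| := by
      intro i _
      rw [Lagrange.basisDivisor, eval_mul, eval_C, eval_sub, eval_X, eval_C, abs_mul, abs_inv]
      rw [mul_comm, div_eq_mul_inv]
    rw [Finset.prod_congr rfl hb, Finset.prod_div_distrib, hd, div_le_iff₀ (by positivity)]
    refine hn.trans ?_
    exact_mod_cast factorial_mul_factorial_le hm hjm hμ1 hμ2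
  refine (Finset.sum_le_card_nsmul _ _ _ hterm).trans ?_
  rw [Finset.card_range, nsmul_eq_mul]
  push_cast
  apply le_of_eq; ring

/-! ### A bound for three-term recurrences with monotone coefficients -/

theorem le_of_midpoint_convex {u : ℕ → ℝ} {A : ℝ} {s : ℕ}
    (hu : ∀ i, 1 ≤ i → i < s → 2 * u i ≤ u (i - 1) + u (i + 1)) (h0 : u 0 ≤ A) (hs : u s ≤ A) :
    ∀ i ≤ s, u i ≤ A := by
  suffices h : ∀ i ≤ s, u i ≤ max (u 0) (u s) from
    fun i hi => (h i hi).trans (max_le h0 hs)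
  clear h0 hs
  induction s with
  | zero => intro i hi; rw [Nat.le_zero.1 hi]; exact le_max_left _ _
  | succ s ih =>
    have ih' := ih fun i h1 h2 => hu i h1 (by omega)
    have hmax : max (u 0) (u s) ≤ max (u 0) (u (s + 1)) := by
      refine max_le (le_max_left _ _) ?_
      rcases le_or_gt (u s) (u (s + 1)) with h | h
      · exact h.trans (le_max_right _ _)
      rcases Nat.eq_zero_or_pos s with rfl | h1
      · exact le_max_left _ _
      have h2 := hu s h1 (by omega)
      have h3 := ih' (s - 1) (by omega)
      rcases le_max_iff.1 h3 with h4 | h4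
      · exact le_max_of_le_left (by linarith)
      · linarith
    intro i hi
    rcases Nat.le_succ_iff.1 hi with h | rfl
    · exact (ih' i h).trans hmax
    · exact le_max_right _ _

theorem sq_le_of_abs_coeff_le {x y c ρ : ℝ} (hc : |c| ≤ 2 - ρ) :
    ρ * (x ^ 2 + y ^ 2) ≤ 2 * (x ^ 2 + y ^ 2 - c * x * y) := by
  have h1 : c * x * y ≤ |c| * (|x| * |y|) := by
    rw [← abs_mul, ← abs_mul, ← mul_assoc]; exact le_abs_self _
  have h2 : |c| * (|x| * |y|) ≤ (2 - ρ) * (|x| * |y|) := by gcongr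
  have h3 : 2 * (|x| * |y|) ≤ x ^ 2 + y ^ 2 := by
    nlinarith [sq_nonneg (|x| - |y|), sq_abs x, sq_abs y]
  have h4 : (0 : ℝ) ≤ 2 - ρ := (abs_nonneg c).trans hc
  nlinarith

theorem energy_div_le {x y z c d : ℝ} (hrec : z + x = c * y) (hcd : c ≤ d) (hd : d < 2) :
    (x ^ 2 + y ^ 2 - c * x * y) / (2 - c) ≤ (y ^ 2 + z ^ 2 - d * y * z) / (2 - d) := by
  have hx : x = c * y - z := by linarith
  have hE : x ^ 2 + y ^ 2 - c * x * y = y ^ 2 + z ^ 2 - c * y * z := by rw [hx]; ring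
  rw [hE, div_le_div_iff₀ (by linarith) (by linarith)]
  have : 0 ≤ (d - c) * (y - z) ^ 2 := mul_nonneg (by linarith) (sq_nonneg _)
  nlinarith

theorem abs_le_of_three_term {W c : ℕ → ℝ} {T : ℕ} {ρ A : ℝ} (hT : 1 ≤ T) (hρ : 0 < ρ) (hρ1 : ρ ≤ 1)
    (hrec : ∀ i, 1 ≤ i → i < T → W (i + 1) + W (i - 1) = c i * W i)
    (hmono : ∀ i, 1 ≤ i → i + 1 < T → c i ≤ c (i + 1))
    (hup : ∀ i, 1 ≤ i → i < T → c i ≤ 2 - ρ)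
    (hgap : ∀ i, 1 ≤ i → i + 1 < T → (i = 1 ∨ c (i - 1) ≤ -2) → c i + ρ ≤ c (i + 1))
    (h0 : |W 0| ≤ A) (h1 : |W (T - 1)| ≤ A) (h2 : |W T| ≤ A) :
    ∀ i ≤ T, |W i| ≤ 6 / ρ * A := by
  have hA : 0 ≤ A := (abs_nonneg _).trans h0
  have hK : A ≤ 6 / ρ * A := by
    refine le_mul_of_one_le_left hA ?_
    rw [le_div_iff₀ hρ]; linarith
  have hconv : ∀ s ≤ T, (∀ i, 1 ≤ i → i < s → c i ≤ -2) → |W s| ≤ 6 / ρ * A →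
      ∀ i ≤ s, |W i| ≤ 6 / ρ * A := by
    intro s hsT hc hs
    refine le_of_midpoint_convex (u := fun i => |W i|) (fun i hi his => ?_) (h0.trans hK) hs
    have h3 := hc i hi his
    have h4 := congrArg abs (hrec i hi (by omega))
    rw [abs_mul] at h4
    have h5 := abs_add_le (W (i + 1)) (W (i - 1))
    have h6 : 2 ≤ |c i| := by rw [abs_of_neg (by linarith)]; linarith
    have h7 := mul_le_mul_of_nonneg_right h6 (abs_nonneg (W i))
    show 2 * |W i| ≤ |W (i - 1)| + |W (i + 1)|
    linarith
  by_cases hex : ∃ s, 1 ≤ s ∧ s < T ∧ -2 < c s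
  swap
  · push Not at hex
    exact hconv T le_rfl hex (h2.trans hK)
  classical
  obtain ⟨hs1, hsT, hcs⟩ := Nat.find_spec hex
  set s := Nat.find hex with hs
  have hsmin : ∀ i, 1 ≤ i → i < s → c i ≤ -2 := by
    intro i hi his
    by_contra! h
    exact Nat.find_min hex his ⟨hi, his.trans hsT, h⟩
  have hcmono : ∀ i, s + 1 ≤ i → i < T → -2 + ρ ≤ c i := by
    intro i hi
    induction i, hi using Nat.le_induction with
    | base =>
      intro h
      have := hgap s hs1 h (by
        rcases eq_or_lt_of_le hs1 with h3 | h3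
        · exact Or.inl h3.symm
        · exact Or.inr (hsmin (s - 1) (by omega) (by omega)))
      linarith
    | succ i hi ih =>
      intro h
      exact (ih (by omega)).trans (hmono i (by omega) h)
  have habs : ∀ i, s + 1 ≤ i → i < T → |c i| ≤ 2 - ρ := fun i hi hiT =>
    abs_le.2 ⟨by linarith [hcmono i hi hiT], hup i (by omega) hiT⟩
  have hE : ∀ l i, i + l + 1 = T → s + 1 ≤ i →
      (W (i - 1) ^ 2 + W i ^ 2 - c i * W (i - 1) * W i) / (2 - c i) ≤ 4 * A ^ 2 / ρ := by
    intro l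
    induction l with
    | zero =>
      intro i hiT hsi
      have e1 : i = T - 1 := by omega
      have hiT' : i < T := by omega
      have hc2 := hup i (by omega) hiT'
      have hE2 : W (i - 1) ^ 2 + W i ^ 2 - c i * W (i - 1) * W i ≤ 4 * A ^ 2 := by
        have hr := hrec i (by omega) hiT'
        have hx : W (i - 1) = c i * W i - W (i + 1) := by linarith
        have e2 : i + 1 = T := by omega
        rw [hx, e2]
        have b1 : |W i| ≤ A := by rw [e1]; exact h1
        have b3 := sq_le_sq' (abs_le.1 b1).1 (abs_le.1 b1).2
        have b4 := sq_le_sq' (abs_le.1 h2).1 (abs_le.1 h2).2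
        have b5 : |c i * W i * W T| ≤ 2 * (A * A) := by
          rw [abs_mul, abs_mul, mul_assoc]
          exact mul_le_mul ((habs i hsi hiT').trans (by linarith))
            (mul_le_mul b1 h2 (abs_nonneg _) hA) (by positivity) (by norm_num)
        have b6 := (abs_le.1 b5).1
        nlinarith
      have : ρ ≤ 2 - c i := by linarith
      gcongr
    | succ l ih =>
      intro i hiT hsi
      refine le_trans ?_ (ih (i + 1) (by omega) (by omega))
      rw [Nat.add_sub_cancel]
      refine energy_div_le (hrec i (by omega) (by omega)) (hmono i (by omega) (by omega)) ?_
      linarith [hup (i + 1) (by omega) (by omega)]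
  have hpair : ∀ i, s + 1 ≤ i → i < T →
      W (i - 1) ^ 2 + W i ^ 2 ≤ (6 / ρ * A) ^ 2 := by
    intro i hsi hiT
    have e := hE (T - 1 - i) i (by omega) hsi
    have hc2 := hup i (by omega) hiT
    have hc3 := hcmono i hsi hiT
    rw [div_le_iff₀ (by linarith)] at e
    have e2 := sq_le_of_abs_coeff_le (x := W (i - 1)) (y := W i) (habs i hsi hiT)
    have e3 : 4 * A ^ 2 / ρ * (2 - c i) ≤ 4 * A ^ 2 / ρ * 4 := by
      have : 0 ≤ 4 * A ^ 2 / ρ := by positivity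
      exact mul_le_mul_of_nonneg_left (by linarith) this
    have e4 : ρ * (W (i - 1) ^ 2 + W i ^ 2) ≤ 32 * A ^ 2 / ρ := by
      calc _ ≤ _ := e2
        _ ≤ 2 * (4 * A ^ 2 / ρ * 4) := by linarith
        _ = _ := by ring
    have e5 : ρ * (6 / ρ * A) ^ 2 = 36 * A ^ 2 / ρ := by field_simp; ring
    have e6 : 32 * A ^ 2 / ρ ≤ 36 * A ^ 2 / ρ := by
      gcongr; norm_num
    exact le_of_mul_le_mul_left (by rw [e5]; exact e4.trans e6) hρ
  have hK0 : 0 ≤ 6 / ρ * A := by positivity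
  have hge : ∀ i, s ≤ i → i ≤ T → |W i| ≤ 6 / ρ * A := by
    intro i hsi hiT
    rcases eq_or_lt_of_le hiT with rfl | hiT
    · exact h2.trans hK
    rcases eq_or_lt_of_le (Nat.succ_le_of_lt hiT) with h | h
    · rw [show i = T - 1 by omega]; exact h1.trans hK
    · have := hpair (i + 1) (by omega) h
      rw [Nat.add_sub_cancel] at this
      exact abs_le_of_sq_le_sq (by nlinarith [sq_nonneg (W (i + 1))]) hK0
  intro i hiT
  rcases le_or_gt s i with h | h
  · exact hge i h hiT
  · exact hconv s hsT.le hsmin (hge s le_rfl hsT.le) i h.le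

/-! ### Uniform bounds for Gram polynomials -/

theorem abs_gramPoly_eval_natCast_le {m k j : ℕ} (hk : k ≤ m) (hj : j ≤ m) :
    |(gramPoly m k).eval (j : ℝ)| ≤ (m + 1) * (m + 1 + k).choose k := by
  have hh := sum_gramPoly_sq_pos hk
  have h1 := choose_sq_eq_gramRatio_mul hk
  have h2 := one_le_mul_gramRatio hk
  have h3 : (gramPoly m k).eval (j : ℝ) ^ 2 ≤
      ∑ x ∈ Finset.range (m + 1), (gramPoly m k).eval (x : ℝ) ^ 2 :=
    Finset.single_le_sum (f := fun x : ℕ => (gramPoly m k).eval (x : ℝ) ^ 2)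
      (fun i _ => sq_nonneg _) (Finset.mem_range.2 (by omega))
  refine abs_le_of_sq_le_sq ?_ (by positivity)
  set h := ∑ x ∈ Finset.range (m + 1), (gramPoly m k).eval (x : ℝ) ^ 2
  have h4 : h ≤ (m + 1) * (gramRatio (m + 1) k * h) := by
    rw [← mul_assoc]; exact le_mul_of_one_le_left hh.le h2
  rw [← h1] at h4
  have h5 : (1 : ℝ) ≤ m + 1 := by linarith [(Nat.cast_nonneg m : (0 : ℝ) ≤ m)]
  have h6 : (0 : ℝ) ≤ (m + 1) * ((m + 1 + k).choose k : ℝ) ^ 2 := by positivity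
  calc _ ≤ _ := h3.trans h4
    _ ≤ (m + 1) * ((m + 1) * ((m + 1 + k).choose k : ℝ) ^ 2) := le_mul_of_one_le_left h6 h5
    _ = _ := by ring

theorem mul_sub_le_sq_div_four (a x : ℝ) : x * (a - x) ≤ a ^ 2 / 4 := by
  nlinarith [sq_nonneg (a - 2 * x)]

theorem one_div_pow_le_div_sub_div {p q l N : ℝ} (hl : 2 ≤ l) (hp : 0 < p) (hpN : p ≤ N ^ 2 / 4)
    (hq : 0 < q) (hqN : q ≤ N ^ 2 / 4) (hpq : 1 ≤ q - p) : 1 / N ^ 4 ≤ l / p - l / q := by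
  have hN : 0 < N ^ 2 := by linarith
  have h : p * q ≤ N ^ 2 / 4 * (N ^ 2 / 4) := mul_le_mul hpN hqN hq.le (by positivity)
  have h2 : 2 * 1 ≤ l * (q - p) := mul_le_mul hl hpq zero_le_one (by linarith)
  rw [div_sub_div _ _ hp.ne' hq.ne', show N ^ 4 = N ^ 2 * N ^ 2 by ring,
    div_le_div_iff₀ (by positivity) (mul_pos hp hq)]
  have h3 := mul_le_mul_of_nonneg_right h2 (mul_pos hN hN).le
  have h4 := mul_pos hN hN
  linarith

theorem three_le_sub_of_mul_le {l N x : ℝ} (hN : 17 ≤ N) (hl : l ≤ N ^ 2 - N)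
    (h : 4 * (x * (N - x)) ≤ l) (hx : 3 < N - 2 * x) : 4 ≤ N - 2 * x := by
  nlinarith [sq_nonneg (N - 2 * x - 4)]

theorem abs_gramPoly_eval_add_natCast_le {m k i : ℕ} (hm : 16 ≤ m) (hk1 : 1 ≤ k) (hk : k ≤ m)
    (hi : i ≤ m / 2) {y : ℝ} (hy0 : 0 < y) (hy1 : y < 1) :
    |(gramPoly m k).eval (y + i)| ≤ 12 * (m + 1) ^ 11 * (m + 1 + k).choose k := by
  obtain ⟨B, hB⟩ : ∃ B : ℝ, B = (m + 1 + k).choose k := ⟨_, rfl⟩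
  obtain ⟨N, hN⟩ : ∃ N : ℝ, N = m + 1 := ⟨_, rfl⟩
  obtain ⟨l, hl⟩ : ∃ l : ℝ, l = k * (k + 1) := ⟨_, rfl⟩
  have hB0 : 0 ≤ B := by rw [hB]; positivity
  have hm' : (16 : ℝ) ≤ m := by exact_mod_cast hm
  have hN17 : 17 ≤ N := by linarith
  have hk1' : (1 : ℝ) ≤ k := by exact_mod_cast hk1
  have hk' : (k : ℝ) ≤ m := by exact_mod_cast hk
  have hl2 : 2 ≤ l := by rw [hl]; nlinarith
  have hlN : l ≤ N ^ 2 - N := by rw [hl, hN]; nlinarith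
  have hhalf : 2 * ((m / 2 : ℕ) : ℝ) ≤ m := by exact_mod_cast Nat.mul_div_le m 2
  set τ := gramPoly m k with hτ
  set b : ℝ → ℝ := fun x => x * (N - x) with hb
  set W : ℕ → ℝ := fun i => b (y + i) * (τ.eval (y + i) - τ.eval (y + i - 1)) with hW
  set c : ℕ → ℝ := fun i => 2 - l / b (y + i) with hc
  have hstep : ∀ i : ℕ, W (i + 1) - W i = -l * τ.eval (y + i) := by
    intro i
    have := gramPoly_difference_eq hk (y + i)
    rw [← hl] at this
    simp only [hW, hb, hN]
    push_cast
    rw [← this, show y + ((i : ℝ) + 1) - 1 = y + i by ring, show y + ((i : ℝ) + 1) = y + i + 1 by ring]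
    ring
  have hidx : ∀ i : ℕ, i ≤ m / 2 → 0 < y + i ∧ 2 * (y + i) < N + 1 := by
    intro i hi
    have : (i : ℝ) ≤ (m / 2 : ℕ) := by exact_mod_cast hi
    constructor
    · positivity
    · linarith
  have hbpos : ∀ i : ℕ, i ≤ m / 2 → 0 < b (y + i) := by
    intro i hi
    obtain ⟨h1, h2⟩ := hidx i hi
    exact mul_pos h1 (by linarith)
  have hble : ∀ x, b x ≤ N ^ 2 / 4 := fun x => mul_sub_le_sq_div_four N x
  have hρ : (0 : ℝ) < 1 / N ^ 4 := by positivity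
  have hρ1 : 1 / N ^ 4 ≤ 1 := by
    rw [div_le_one (by positivity)]; exact one_le_pow₀ (by linarith)
  have hcenter : ∀ x : ℝ, (m / 2 : ℕ) - 1 ≤ x → x ≤ (m / 2 : ℕ) + 2 → |τ.eval x| ≤ N ^ 5 * B := by
    intro x h1 h2
    have := abs_eval_le_of_mem_middle (by omega) ((natDegree_gramPoly_le m k).trans hk)
      (fun j hj => abs_gramPoly_eval_natCast_le hk hj) h1 h2
    rw [← hB, ← hN] at this
    linarith [show N ^ 4 * (N * B) = N ^ 5 * B by ring]
  have hWle : ∀ i : ℕ, ∀ G : ℝ, 0 ≤ b (y + i) → |τ.eval (y + i)| ≤ G → |τ.eval (y + i - 1)| ≤ G →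
      |W i| ≤ N ^ 2 * G := by
    intro i G hb0 h1 h2
    have hG : 0 ≤ G := (abs_nonneg _).trans h1
    have h3 : |τ.eval (y + i) - τ.eval (y + i - 1)| ≤ 2 * G := by
      refine (abs_sub _ _).trans ?_; linarith
    simp only [hW]
    rw [abs_mul, abs_of_nonneg hb0]
    calc _ ≤ N ^ 2 / 4 * (2 * G) := mul_le_mul (hble _) h3 (abs_nonneg _) (by positivity)
      _ ≤ N ^ 2 * G := by nlinarith [mul_nonneg (sq_nonneg N) hG]
  have hB1 : B ≤ N ^ 5 * B := le_mul_of_one_le_left hB0 (one_le_pow₀ (by linarith))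
  have hbound := abs_le_of_three_term (W := W) (c := c) (T := m / 2 + 1) (ρ := 1 / N ^ 4)
    (A := N ^ 7 * B) (by omega) hρ hρ1 ?_ ?_ ?_ ?_ ?_ ?_ ?_
  · have e1 := hbound i (by omega)
    have e2 := hbound (i + 1) (by omega)
    have e3 := congrArg abs (hstep i)
    rw [abs_mul, abs_neg, abs_of_pos (show (0 : ℝ) < l by linarith)] at e3
    have e4 := abs_sub (W (i + 1)) (W i)
    have e5 : |τ.eval (y + i)| ≤ l * |τ.eval (y + i)| :=
      le_mul_of_one_le_left (abs_nonneg _) (by linarith)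
    have e6 : 6 / (1 / N ^ 4) * (N ^ 7 * B) = 6 * N ^ 11 * B := by field_simp
    rw [e6] at e1 e2
    rw [← hB, ← hN]
    linarith
  · intro i hi1 hiT
    have h1 := hstep i
    have h2 := hstep (i - 1)
    have h3 := hbpos i (by omega)
    rw [Nat.sub_add_cancel hi1, Nat.cast_sub hi1, Nat.cast_one] at h2
    have h4 : W i = b (y + i) * (τ.eval (y + i) - τ.eval (y + i - 1)) := rfl
    have h5 : l / b (y + i) * W i = l * (τ.eval (y + i) - τ.eval (y + i - 1)) := by
      rw [h4]; field_simp
    rw [show y + ((i : ℝ) - 1) = y + i - 1 by ring] at h2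
    simp only [hc]
    linear_combination h1 - h2 + h5
  · intro i hi1 hiT
    have h3 := hbpos i (by omega)
    have h4 : b (y + i) ≤ b (y + (i + 1 : ℕ)) := by
      have := (hidx (i + 1) (by omega)).2
      simp only [hb]; push_cast at this ⊢; nlinarith
    simp only [hc]
    gcongr
  · intro i hi1 hiT
    have h3 := hbpos i (by omega)
    simp only [hc]
    have h4 : 1 / N ^ 4 ≤ l / b (y + i) := by
      rw [div_le_div_iff₀ (by positivity) h3]
      have h5 := hble (y + i)
      have h6 : N ^ 2 ≤ N ^ 4 := pow_le_pow_right₀ (by linarith) (by norm_num)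
      have h7 : 2 * N ^ 4 ≤ l * N ^ 4 := mul_le_mul_of_nonneg_right hl2 (by positivity)
      nlinarith
    linarith
  · intro i hi1 hiT hor
    have h3 := hbpos i (by omega)
    have h4 := hbpos (i + 1) (by omega)
    have hx := (hidx (i + 1) (by omega)).2
    push_cast at h4 hx
    have hgap : 1 ≤ N - 1 - 2 * (y + i) := by
      have h1 : i = 1 ∨ (2 ≤ i ∧ c (i - 1) ≤ -2) := by
        rcases eq_or_lt_of_le hi1 with h | h
        · exact Or.inl h.symm
        · rcases hor with h' | h'
          · exact Or.inl h'
          · exact Or.inr ⟨h, h'⟩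
      rcases h1 with rfl | ⟨h2, h5⟩
      · push_cast; linarith
      · have h6 := hbpos (i - 1) (by omega)
        simp only [hc] at h5
        rw [Nat.cast_sub hi1, Nat.cast_one] at h5 h6
        have h7 : 4 ≤ l / b (y + (i - 1)) := by linarith
        rw [le_div_iff₀ h6] at h7
        simp only [hb] at h7
        linarith [three_le_sub_of_mul_le (x := y + (i - 1)) hN17 hlN h7 (by linarith)]
    simp only [hc]
    push_cast
    have h5 : b (y + (i + 1)) - b (y + i) = N - 1 - 2 * (y + i) := by simp only [hb]; ring
    have h6 : 1 / N ^ 4 ≤ l / b (y + i) - l / b (y + (i + 1)) :=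
      one_div_pow_le_div_sub_div hl2 h3 (hble _) h4 (hble _) (by rw [h5]; exact hgap)
    linarith
  · have h1 := abs_gramPoly_eval_le hk (x := y) (abs_le.2 ⟨by linarith, by linarith⟩)
    have h2 := abs_gramPoly_eval_le hk (x := y - 1) (abs_le.2 ⟨by linarith, by linarith⟩)
    rw [← hB] at h1 h2
    have := hWle 0 B (hbpos 0 (by omega)).le (by simpa using h1) (by simpa using h2)
    calc _ ≤ _ := this
      _ ≤ N ^ 2 * (N ^ 5 * B) := by gcongr
      _ = _ := by ring
  · rw [Nat.add_sub_cancel]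
    have := hWle (m / 2) (N ^ 5 * B) (hbpos _ le_rfl).le
      (hcenter _ (by linarith) (by linarith)) (hcenter _ (by linarith) (by linarith))
    calc _ ≤ _ := this
      _ = _ := by ring
  · have := hWle (m / 2 + 1) (N ^ 5 * B)
      (by simp only [hb]; push_cast; apply mul_nonneg <;> linarith)
      (hcenter _ (by push_cast; linarith) (by push_cast; linarith))
      (hcenter _ (by push_cast; linarith) (by push_cast; linarith))
    calc _ ≤ _ := this
      _ = _ := by ring

/-! ### Comparison of the grid norm with the uniform norm -/

theorem sq_coeff_mul_le {m d k : ℕ} (hd : d ≤ m) (hk : k ≤ d) {p : ℝ[X]} {a : ℕ → ℝ}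
    (ha : p = ∑ k ∈ Finset.range (d + 1), C (a k) * gramPoly m k) {G : ℝ}
    (hG : ∀ j ≤ m, |p.eval (j : ℝ)| ≤ G) :
    a k ^ 2 * ∑ x ∈ Finset.range (m + 1), (gramPoly m k).eval (x : ℝ) ^ 2 ≤ (m + 1) * G ^ 2 := by
  have hh := sum_gramPoly_sq_pos (hk.trans hd)
  set h := ∑ x ∈ Finset.range (m + 1), (gramPoly m k).eval (x : ℝ) ^ 2 with hdef
  have h1 : ∑ x ∈ Finset.range (m + 1), p.eval (x : ℝ) * (gramPoly m k).eval (x : ℝ) = a k * h := by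
    have h2 : ∀ x : ℕ, p.eval (x : ℝ) * (gramPoly m k).eval (x : ℝ) =
        ∑ l ∈ Finset.range (d + 1),
          a l * ((gramPoly m l).eval (x : ℝ) * (gramPoly m k).eval (x : ℝ)) := by
      intro x
      conv_lhs => rw [ha]
      rw [eval_finsetSum, Finset.sum_mul]
      refine Finset.sum_congr rfl fun l _ => ?_
      rw [eval_mul, eval_C]; ring
    rw [Finset.sum_congr rfl fun x _ => h2 x, Finset.sum_comm,
      Finset.sum_eq_single_of_mem k (Finset.mem_range.2 (by omega)), ← Finset.mul_sum, hdef]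
    · simp only [sq]
    · intro l hl hlk
      rw [Finset.mem_range] at hl
      rw [← Finset.mul_sum, sum_gramPoly_mul_gramPoly (by omega) (by omega) hlk, mul_zero]
  have h3 := Finset.sum_mul_sq_le_sq_mul_sq (Finset.range (m + 1))
    (fun x : ℕ => p.eval (x : ℝ)) (fun x : ℕ => (gramPoly m k).eval (x : ℝ))
  rw [h1, ← hdef] at h3
  have h4 : ∑ x ∈ Finset.range (m + 1), p.eval (x : ℝ) ^ 2 ≤ (m + 1) * G ^ 2 := by
    refine (Finset.sum_le_card_nsmul _ _ (G ^ 2) fun j hj => ?_).trans (by simp)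
    have := hG j (Nat.lt_succ_iff.1 (Finset.mem_range.1 hj))
    exact sq_le_sq' (abs_le.1 this).1 (abs_le.1 this).2
  have h5 := mul_le_mul_of_nonneg_right h4 hh.le
  exact le_of_mul_le_mul_right (by nlinarith) hh

theorem abs_eval_add_natCast_le {m d i : ℕ} (hm : 16 ≤ m) (hd : d ≤ m) {p : ℝ[X]}
    (hp : p.natDegree ≤ d) {G : ℝ} (hG : ∀ j ≤ m, |p.eval (j : ℝ)| ≤ G) (hi : i ≤ m / 2) {y : ℝ}
    (hy0 : 0 < y) (hy1 : y < 1) :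
    |p.eval (y + i)| ≤ 12 * (m + 1) ^ 13 * √(gramRatio (m + 1) d) * G := by
  have hG0 : 0 ≤ G := (abs_nonneg _).trans (hG 0 (by omega))
  have hN : (1 : ℝ) ≤ m + 1 := by linarith [(Nat.cast_nonneg m : (0 : ℝ) ≤ m)]
  obtain ⟨a, ha⟩ := exists_eq_sum_gramPoly m d p hp
  have hterm : ∀ k ∈ Finset.range (d + 1), |(C (a k) * gramPoly m k).eval (y + i)| ≤
      12 * (m + 1) ^ 12 * √(gramRatio (m + 1) d) * G := by
    intro k hk
    have hkd : k ≤ d := Nat.lt_succ_iff.1 (Finset.mem_range.1 hk)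
    have h1 := sq_coeff_mul_le hd hkd ha hG
    have h2 := choose_sq_eq_gramRatio_mul (hkd.trans hd)
    have h3 := gramRatio_mono hkd hd
    have h4 : |(gramPoly m k).eval (y + i)| ≤ 12 * (m + 1) ^ 11 * (m + 1 + k).choose k := by
      rcases Nat.eq_zero_or_pos k with rfl | hk0
      · have : (1 : ℝ) ≤ (m + 1) ^ 11 := one_le_pow₀ hN
        simp [gramPoly_zero]; linarith
      · exact abs_gramPoly_eval_add_natCast_le hm hk0 (hkd.trans hd) hi hy0 hy1
    have hh := sum_gramPoly_sq_pos (hkd.trans hd)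
    set h := ∑ x ∈ Finset.range (m + 1), (gramPoly m k).eval (x : ℝ) ^ 2
    have hR := gramRatio_nonneg (m + 1) k
    refine abs_le_of_sq_le_sq ?_ (by positivity)
    rw [eval_mul, eval_C, mul_pow]
    have h5 : (gramPoly m k).eval (y + i) ^ 2 ≤ (12 * (m + 1) ^ 11 * (m + 1 + k).choose k) ^ 2 :=
      sq_le_sq' (abs_le.1 h4).1 (abs_le.1 h4).2
    calc a k ^ 2 * (gramPoly m k).eval (y + i) ^ 2
        ≤ a k ^ 2 * (12 * (m + 1) ^ 11 * (m + 1 + k).choose k) ^ 2 := by gcongr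
      _ = 144 * (m + 1) ^ 22 * gramRatio (m + 1) k * (a k ^ 2 * h) := by rw [mul_pow, h2]; ring
      _ ≤ 144 * (m + 1) ^ 22 * gramRatio (m + 1) k * ((m + 1) * G ^ 2) := by gcongr
      _ ≤ 144 * (m + 1) ^ 22 * gramRatio (m + 1) d * ((m + 1) * G ^ 2) := by gcongr
      _ = (144 * (m + 1) ^ 23 * gramRatio (m + 1) d * G ^ 2) * 1 := by ring
      _ ≤ (144 * (m + 1) ^ 23 * gramRatio (m + 1) d * G ^ 2) * (m + 1) := by
          have := gramRatio_nonneg (m + 1) d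
          gcongr
      _ = _ := by
          rw [mul_pow, mul_pow, Real.sq_sqrt (gramRatio_nonneg _ _)]; ring
  rw [ha, eval_finsetSum]
  refine (Finset.abs_sum_le_sum_abs _ _).trans ((Finset.sum_le_card_nsmul _ _ _ hterm).trans ?_)
  rw [Finset.card_range, nsmul_eq_mul]
  have : ((d + 1 : ℕ) : ℝ) ≤ m + 1 := by exact_mod_cast (by omega : d + 1 ≤ m + 1)
  calc _ ≤ ((m : ℝ) + 1) * (12 * (m + 1) ^ 12 * √(gramRatio (m + 1) d) * G) := by gcongr
    _ = _ := by ring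

theorem abs_eval_le_of_grid {m d : ℕ} (hm : 16 ≤ m) (hd : d ≤ m) {p : ℝ[X]}
    (hp : p.natDegree ≤ d) {G : ℝ} (hG : ∀ j ≤ m, |p.eval (j : ℝ)| ≤ G) {x : ℝ}
    (hx : x ∈ Icc (0 : ℝ) m) :
    |p.eval x| ≤ 12 * (m + 1) ^ 13 * √(gramRatio (m + 1) d) * G := by
  have hG0 : 0 ≤ G := (abs_nonneg _).trans (hG 0 (by omega))
  have hfloor : ⌊x⌋₊ ≤ m := by
    have := Nat.floor_le_floor hx.2
    rwa [Nat.floor_natCast] at this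
  have hxf := Nat.floor_le hx.1
  have hxl := Nat.lt_floor_add_one x
  rcases eq_or_lt_of_le hxf with h | h
  · rw [← h]
    refine (hG _ hfloor).trans (le_mul_of_one_le_left hG0 ?_)
    have hN : (1 : ℝ) ≤ m + 1 := by linarith [(Nat.cast_nonneg m : (0 : ℝ) ≤ m)]
    have h1 := one_le_mul_gramRatio hd
    have h2 : 1 ≤ √((m + 1) ^ 2 * gramRatio (m + 1) d) := by
      rw [Real.one_le_sqrt]; nlinarith [gramRatio_nonneg (m + 1) d]
    rw [Real.sqrt_mul (by positivity), Real.sqrt_sq (by positivity)] at h2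
    refine h2.trans (mul_le_mul_of_nonneg_right ?_ (Real.sqrt_nonneg _))
    have : (m + 1 : ℝ) ≤ (m + 1) ^ 13 := le_self_pow₀ hN (by norm_num)
    linarith
  rcases le_or_gt ⌊x⌋₊ (m / 2) with h2 | h2
  · have := abs_eval_add_natCast_le hm hd hp hG h2 (y := x - ⌊x⌋₊) (by linarith) (by linarith)
    rwa [sub_add_cancel] at this
  · have hlt : ⌊x⌋₊ < m := by
      rcases eq_or_lt_of_le hfloor with h3 | h3
      · rw [h3] at h; exact absurd h (not_lt.2 hx.2)
      · exact h3
    have hq : (C (m : ℝ) - X : ℝ[X]).natDegree ≤ 1 := by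
      refine (natDegree_sub_le _ _).trans ?_; simp
    have hqd : (p.comp (C (m : ℝ) - X)).natDegree ≤ d :=
      natDegree_comp_le.trans ((Nat.mul_le_mul hp hq).trans (by omega))
    have := abs_eval_add_natCast_le hm hd hqd (G := G) (i := m - ⌊x⌋₊ - 1) (fun j hj => by
      have := hG (m - j) (by omega)
      rw [Nat.cast_sub hj] at this
      simpa using this) (by omega) (y := ⌊x⌋₊ + 1 - x) (by linarith) (by linarith)
    rw [Nat.sub_sub, Nat.cast_sub (by omega), eval_comp] at this
    simpa using this

/-! ### Extremal polynomials and extrapolation -/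

theorem mul_abs_eval_le_of_minimal {s : Set ℝ} {b c E G : ℝ} (hc : 0 < c)
    (hs : ∀ x ∈ s, c ≤ x - b) {d : ℕ} (hd : 1 ≤ d) {p q : ℝ[X]} (hp : p.Monic)
    (hpd : p.natDegree = d) (hqd : q.natDegree ≤ d)
    (hpE : ∀ x ∈ s, |p.eval x| ≤ E) (hqG : ∀ x ∈ s, |q.eval x| ≤ G)
    (hmin : ∀ r : ℝ[X], r.Monic → r.natDegree = d → ∃ x ∈ s, E ≤ |r.eval x|) :
    E * |q.eval b| ≤ G * |p.eval b| := by
  by_contra! hlt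
  have hG : 0 ≤ G := by
    obtain ⟨x, hx, -⟩ := hmin p hp hpd
    exact (abs_nonneg _).trans (hqG x hx)
  have hqb : q.eval b ≠ 0 := by
    intro h
    rw [h, abs_zero, mul_zero] at hlt
    exact absurd hlt (not_lt.2 (mul_nonneg hG (abs_nonneg _)))
  set θ := p.eval b / q.eval b with hθ
  have hθG : |θ| * G < E := by
    rw [hθ, abs_div, div_mul_eq_mul_div, div_lt_iff₀ (abs_pos.2 hqb), mul_comm]
    exact hlt
  set w := p - C θ * q with hw
  have hroot : w.IsRoot b := by
    simp only [hw, IsRoot.def, eval_sub, eval_mul, eval_C, hθ]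
    field_simp
    ring
  set r := w /ₘ (X - C b) with hr
  have hwr : (X - C b) * r = w := mul_divByMonic_eq_iff_isRoot.2 hroot
  have hwd : w.natDegree ≤ d :=
    (natDegree_sub_le _ _).trans (max_le hpd.le ((natDegree_C_mul_le _ _).trans hqd))
  have hrd : r.natDegree < d := by
    rw [hr, natDegree_divByMonic _ (monic_X_sub_C b), natDegree_X_sub_C]
    omega
  have hcr : (C c * r).natDegree < p.natDegree := by
    rw [hpd]; exact (natDegree_C_mul_le _ _).trans_lt hrd
  obtain ⟨x, hx, hxE⟩ := hmin (p - C c * r) (hp.sub_of_left (degree_lt_degree hcr))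
    (by rw [natDegree_sub_eq_left_of_natDegree_lt hcr, hpd])
  have hxb := hs x hx
  have hxb0 : 0 < x - b := hc.trans_le hxb
  set t := c / (x - b) with ht
  have ht0 : 0 < t := by positivity
  have ht1 : t ≤ 1 := (div_le_one hxb0).2 hxb
  have heval : (p - C c * r).eval x = (1 - t) * p.eval x + t * (θ * q.eval x) := by
    have h := congrArg (eval x) hwr
    simp only [eval_mul, eval_sub, eval_X, eval_C, hw] at h ⊢
    have h2 : r.eval x = (p.eval x - θ * q.eval x) / (x - b) := by
      rw [← h]; field_simp
    rw [h2, ht]; ring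
  rw [heval] at hxE
  have h1 : |(1 - t) * p.eval x + t * (θ * q.eval x)| ≤
      (1 - t) * |p.eval x| + t * (|θ| * |q.eval x|) := by
    refine (abs_add_le _ _).trans_eq ?_
    rw [abs_mul, abs_mul, abs_mul, abs_of_pos ht0, abs_of_nonneg (sub_nonneg.2 ht1)]
  have h2 : |θ| * |q.eval x| < E :=
    (mul_le_mul_of_nonneg_left (hqG x hx) (abs_nonneg θ)).trans_lt hθG
  have h3 : (1 - t) * |p.eval x| ≤ (1 - t) * E :=
    mul_le_mul_of_nonneg_left (hpE x hx) (sub_nonneg.2 ht1)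
  have h4 : t * (|θ| * |q.eval x|) < t * E := mul_lt_mul_of_pos_left h2 ht0
  linarith

theorem one_add_sq_div_two_le_cosh (x : ℝ) : 1 + x ^ 2 / 2 ≤ Real.cosh x := by
  have h := sum_le_hasSum (Finset.range 2) (fun i _ => by rw [pow_mul]; positivity)
    (Real.hasSum_cosh x)
  simpa [Finset.sum_range_succ] using h

theorem arcosh_one_add_le {y : ℝ} (hy : 0 ≤ y) : Real.arcosh (1 + y) ≤ √(2 * y) := by
  have h := Real.cosh_arcosh (x := 1 + y) (by linarith)
  refine Real.le_sqrt_of_sq_le ?_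
  have h2 := one_add_sq_div_two_le_cosh (Real.arcosh (1 + y))
  linarith

theorem eval_one_add_le {d : ℕ} {p : ℝ[X]} (hp : p.natDegree ≤ d) {M : ℝ} (hM : 0 < M)
    (h : ∀ x ∈ Icc (-1 : ℝ) 1, |p.eval x| ≤ M) {y : ℝ} (hy : 0 ≤ y) :
    p.eval (1 + y) ≤ Real.exp (d * √(2 * y)) * M := by
  have h1 := Chebyshev.eval_iterate_derivative_le_of_forall_abs_le_one (n := d)
    (P := C M⁻¹ * p) (k := 0) (x := 1 + y) (by linarith)
    (natDegree_le_iff_degree_le.1 ((natDegree_C_mul_le _ _).trans hp)) (fun x hx => by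
      rw [eval_mul, eval_C, abs_mul, abs_of_pos (inv_pos.2 hM), inv_mul_le_one₀ hM]
      exact h x hx)
  simp only [Function.iterate_zero, id_eq, eval_mul, eval_C] at h1
  rw [inv_mul_le_iff₀ hM, ← Real.cosh_arcosh (x := 1 + y) (by linarith),
    Chebyshev.T_real_cosh, Real.cosh_arcosh (x := 1 + y) (by linarith)] at h1
  rw [mul_comm]
  refine h1.trans (mul_le_mul_of_nonneg_left ?_ hM.le)
  have h0 := Real.arcosh_nonneg (x := 1 + y) (by linarith)
  have h2 := arcosh_one_add_le hy
  have h3 : (((d : ℤ) : ℝ)) * Real.arcosh (1 + y) ≤ d * √(2 * y) := by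
    push_cast; gcongr
  have h4 : 0 ≤ (((d : ℤ) : ℝ)) * Real.arcosh (1 + y) := by positivity
  rw [Real.cosh_eq]
  have h5 := Real.exp_le_exp.2 h3
  have h6 := Real.exp_le_exp.2 ((neg_nonpos.2 h4).trans h4)
  linarith

theorem abs_eval_neg_one_sub_le {d : ℕ} {p : ℝ[X]} (hp : p.natDegree ≤ d) {M : ℝ} (hM : 0 < M)
    (h : ∀ x ∈ Icc (-1 : ℝ) 1, |p.eval x| ≤ M) {y : ℝ} (hy : 0 ≤ y) :
    |p.eval (-1 - y)| ≤ Real.exp (d * √(2 * y)) * M := by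
  have hX : (-X : ℝ[X]).natDegree = 1 := by rw [natDegree_neg, natDegree_X]
  have hq : (p.comp (-X)).natDegree ≤ d := by
    rw [natDegree_comp, hX, mul_one]; exact hp
  have hb : ∀ x ∈ Icc (-1 : ℝ) 1, |(p.comp (-X)).eval x| ≤ M := fun x hx => by
    simp only [eval_comp, eval_neg, eval_X]
    exact h _ ⟨by linarith [hx.2], by linarith [hx.1]⟩
  have h1 := eval_one_add_le hq hM hb hy
  have h2 := eval_one_add_le (d := d) (p := -p.comp (-X)) (by rwa [natDegree_neg]) hM
    (fun x hx => by rw [eval_neg, abs_neg]; exact hb x hx) hy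
  simp only [eval_comp, eval_neg, eval_X, neg_add'] at h1 h2
  exact abs_le.2 ⟨by linarith, h1⟩

/-! ### The norms `normI` and `normE` -/

theorem finite_nGrid (n : ℕ) : (nGrid n).Finite := by
  refine ((Finset.range (n + 1)).finite_toSet.image
    fun k : ℕ => (2 * (k : ℝ) - n - 1) / ((n : ℝ) - 1)).subset ?_
  rintro x ⟨k, -, hk, rfl⟩
  exact ⟨k, by simpa using Nat.lt_succ_of_le hk, rfl⟩

theorem mem_nGrid_succ {m : ℕ} (hm : m ≠ 0) {x : ℝ} :
    x ∈ nGrid (m + 1) ↔ ∃ j ≤ m, x = 2 / m * (j : ℝ) - 1 := by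
  have hm' : (m : ℝ) ≠ 0 := by exact_mod_cast hm
  constructor
  · rintro ⟨k, hk, hkm, rfl⟩
    obtain ⟨j, rfl⟩ := Nat.exists_eq_add_of_le' hk
    refine ⟨j, by omega, ?_⟩
    push_cast
    rw [add_sub_cancel_right]
    field_simp
    ring
  · rintro ⟨j, hj, rfl⟩
    refine ⟨j + 1, by omega, by omega, ?_⟩
    push_cast
    rw [add_sub_cancel_right]
    field_simp
    ring

theorem abs_eval_le_normE {n : ℕ} {x : ℝ} (hx : x ∈ nGrid n) (p : ℝ[X]) :
    |p.eval x| ≤ normE n p :=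
  le_csSup ((finite_nGrid n).image _).bddAbove (mem_image_of_mem _ hx)

theorem exists_normE_eq {n : ℕ} (hn : 1 ≤ n) (p : ℝ[X]) :
    ∃ x ∈ nGrid n, normE n p = |p.eval x| := by
  have hne : (nGrid n).Nonempty := ⟨_, 1, le_rfl, hn, rfl⟩
  obtain ⟨x, hx, h⟩ := (hne.image fun x => |p.eval x|).csSup_mem ((finite_nGrid n).image _)
  exact ⟨x, hx, h.symm⟩

theorem abs_eval_le_normI {x : ℝ} (hx : x ∈ Icc (-1 : ℝ) 1) (p : ℝ[X]) :
    |p.eval x| ≤ normI p :=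
  le_csSup (isCompact_Icc.bddAbove_image (by fun_prop)) (mem_image_of_mem _ hx)

theorem normI_le {p : ℝ[X]} {M : ℝ} (h : ∀ x ∈ Icc (-1 : ℝ) 1, |p.eval x| ≤ M) :
    normI p ≤ M := by
  refine csSup_le ((nonempty_Icc.2 (by norm_num)).image _) ?_
  rintro _ ⟨x, hx, rfl⟩
  exact h x hx

theorem normE_pos {m : ℕ} (hm : m ≠ 0) {p : ℝ[X]} (hp : p ≠ 0) (hd : p.natDegree ≤ m) :
    0 < normE (m + 1) p := by
  have hm' : (0 : ℝ) < m := by exact_mod_cast Nat.pos_of_ne_zero hm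
  have hmem : ∀ j ∈ Finset.range (m + 1), 2 / (m : ℝ) * (j : ℝ) - 1 ∈ nGrid (m + 1) :=
    fun j hj => (mem_nGrid_succ hm).2 ⟨j, by rw [Finset.mem_range] at hj; omega, rfl⟩
  by_contra! h
  refine hp (eq_zero_of_natDegree_lt_card_of_eval_eq_zero' p
    ((Finset.range (m + 1)).image fun j : ℕ => 2 / (m : ℝ) * (j : ℝ) - 1) ?_ ?_)
  · intro x hx
    obtain ⟨j, hj, rfl⟩ := Finset.mem_image.1 hx
    exact abs_nonpos_iff.1 ((abs_eval_le_normE (hmem j hj) p).trans h)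
  · rw [Finset.card_image_of_injective, Finset.card_range]
    · omega
    · intro i j hij
      have h2 : (2 / (m : ℝ)) ≠ 0 := by positivity
      simpa [h2] using hij

theorem natDegree_comp_affine_le (p : ℝ[X]) (a b : ℝ) :
    (p.comp (C a * X + C b)).natDegree ≤ p.natDegree := by
  refine natDegree_comp_le.trans ?_
  exact (Nat.mul_le_mul_left _ natDegree_linear_le).trans_eq (mul_one _)

theorem normI_le_mul_normE {m d : ℕ} (hm : 16 ≤ m) (hd : d ≤ m) {p : ℝ[X]}
    (hp : p.natDegree ≤ d) :
    normI p ≤ 12 * (m + 1) ^ 13 * √(gramRatio (m + 1) d) * normE (m + 1) p := by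
  have hm' : (0 : ℝ) < m := by exact_mod_cast (by omega : 0 < m)
  refine normI_le fun x hx => ?_
  have h := abs_eval_le_of_grid hm hd (p := p.comp (C (2 / (m : ℝ)) * X + C (-1)))
    ((natDegree_comp_affine_le _ _ _).trans hp) (G := normE (m + 1) p) (fun j hj => by
      rw [eval_comp]
      refine abs_eval_le_normE ((mem_nGrid_succ (by omega)).2 ⟨j, hj, ?_⟩) p
      simp [sub_eq_add_neg]) (x := m / 2 * (x + 1))
    ⟨mul_nonneg (by positivity) (by linarith [hx.1]), by nlinarith [hx.2]⟩
  rw [eval_comp] at h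
  simp only [eval_add, eval_mul, eval_C, eval_X] at h
  rwa [show 2 / (m : ℝ) * (m / 2 * (x + 1)) + -1 = x by field_simp; ring] at h

theorem sqrt_gramRatio_mul_normE_le {m d : ℕ} (hm : m ≠ 0) (hd1 : 1 ≤ d) (hd : d ≤ m) {p : ℝ[X]}
    (hp : p.Monic) (hpd : p.natDegree = d)
    (hmin : ∀ q : ℝ[X], q.Monic → q.natDegree = d → normE (m + 1) p ≤ normE (m + 1) q) :
    √(gramRatio (m + 1) d) * normE (m + 1) p ≤ Real.exp (d * √(4 / m)) * normI p := by
  have hm' : (0 : ℝ) < m := by exact_mod_cast Nat.pos_of_ne_zero hm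
  have hE := normE_pos hm hp.ne_zero (hpd.le.trans hd)
  have hIE : normE (m + 1) p ≤ normI p := by
    obtain ⟨x, hx, h⟩ := exists_normE_eq (by omega : 1 ≤ m + 1) p
    rw [h]
    obtain ⟨j, hj, rfl⟩ := (mem_nGrid_succ hm).1 hx
    have hj' : (j : ℝ) ≤ m := by exact_mod_cast hj
    refine abs_eval_le_normI ⟨?_, ?_⟩ p
    · have : 0 ≤ 2 / (m : ℝ) * j := by positivity
      linarith
    · have : 2 / (m : ℝ) * j ≤ 2 := by rw [div_mul_eq_mul_div, div_le_iff₀ hm']; linarith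
      linarith
  have hh := sum_gramPoly_sq_pos hd
  have hR := choose_sq_eq_gramRatio_mul hd
  set h := ∑ x ∈ Finset.range (m + 1), (gramPoly m d).eval (x : ℝ) ^ 2 with hhdef
  have hext := mul_abs_eval_le_of_minimal (s := nGrid (m + 1)) (b := -1 - 2 / m) (c := 2 / m)
    (E := normE (m + 1) p) (G := √h) (by positivity) (fun x hx => by
      obtain ⟨j, hj, rfl⟩ := (mem_nGrid_succ hm).1 hx
      have : 0 ≤ 2 / (m : ℝ) * j := by positivity
      linarith) hd1 hp hpd
    (q := (gramPoly m d).comp (C ((m : ℝ) / 2) * X + C ((m : ℝ) / 2)))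
    ((natDegree_comp_affine_le _ _ _).trans (natDegree_gramPoly_le m d))
    (fun x hx => abs_eval_le_normE hx p) (fun x hx => by
      obtain ⟨j, hj, rfl⟩ := (mem_nGrid_succ hm).1 hx
      rw [eval_comp]
      simp only [eval_add, eval_mul, eval_C, eval_X]
      rw [show (m : ℝ) / 2 * (2 / m * j - 1) + m / 2 = j by field_simp; ring]
      refine Real.abs_le_sqrt ?_
      exact Finset.single_le_sum (f := fun x : ℕ => (gramPoly m d).eval (x : ℝ) ^ 2)
        (fun _ _ => sq_nonneg _) (Finset.mem_range.2 (by omega)))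
    (fun r hr hrd => by
      obtain ⟨x, hx, hxr⟩ := exists_normE_eq (by omega : 1 ≤ m + 1) r
      exact ⟨x, hx, hxr ▸ hmin r hr hrd⟩)
  rw [eval_comp] at hext
  simp only [eval_add, eval_mul, eval_C, eval_X] at hext
  rw [show (m : ℝ) / 2 * (-1 - 2 / m) + m / 2 = -1 by field_simp; ring, gramPoly_eval_neg_one hd,
    abs_of_nonneg (Nat.cast_nonneg _), ← Real.sqrt_sq (Nat.cast_nonneg ((m + 1 + d).choose d)), hR,
    Real.sqrt_mul' _ hh.le] at hext
  have hb := abs_eval_neg_one_sub_le hpd.le (hE.trans_le hIE) (fun x hx => abs_eval_le_normI hx p)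
    (y := 2 / m) (by positivity)
  rw [show (2 : ℝ) * (2 / m) = 4 / m by ring] at hb
  refine le_trans ?_ hb
  have hs : 0 < √h := Real.sqrt_pos.2 hh
  refine le_of_mul_le_mul_left ?_ hs
  linarith

/-! ### Asymptotics -/

theorem mul_log_sub_le_log_factorial (k : ℕ) :
    k * Real.log k - k ≤ Real.log (k.factorial : ℝ) := by
  rcases Nat.eq_zero_or_pos k with rfl | hk
  · simp
  have h := Stirling.le_log_factorial_stirling hk.ne'
  have h1 : 0 ≤ Real.log k := Real.log_natCast_nonneg k
  have h2 : 0 ≤ Real.log (2 * Real.pi) := Real.log_nonneg (by linarith [Real.pi_gt_three])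
  linarith

theorem log_factorial_le {k : ℕ} (hk : 1 ≤ k) :
    Real.log (k.factorial : ℝ) ≤ k * Real.log k - k + Real.log (2 * k) / 2 + 1 := by
  obtain ⟨j, rfl⟩ := Nat.exists_eq_add_of_le' hk
  have h := Stirling.log_stirlingSeq'_antitone (Nat.zero_le j)
  simp only [Function.comp_apply, Nat.succ_eq_add_one, zero_add, Stirling.log_stirlingSeq_formula]
    at h
  rw [Real.log_div (by positivity) (Real.exp_ne_zero 1), Real.log_exp] at h
  have h2 := Real.log_nonneg one_le_two
  norm_num at h ⊢
  linarith

theorem tendsto_log_natCast_div :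
    Tendsto (fun n : ℕ => Real.log n / (n : ℝ)) atTop (nhds 0) :=
  (Real.isLittleO_log_id_atTop.tendsto_div_nhds_zero).comp tendsto_natCast_atTop_atTop

theorem tendsto_log_factorial_sub {k : ℕ → ℕ} {c : ℝ} (hk : ∀ n, k n ≤ 2 * n)
    (hc : Tendsto (fun n : ℕ => (k n : ℝ) / n) atTop (nhds c)) :
    Tendsto (fun n : ℕ => (Real.log ((k n).factorial : ℝ) - k n * Real.log n + k n) / n) atTop
      (nhds (c * Real.log c)) := by
  have h1 := (Real.continuous_mul_log.tendsto c).comp hc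
  have h2 : Tendsto (fun n : ℕ => (Real.log ((k n).factorial : ℝ) - k n * Real.log (k n) + k n)
      / n) atTop (nhds 0) := by
    have h3 : Tendsto (fun n : ℕ => Real.log n / (n : ℝ) / 2 + (Real.log 4 / 2 + 1) / n) atTop
        (nhds (0 / 2 + 0)) :=
      (tendsto_log_natCast_div.div_const 2).add (tendsto_const_div_atTop_nhds_zero_nat _)
    rw [zero_div, add_zero] at h3
    refine squeeze_zero' (Eventually.of_forall fun n => ?_) ?_ h3
    · have := mul_log_sub_le_log_factorial (k n)
      exact div_nonneg (by linarith) (Nat.cast_nonneg n)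
    · filter_upwards [eventually_ge_atTop 1] with n hn
      have hn' : (0 : ℝ) < n := by exact_mod_cast hn
      have h4 : Real.log n / (n : ℝ) / 2 + (Real.log 4 / 2 + 1) / n =
          (Real.log (4 * n) / 2 + 1) / n := by
        rw [Real.log_mul (by norm_num) hn'.ne']; ring
      rw [h4]
      refine div_le_div_of_nonneg_right ?_ hn'.le
      have h5 : 0 ≤ Real.log (4 * n) :=
        Real.log_nonneg (by have : (1 : ℝ) ≤ n := by exact_mod_cast hn
                            linarith)
      rcases Nat.eq_zero_or_pos (k n) with h0 | h0
      · simp only [h0, Nat.factorial_zero, Nat.cast_one, Real.log_one, Nat.cast_zero]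
        linarith
      · have h6 := log_factorial_le h0
        have h7 : Real.log (2 * (k n : ℝ)) ≤ Real.log (4 * n) := by
          refine Real.log_le_log (by positivity) ?_
          have : (k n : ℝ) ≤ 2 * n := by exact_mod_cast hk n
          linarith
        linarith
  have h3 := h2.add h1
  rw [zero_add] at h3
  refine h3.congr' ?_
  filter_upwards [eventually_ge_atTop 1] with n hn
  have hn' : (0 : ℝ) < n := by exact_mod_cast hn
  simp only [Function.comp_apply]
  rcases Nat.eq_zero_or_pos (k n) with h0 | h0
  · simp [h0]
  · rw [Real.log_div (by positivity) hn'.ne']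
    ring

theorem tendsto_log_gramRatio {α : ℝ} (hα : α ∈ Ioo (0 : ℝ) 1) :
    Tendsto (fun n : ℕ => Real.log (gramRatio n ⌊α * (n : ℝ)⌋₊) / n) atTop
      (nhds (2 * Cconst α)) := by
  obtain ⟨hα0, hα1⟩ := hα
  set d : ℕ → ℕ := fun n => ⌊α * (n : ℝ)⌋₊ with hd
  have hdn : ∀ n, d n ≤ n := fun n => Nat.floor_le_of_le (by nlinarith [n.cast_nonneg (α := ℝ)])
  have hdn' : ∀ n, 1 ≤ n → d n < n := fun n hn => by
    have : (0 : ℝ) < n := by exact_mod_cast hn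
    exact (Nat.floor_lt (by positivity)).2 (by nlinarith)
  have hdlim : Tendsto (fun n : ℕ => (d n : ℝ) / n) atTop (nhds α) :=
    (tendsto_nat_floor_mul_div_atTop hα0.le).comp tendsto_natCast_atTop_atTop
  have hinv : Tendsto (fun n : ℕ => (1 : ℝ) / n) atTop (nhds 0) :=
    tendsto_const_div_atTop_nhds_zero_nat 1
  have hone : Tendsto (fun n : ℕ => (n : ℝ) / n) atTop (nhds 1) :=
    tendsto_const_nhds.congr' (by
      filter_upwards [eventually_ne_atTop 0] with n hn
      exact (div_self (by exact_mod_cast hn)).symm)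
  have h1 := tendsto_log_factorial_sub (k := fun n => n + d n) (c := 1 + α)
    (fun n => by have := hdn n; omega) (by
      refine (hone.add hdlim).congr fun n => ?_
      push_cast; ring)
  have h2 := tendsto_log_factorial_sub (k := fun n => n - d n - 1) (c := 1 - α)
    (fun n => by omega) (by
      have h := (hone.sub hdlim).sub hinv
      rw [sub_zero] at h
      refine h.congr' ?_
      filter_upwards [eventually_ge_atTop 1] with n hn
      have := hdn' n hn
      rw [Nat.cast_sub (by omega), Nat.cast_sub (by omega)]
      push_cast; ring)
  have h3 := tendsto_log_factorial_sub (k := fun n => n) (fun n => by omega) hone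
  have h4 : Tendsto (fun n : ℕ => Real.log (2 * d n + 1) / n) atTop (nhds 0) := by
    have h : Tendsto (fun n : ℕ => Real.log 3 / (n : ℝ) + Real.log n / n) atTop (nhds (0 + 0)) :=
      (tendsto_const_div_atTop_nhds_zero_nat _).add tendsto_log_natCast_div
    rw [add_zero] at h
    refine squeeze_zero' (Eventually.of_forall fun n => ?_) ?_ h
    · exact div_nonneg (Real.log_nonneg (by linarith [(d n).cast_nonneg (α := ℝ)]))
        (Nat.cast_nonneg n)
    · filter_upwards [eventually_ge_atTop 1] with n hn
      have hn' : (0 : ℝ) < n := by exact_mod_cast hn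
      rw [← add_div, ← Real.log_mul (by norm_num) hn'.ne']
      gcongr
      have h5 : (d n : ℝ) ≤ n := by exact_mod_cast hdn n
      have h6 : (1 : ℝ) ≤ n := by exact_mod_cast hn
      linarith
  have h5 := (((h4.add h1).add h2).sub (h3.const_mul 2)).add
    (hinv.sub tendsto_log_natCast_div)
  rw [show 0 + (1 + α) * Real.log (1 + α) + (1 - α) * Real.log (1 - α) - 2 * (1 * Real.log 1)
    + (0 - 0) = 2 * Cconst α by simp [Cconst]; ring] at h5
  refine h5.congr' ?_
  filter_upwards [eventually_ge_atTop 1] with n hn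
  have hn' : (0 : ℝ) < n := by exact_mod_cast hn
  have h6 := hdn' n hn
  have h7 : ((n - d n - 1 : ℕ) : ℝ) = n - d n - 1 := by
    rw [Nat.cast_sub (by omega), Nat.cast_sub (by omega)]; simp
  have h8 : Real.log (gramRatio n (d n)) = Real.log (2 * d n + 1) +
      Real.log ((n + d n).factorial : ℝ) + Real.log ((n - d n - 1).factorial : ℝ) -
      2 * Real.log (n.factorial : ℝ) := by
    have e1 : ((n + d n).factorial : ℝ) ≠ 0 := by positivity
    have e2 : ((n - d n - 1).factorial : ℝ) ≠ 0 := by positivity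
    rw [gramRatio, Real.log_div (by positivity) (by positivity), Real.log_pow,
      Real.log_mul (by positivity) e2, Real.log_mul (by positivity) e1]
    push_cast; ring
  rw [h8, h7]
  push_cast
  ring

theorem chebyshev_grid_ratio_limit (α : ℝ) (hα : α ∈ Set.Ioo (0 : ℝ) 1)
    (P : ℕ → Polynomial ℝ)
    (hmonic : ∀ n : ℕ, 2 ≤ n → (P n).Monic)
    (hdeg : ∀ n : ℕ, 2 ≤ n → (P n).natDegree = ⌊α * (n : ℝ)⌋₊)
    (hmin : ∀ n : ℕ, 2 ≤ n → ∀ Q : Polynomial ℝ, Q.Monic → Q.natDegree = ⌊α * (n : ℝ)⌋₊ →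
      normE n (P n) ≤ normE n Q) :
    Tendsto (fun n : ℕ => (n : ℝ)⁻¹ * Real.log (normI (P n) / normE n (P n)))
      atTop (nhds (Cconst α)) := by
  have hR := (tendsto_log_gramRatio hα).div_const 2
  rw [mul_div_cancel_left₀ _ two_ne_zero] at hR
  have hsqrt : Tendsto (fun n : ℕ => √(4 / ((n - 1 : ℕ) : ℝ))) atTop (nhds 0) := by
    have h := ((tendsto_const_div_atTop_nhds_zero_nat (4 : ℝ)).comp (tendsto_sub_atTop_nat 1)).sqrt
    rwa [Real.sqrt_zero] at h
  have hlow := hR.sub hsqrt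
  have hupp := (hR.add (tendsto_log_natCast_div.const_mul 13)).add
    (tendsto_const_div_atTop_nhds_zero_nat (Real.log 12))
  rw [sub_zero] at hlow
  rw [mul_zero, add_zero, add_zero] at hupp
  have key : ∀ᶠ n : ℕ in atTop, 16 ≤ n - 1 ∧ 1 ≤ ⌊α * (n : ℝ)⌋₊ := by
    refine ((tendsto_sub_atTop_nat 1).eventually_ge_atTop 16).and ?_
    exact (tendsto_nat_floor_atTop.comp
      (tendsto_natCast_atTop_atTop.const_mul_atTop hα.1)).eventually_ge_atTop 1
  have bounds : ∀ᶠ n : ℕ in atTop,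
      Real.log (gramRatio n ⌊α * (n : ℝ)⌋₊) / n / 2 - √(4 / ((n - 1 : ℕ) : ℝ)) ≤
        (n : ℝ)⁻¹ * Real.log (normI (P n) / normE n (P n)) ∧
      (n : ℝ)⁻¹ * Real.log (normI (P n) / normE n (P n)) ≤
        Real.log (gramRatio n ⌊α * (n : ℝ)⌋₊) / n / 2 + 13 * (Real.log n / n) +
          Real.log 12 / n := by
    filter_upwards [key] with n hn
    obtain ⟨m, rfl⟩ : ∃ m, n = m + 1 := ⟨n - 1, by omega⟩
    rw [Nat.add_sub_cancel] at hn ⊢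
    obtain ⟨hm, hd1⟩ := hn
    have hn0 : (0 : ℝ) < ((m + 1 : ℕ) : ℝ) := by positivity
    set d := ⌊α * ((m + 1 : ℕ) : ℝ)⌋₊ with hd
    have hdm : d ≤ m := by
      refine Nat.lt_succ_iff.1 ((Nat.floor_lt (mul_nonneg hα.1.le hn0.le)).2 ?_)
      exact mul_lt_of_lt_one_left hn0 hα.2
    have hp := hmonic (m + 1) (by omega)
    have hpd := hdeg (m + 1) (by omega)
    have hE := normE_pos (by omega) hp.ne_zero (hpd.le.trans hdm)
    have hU := normI_le_mul_normE hm hdm hpd.le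
    have hL := sqrt_gramRatio_mul_normE_le (by omega) hd1 hdm hp hpd (hmin (m + 1) (by omega))
    have hRpos : 0 < gramRatio (m + 1) d := by
      by_contra! h
      have h2 := one_le_mul_gramRatio hdm
      have h3 : ((m : ℝ) + 1) * gramRatio (m + 1) d ≤ 0 :=
        mul_nonpos_of_nonneg_of_nonpos (by positivity) h
      linarith
    have hs := Real.sqrt_pos.2 hRpos
    rw [← div_le_iff₀ hE] at hU
    rw [← le_div_iff₀ hE, mul_div_assoc, ← div_le_iff₀' (Real.exp_pos _)] at hL
    have hq : 0 < normI (P (m + 1)) / normE (m + 1) (P (m + 1)) :=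
      lt_of_lt_of_le (by positivity) hL
    have hL' := Real.log_le_log (by positivity) hL
    have hU' := Real.log_le_log hq hU
    rw [Real.log_div hs.ne' (Real.exp_ne_zero _), Real.log_exp, Real.log_sqrt hRpos.le] at hL'
    rw [Real.log_mul (by positivity) hs.ne', Real.log_mul (by norm_num) (by positivity),
      Real.log_pow, Real.log_sqrt hRpos.le] at hU'
    set L := Real.log (normI (P (m + 1)) / normE (m + 1) (P (m + 1))) with hLdef
    have hdn : (d : ℝ) ≤ ((m + 1 : ℕ) : ℝ) := by exact_mod_cast hdm.trans (Nat.le_succ m)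
    rw [inv_mul_eq_div]
    constructor
    · rw [le_div_iff₀ hn0]
      have h1 := mul_le_mul_of_nonneg_right hdn (Real.sqrt_nonneg (4 / (m : ℝ)))
      refine le_trans (le_of_eq ?_) ((sub_le_sub_left h1 _).trans hL')
      field_simp
    · rw [div_le_iff₀ hn0]
      refine hU'.trans (le_of_eq ?_)
      push_cast
      field_simp
      ring
  exact tendsto_of_tendsto_of_tendsto_of_le_of_le' hlow hupp
    (bounds.mono fun _ h => h.1) (bounds.mono fun _ h => h.2)
end
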